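/- Let X be a geometrically integral curve over a perfect field k, let L ⊇ k be an algebraic field extension, and let d = γ_L(X). If X has a k-rational point and d > 2, then γ_k(X) ≤ (d − 1)². -/

import Mathlib

open IntermediateField

/-- The gonality of the function field `F` of a curve over `k`: the smallest degree
`[F : k(f)]` of a nonconstant rational function `f ∈ F`, i.e. the smallest degree of a
dominant rational map from the curve to `ℙ¹_k`. -/
noncomputable def gonality (k F : Type*) [Field k] [Field F] [Algebra k F] : ℕ :=
  sInf {d : ℕ | ∃ f : F, Transcendental k f ∧
    Module.finrank (IntermediateField.adjoin k {f}) F = d}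

/-- `F` is the function field of a curve over `k`: a finitely generated field extension of
transcendence degree 1, i.e. a finite extension of some `k(x)` with `x` transcendental. -/
def IsFunctionField (k F : Type*) [Field k] [Field F] [Algebra k F] : Prop :=
  ∃ x : F, Transcendental k x ∧
    FiniteDimensional (IntermediateField.adjoin k {x}) F

/-- A place of the function field `F/k`: a valuation subring of `F` containing `k`
and different from `F` itself.  These correspond to the closed points of the smooth
projective model of the curve. -/
structure FFPlace (k F : Type*) [Field k] [Field F] [Algebra k F] where
  asSubring : ValuationSubring F
  algebraMap_mem : ∀ a : k, algebraMap k F a ∈ asSubring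
  ne_top : asSubring ≠ ⊤

variable (k F : Type*) [Field k] [Field F] [Algebra k F]

/-- The degree of a place: the `k`-dimension of its residue field. -/
noncomputable def FFPlace.degree (P : FFPlace k F) : ℕ :=
  letI : Algebra k (IsLocalRing.ResidueField P.asSubring) :=
    ((IsLocalRing.residue (P.asSubring : Type _)).comp
      ((algebraMap k F).codRestrict P.asSubring.toSubring P.algebraMap_mem)).toAlgebra
  Module.finrank k (IsLocalRing.ResidueField P.asSubring)

/-- The space of adeles (repartitions) of `F/k`: families `(α_P)_P` indexed by the places of
`F/k` with `α_P` integral at all but finitely many places, as a `k`-submodule of `Π_P F`. -/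
def adeleSubmodule : Submodule k (FFPlace k F → F) where
  carrier := {α | {P : FFPlace k F | α P ∉ P.asSubring}.Finite}
  zero_mem' := by
    show {P : FFPlace k F | (0 : F) ∉ P.asSubring}.Finite
    convert Set.finite_empty using 2
    ext P
    simp [zero_mem]
  add_mem' := by
    intro a b ha hb
    refine Set.Finite.subset (ha.union hb) ?_
    intro P hP
    rw [Set.mem_union]
    by_contra h
    push_neg at h
    simp only [Set.mem_setOf_eq, not_not] at h
    exact hP (add_mem h.1 h.2)
  smul_mem' := by
    intro c α hα
    refine Set.Finite.subset hα ?_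
    intro P hP
    by_contra h
    simp only [Set.mem_setOf_eq, not_not] at h
    refine hP ?_
    show c • α P ∈ P.asSubring
    rw [Algebra.smul_def]
    exact mul_mem (P.algebraMap_mem c) h

/-- The adeles that are integral at every place. -/
def integralAdeles : Submodule k (FFPlace k F → F) where
  carrier := {α | ∀ P : FFPlace k F, α P ∈ P.asSubring}
  zero_mem' := fun P => zero_mem _
  add_mem' := fun ha hb P => add_mem (ha P) (hb P)
  smul_mem' := by
    intro c α hα P
    show c • α P ∈ P.asSubring
    rw [Algebra.smul_def]
    exact mul_mem (P.algebraMap_mem c) (hα P)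

/-- The principal adeles: the diagonal image of `F`. -/
def principalAdeles : Submodule k (FFPlace k F → F) :=
  LinearMap.range (LinearMap.pi fun _ : FFPlace k F => (LinearMap.id : F →ₗ[k] F))

/-- The genus of the function field `F/k`, defined à la Chevalley/Weil as the `k`-dimension of
`A / (A(0) + F)`, where `A` is the space of adeles, `A(0)` the everywhere-integral ones and `F`
the principal ones.  For the function field of a geometrically integral smooth projective curve
this is the usual genus. -/
noncomputable def genus : ℕ :=
  Module.finrank k
    (↥(adeleSubmodule k F) ⧸
      ((integralAdeles k F ⊔ principalAdeles k F).comap (adeleSubmodule k F).subtype))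

namespace GonalityAux

section Pencil

variable {K E : Type*} [Field K] [Field E] [Algebra K E]

theorem card_le_finrank_of_mem {ι : Type*} [Fintype ι] {S : Submodule K E} (hS : S.FG)
    {v : ι → E} (hv : LinearIndependent K v) (h : ∀ i, v i ∈ S) :
    Fintype.card ι ≤ Module.finrank K S := by
  have : Module.Finite K S := Module.Finite.iff_fg.mpr hS
  have : LinearIndependent K (fun i => (⟨v i, h i⟩ : S)) :=
    LinearIndependent.of_comp S.subtype (by simpa [Function.comp_def] using hv)
  exact this.fintype_card_le_finrank

theorem finrank_mono_of_fg {A B : Submodule K E} (hB : B.FG) (h : A ≤ B) :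
    Module.finrank K A ≤ Module.finrank K B := by
  have : Module.Finite K B := Module.Finite.iff_fg.mpr hB
  exact Submodule.finrank_mono h

theorem fg_of_le {A B : Submodule K E} (hB : B.FG) (h : A ≤ B) : A.FG := by
  have : Module.Finite K B := Module.Finite.iff_fg.mpr hB
  have := Submodule.finiteDimensional_of_le h
  exact Module.Finite.iff_fg.mp this

theorem finrank_mul_le {A B : Submodule K E} (hA : A.FG) (hB : B.FG) :
    Module.finrank K (A * B : Submodule K E) ≤ Module.finrank K A * Module.finrank K B := by
  have : Module.Finite K A := Module.Finite.iff_fg.mpr hA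
  have : Module.Finite K B := Module.Finite.iff_fg.mpr hB
  let a := Module.finBasis K A
  let b := Module.finBasis K B
  have hA' : A = Submodule.span K (Set.range fun i => (a i : E)) := by
    have := congrArg (Submodule.map A.subtype) a.span_eq
    rw [Submodule.map_span, Submodule.map_top, Submodule.range_subtype, ← Set.range_comp] at this
    exact this.symm
  have hB' : B = Submodule.span K (Set.range fun i => (b i : E)) := by
    have := congrArg (Submodule.map B.subtype) b.span_eq
    rw [Submodule.map_span, Submodule.map_top, Submodule.range_subtype, ← Set.range_comp] at this
    exact this.symm
  have : A * B = Submodule.span K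
      (Set.range fun p : Fin (Module.finrank K A) × Fin (Module.finrank K B) =>
        (a p.1 : E) * (b p.2 : E)) := by
    conv_lhs => rw [hA', hB', Submodule.span_mul_span]
    congr 1
    ext x
    simp [Set.mem_mul]
  rw [this]
  refine (finrank_range_le_card _).trans ?_
  simp

/-- The two-dimensional space (pencil) spanned by `1` and `z`. -/
def pencil (K : Type*) {E : Type*} [Field K] [Field E] [Algebra K E] (z : E) : Submodule K E :=
  Submodule.span K {1, z}

theorem one_mem_pencil (z : E) : (1 : E) ∈ pencil K z := Submodule.subset_span (by simp)

theorem self_mem_pencil (z : E) : z ∈ pencil K z := Submodule.subset_span (by simp)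

theorem one_le_pencil (z : E) : 1 ≤ pencil K z := Submodule.one_le.mpr (one_mem_pencil z)

theorem pencil_le {z : E} {S : Submodule K E} (h1 : (1 : E) ∈ S) (hz : z ∈ S) :
    pencil K z ≤ S := by
  rw [pencil, Submodule.span_le]
  rintro x (rfl | rfl)
  · exact h1
  · exact hz

theorem fg_pencil (z : E) : (pencil K z).FG := Submodule.fg_span (by simp)

theorem mem_pencil {z x : E} :
    x ∈ pencil K z ↔ ∃ a b : K, x = algebraMap K E a + algebraMap K E b * z := by
  rw [pencil, Submodule.mem_span_pair]
  simp only [Algebra.smul_def, mul_one, eq_comm]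

theorem pencil_pow (z : E) (m : ℕ) :
    pencil K z ^ m = Submodule.span K ((fun i : ℕ => z ^ i) '' (Set.Iic m)) := by
  induction m with
  | zero => simp [Submodule.one_eq_span, Set.Iic]
  | succ m ih =>
    rw [pow_succ, ih, pencil, Submodule.span_mul_span]
    congr 1
    ext x
    simp only [Set.mem_mul, Set.mem_image, Set.mem_Iic, Set.mem_insert_iff,
      Set.mem_singleton_iff]
    constructor
    · rintro ⟨_, ⟨i, hi, rfl⟩, _, rfl | rfl, rfl⟩
      · exact ⟨i, by omega, by simp⟩
      · exact ⟨i + 1, by omega, by rw [pow_succ]⟩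
    · rintro ⟨i, hi, rfl⟩
      rcases Nat.lt_or_ge m i with h | h
      · obtain rfl : i = m + 1 := by omega
        exact ⟨_, ⟨m, le_rfl, rfl⟩, z, Or.inr rfl, by rw [pow_succ]⟩
      · exact ⟨_, ⟨i, h, rfl⟩, 1, Or.inl rfl, by simp⟩

theorem pow_mem_pencil_pow (z : E) {i m : ℕ} (h : i ≤ m) : z ^ i ∈ pencil K z ^ m := by
  rw [pencil_pow]
  exact Submodule.subset_span ⟨i, h, rfl⟩

theorem finrank_pencil_pow_le (z : E) (m : ℕ) :
    Module.finrank K (pencil K z ^ m : Submodule K E) ≤ m + 1 := by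
  rw [pencil_pow]
  have : (fun i : ℕ => z ^ i) '' (Set.Iic m) = Set.range (fun i : Fin (m + 1) => z ^ (i : ℕ)) := by
    ext x
    simp only [Set.mem_image, Set.mem_Iic, Set.mem_range]
    constructor
    · rintro ⟨i, hi, rfl⟩
      exact ⟨⟨i, by omega⟩, rfl⟩
    · rintro ⟨i, rfl⟩
      exact ⟨i, by omega, rfl⟩
  rw [this]
  exact (finrank_range_le_card (R := K) (fun i : Fin (m + 1) => z ^ (i : ℕ))).trans (by simp)

theorem le_mul_of_one_le {A B : Submodule K E} (h : 1 ≤ B) : A ≤ A * B := by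
  simpa using mul_le_mul_right h A

theorem pow_le_pow_of_one_le {A : Submodule K E} (h : 1 ≤ A) {m n : ℕ} (hmn : m ≤ n) :
    A ^ m ≤ A ^ n := by
  exact pow_le_pow_right' h hmn

/-- Polynomial expressions of degree at most `m` in `z` lie in the `m`-th power of the pencil. -/
theorem aeval_mem_pencil_pow (z : E) {p : Polynomial K} {m : ℕ} (h : p.natDegree ≤ m) :
    Polynomial.aeval z p ∈ pencil K z ^ m := by
  rw [Polynomial.aeval_eq_sum_range]
  refine Submodule.sum_mem _ fun i hi => Submodule.smul_mem _ _ (pow_mem_pencil_pow z ?_)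
  simp at hi
  omega

theorem card_mul_finrank_le (M : IntermediateField K E) {ι : Type*} [Fintype ι] {w : ι → E}
    (hw : LinearIndependent M w) {A W : Submodule K E} (hA : A.FG) (hW : W.FG)
    (hwW : ∀ i, w i ∈ W) (hAM : ∀ x ∈ A, x ∈ M) :
    Fintype.card ι * Module.finrank K A ≤ Module.finrank K (W * A : Submodule K E) := by
  have : Module.Finite K A := Module.Finite.iff_fg.mpr hA
  let a := Module.finBasis K A
  have ha : LinearIndependent K (fun j => (⟨a j, hAM _ (a j).2⟩ : M)) := by
    refine LinearIndependent.of_comp M.val.toLinearMap ?_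
    have := a.linearIndependent.map' A.subtype (Submodule.ker_subtype _)
    simpa [Function.comp_def] using this
  have h := linearIndependent_smul ha hw
  have := card_le_finrank_of_mem (S := W * A) (hW.mul hA) h ?_
  · rw [Fintype.card_prod, Fintype.card_fin, mul_comm] at this
    exact this
  · rintro ⟨j, i⟩
    rw [Algebra.smul_def, mul_comm (algebraMap M E _)]
    exact Submodule.mul_mem_mul (hwW i) (a j).2

end Pencil

section Rank

variable {K E : Type*} [Field K] [Field E] [Algebra K E]

theorem finrank_add_card_le_mul_pencil {z : E} (hz : Transcendental K z) {W : Submodule K E}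
    (hW : W.FG) {ι : Type*} [Fintype ι] {b : ι → E} (hb : LinearIndependent K⟮z⟯ b)
    (hbW : ∀ i, b i ∈ Submodule.span K⟮z⟯ (W : Set E)) :
    Module.finrank K W + Fintype.card ι ≤ Module.finrank K (W * pencil K z : Submodule K E) := by
  have : Module.Finite K W := Module.Finite.iff_fg.mpr hW
  let Q : Submodule K W := Submodule.comap ((LinearMap.mulLeft K z).comp W.subtype) W
  obtain ⟨C, hC⟩ := Q.exists_isCompl
  have : Module.Free K C := Module.Free.of_divisionRing K C
  let q : W →ₗ[K] W := Q.projection C hC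
  let c := Module.finBasis K C
  let N : Submodule K⟮z⟯ E := Submodule.span K⟮z⟯ (Set.range fun j => ((c j : W) : E))
  have hCN : ∀ x : C, ((x : W) : E) ∈ N := by
    intro x
    have h := congrArg (fun y : C => ((y : W) : E)) (c.sum_repr x)
    simp only [Submodule.coe_sum, Submodule.coe_smul] at h
    rw [← h]
    refine Submodule.sum_mem _ fun j _ => ?_
    rw [← IsScalarTower.algebraMap_smul K⟮z⟯ (c.repr x j)]
    exact Submodule.smul_mem _ _ (Submodule.subset_span ⟨j, rfl⟩)
  have hzN : ∀ x ∈ N, z * x ∈ N := fun x hx =>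
    N.smul_mem (⟨z, mem_adjoin_simple_self K z⟩ : K⟮z⟯) hx
  let T : W →ₗ[K] W := LinearMap.codRestrict W
    ((LinearMap.mulLeft K z).comp (W.subtype.comp q)) (fun w => Submodule.projection_apply_mem hC w)
  have hT : ∀ w : W, z * (w : E) - (T w : E) ∈ N := by
    intro w
    have h : w - q w ∈ C := Submodule.sub_projection_mem hC w
    have h2 := hzN _ (hCN ⟨_, h⟩)
    have h3 : (T w : E) = z * (q w : W) := rfl
    rw [h3, ← mul_sub]
    exact h2
  have hpow : ∀ (n : ℕ) (w : W), z ^ n * (w : E) - ((T ^ n) w : W) ∈ N := by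
    intro n
    induction n with
    | zero => intro w; simp
    | succ n ih =>
      intro w
      have := N.add_mem (hzN _ (ih w)) (hT ((T ^ n) w))
      rw [pow_succ' T, Module.End.mul_apply]
      convert this using 1
      ring
  have hpoly : ∀ (p : Polynomial K) (w : W),
      Polynomial.aeval z p * (w : E) - ((Polynomial.aeval T p) w : W) ∈ N := by
    intro p w
    induction p using Polynomial.induction_on' with
    | add p r hp hr =>
      have := N.add_mem hp hr
      simp only [map_add, LinearMap.add_apply, Submodule.coe_add] at this ⊢
      convert this using 1
      ring
    | monomial n a =>
      have := N.smul_mem (algebraMap K K⟮z⟯ a) (hpow n w)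
      rw [IsScalarTower.algebraMap_smul, smul_sub] at this
      simpa [Polynomial.aeval_monomial, Algebra.smul_def, mul_assoc] using this
  have hWN : Submodule.span K⟮z⟯ (W : Set E) ≤ N := by
    rw [Submodule.span_le]
    intro w hw
    have h := hpoly T.charpoly ⟨w, hw⟩
    rw [LinearMap.aeval_self_charpoly] at h
    simp only [LinearMap.zero_apply, Submodule.coe_zero, sub_zero] at h
    have hne : Polynomial.aeval z T.charpoly ≠ 0 := fun h0 =>
      T.charpoly_monic.ne_zero (transcendental_iff.mp hz _ h0)
    have hm : (Polynomial.aeval z T.charpoly)⁻¹ ∈ K⟮z⟯ :=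
      inv_mem (algebra_adjoin_le_adjoin K _ (Polynomial.aeval_mem_adjoin_singleton K z))
    have := N.smul_mem (⟨_, hm⟩ : K⟮z⟯) h
    simpa [Algebra.smul_def, hne, Subring.smul_def] using this
  have h1 : Fintype.card ι ≤ Module.finrank K C := by
    refine (card_le_finrank_of_mem (Submodule.fg_span (Set.finite_range _)) hb
      fun i => hWN (hbW i)).trans ?_
    refine (finrank_range_le_card _).trans ?_
    simp
  have hfg : (W * pencil K z).FG := hW.mul (fg_pencil z)
  have : Module.Finite K (W * pencil K z : Submodule K E) := Module.Finite.iff_fg.mpr hfg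
  let g : (W × C) →ₗ[K] E := LinearMap.coprod W.subtype
    ((LinearMap.mulLeft K z).comp (W.subtype.comp C.subtype))
  have hg : ∀ x, g x ∈ W * pencil K z := by
    rintro ⟨w, x⟩
    refine Submodule.add_mem _ ?_ ?_
    · exact le_mul_of_one_le (one_le_pencil z) w.2
    · simp only [LinearMap.coe_comp, Function.comp_apply, LinearMap.mulLeft_apply]
      rw [mul_comm z]
      exact Submodule.mul_mem_mul x.1.2 (self_mem_pencil z)
  have hinj : Function.Injective (g.codRestrict _ hg) := by
    rw [injective_iff_map_eq_zero]
    rintro ⟨w, x⟩ h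
    have h0 : (w : E) + z * ((x : W) : E) = 0 := congrArg Subtype.val h
    have hxQ : (x : W) ∈ Q := by
      show z * ((x : W) : E) ∈ W
      rw [eq_neg_of_add_eq_zero_right h0]
      exact W.neg_mem w.2
    have hx : (x : W) = 0 := (Submodule.disjoint_def.mp hC.disjoint) _ hxQ x.2
    have hx' : x = 0 := Subtype.ext hx
    subst hx'
    have hw : w = 0 := by simpa using h0
    rw [hw]
    rfl
  have h2 := LinearMap.finrank_le_finrank_of_injective hinj
  rw [Module.finrank_prod] at h2
  omega

end Rank

section Slope

variable {K E : Type*} [Field K] [Field E] [Algebra K E]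

/-- The powers of `V` grow at most linearly with slope `A`, uniformly up to constants, on
finite-dimensional subspaces of `E₀`. -/
def HasSlope (E₀ : IntermediateField K E) (V : Submodule K E) (A : ℕ) : Prop :=
  ∀ U : Submodule K E, U.FG → (∀ u ∈ U, u ∈ E₀) →
    ∃ C : ℕ, ∀ n : ℕ, Module.finrank K (U * V ^ n : Submodule K E) ≤ n * A + C

/-- The powers of `B` are uniformly bounded by those of `T`. -/
def PowDominated (B T : Submodule K E) : Prop :=
  ∃ U : Submodule K E, U.FG ∧ ∀ n : ℕ, B ^ n ≤ U * T ^ n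

theorem PowDominated.mul {B T B' T' : Submodule K E} (h : PowDominated B T)
    (h' : PowDominated B' T') : PowDominated (B * B') (T * T') := by
  obtain ⟨U, hU, h⟩ := h
  obtain ⟨U', hU', h'⟩ := h'
  refine ⟨U * U', hU.mul hU', fun n => ?_⟩
  rw [mul_pow, mul_pow]
  exact (mul_le_mul' (h n) (h' n)).trans_eq (mul_mul_mul_comm _ _ _ _)

theorem PowDominated.trans {A B T : Submodule K E} (h : PowDominated A B)
    (h' : PowDominated B T) : PowDominated A T := by
  obtain ⟨U, hU, h⟩ := h
  obtain ⟨U', hU', h'⟩ := h'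
  refine ⟨U * U', hU.mul hU', fun n => (h n).trans ?_⟩
  rw [mul_assoc]
  exact mul_le_mul' le_rfl (h' n)

theorem PowDominated.refl (A : Submodule K E) : PowDominated A A :=
  ⟨1, by rw [Submodule.one_eq_span]; exact Submodule.fg_span (by simp), fun n => by simp⟩

theorem PowDominated.pow {B T : Submodule K E} (h : PowDominated B T) (m : ℕ) :
    PowDominated (B ^ m) (T ^ m) := by
  induction m with
  | zero => simpa using PowDominated.refl (1 : Submodule K E)
  | succ m ih => rw [pow_succ, pow_succ]; exact ih.mul h

theorem HasSlope.of_dominated {B T : Submodule K E} {A : ℕ}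
    (hT : HasSlope (⊤ : IntermediateField K E) T A)
    (hTfg : T.FG) (h : PowDominated B T) : HasSlope (⊤ : IntermediateField K E) B A := by
  obtain ⟨U', hU', h⟩ := h
  intro U hU _
  obtain ⟨C, hC⟩ := hT (U * U') (hU.mul hU') (fun _ _ => IntermediateField.mem_top)
  refine ⟨C, fun n => le_trans ?_ (hC n)⟩
  refine finrank_mono_of_fg ((hU.mul hU').mul (hTfg.pow n)) ?_
  rw [mul_assoc]
  exact mul_le_mul' le_rfl (h n)

theorem HasSlope.pow {E₀ : IntermediateField K E} {V : Submodule K E} {A : ℕ}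
    (h : HasSlope E₀ V A) (N : ℕ) : HasSlope E₀ (V ^ N) (N * A) := by
  intro U hU hUE
  obtain ⟨C, hC⟩ := h U hU hUE
  refine ⟨C, fun n => ?_⟩
  rw [← pow_mul]
  refine (hC (N * n)).trans (le_of_eq ?_)
  ring

theorem HasSlope.restrict {E₀ : IntermediateField K E} {V : Submodule K E} {e A : ℕ}
    (h : HasSlope (⊤ : IntermediateField K E) V (e * A)) (he : Module.finrank E₀ E = e)
    (he0 : 0 < e) (hV : V.FG) (hVE : ∀ x ∈ V, x ∈ E₀) : HasSlope E₀ V A := by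
  intro U hU hUE
  have : Module.Finite E₀ E := Module.finite_of_finrank_pos (he ▸ he0)
  let w := Module.finBasis E₀ E
  let W : Submodule K E := Submodule.span K (Set.range w)
  have hW : W.FG := Submodule.fg_span (Set.finite_range _)
  obtain ⟨C, hC⟩ := h (W * U) (hW.mul hU) (fun _ _ => IntermediateField.mem_top)
  refine ⟨C, fun n => ?_⟩
  have hle : U * V ^ n ≤ Subalgebra.toSubmodule E₀.toSubalgebra := by
    have h1 : U ≤ Subalgebra.toSubmodule E₀.toSubalgebra := hUE
    have h2 : V ≤ Subalgebra.toSubmodule E₀.toSubalgebra := hVE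
    induction n with
    | zero => simpa using h1
    | succ n ih =>
      rw [pow_succ, ← mul_assoc]
      refine (mul_le_mul' ih h2).trans ?_
      exact (Subalgebra.isIdempotentElem_toSubmodule _).le
  have h1 := card_mul_finrank_le E₀ (w := w) w.linearIndependent (hU.mul (hV.pow n)) hW
    (fun i => Submodule.subset_span ⟨i, rfl⟩) hle
  rw [Fintype.card_fin, he, ← mul_assoc] at h1
  have h2 := hC n
  have h3 : e * Module.finrank K (U * V ^ n : Submodule K E) ≤ e * (n * A + C) := by
    nlinarith
  exact Nat.le_of_mul_le_mul_left h3 he0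

theorem hasSlope_pencil (g : E) [FiniteDimensional K⟮g⟯ E] :
    HasSlope (⊤ : IntermediateField K E) (pencil K g) (Module.finrank K⟮g⟯ E) := by
  let w := Module.finBasis K⟮g⟯ E
  let W : Submodule K E := Submodule.span K (Set.range w)
  have hW : W.FG := Submodule.fg_span (Set.finite_range _)
  have hWr : Module.finrank K W ≤ Module.finrank K⟮g⟯ E :=
    (finrank_range_le_card _).trans (by simp)
  have hmono : ∀ {m n : ℕ}, m ≤ n → W * pencil K g ^ m ≤ W * pencil K g ^ n := fun h =>
    mul_le_mul' le_rfl (pow_le_pow_of_one_le (one_le_pencil g) h)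
  have hmul : ∀ {x : E} {m : ℕ} (p : Polynomial K), x ∈ W * pencil K g ^ m →
      Polynomial.aeval g p * x ∈ W * pencil K g ^ (m + p.natDegree) := by
    intro x m p hx
    rw [pow_add, ← mul_assoc, mul_comm _ x]
    exact Submodule.mul_mem_mul hx (aeval_mem_pencil_pow g le_rfl)
  have hden : ∀ u : E, ∃ (s : Polynomial K) (c : ℕ), Polynomial.aeval g s ≠ 0 ∧
      Polynomial.aeval g s * u ∈ W * pencil K g ^ c := by
    intro u
    have hu : u ∈ Submodule.span K⟮g⟯ (Set.range w) := by rw [w.span_eq]; trivial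
    induction hu using Submodule.span_induction with
    | mem x hx =>
      refine ⟨1, 0, by simp, ?_⟩
      simpa using Submodule.subset_span hx
    | zero => exact ⟨1, 0, by simp, by simp⟩
    | add x y _ _ hx hy =>
      obtain ⟨s, c, hs, h⟩ := hx
      obtain ⟨s', c', hs', h'⟩ := hy
      refine ⟨s * s', (c + s'.natDegree) + (c' + s.natDegree), by simp [hs, hs'], ?_⟩
      have h1 := hmono (Nat.le_add_right _ (c' + s.natDegree)) (hmul s' h)
      have h2 := hmono (Nat.le_add_left _ (c + s'.natDegree)) (hmul s h')
      have := Submodule.add_mem _ h1 h2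
      convert this using 1
      rw [map_mul]
      ring
    | smul r x _ hx =>
      obtain ⟨s, c, hs, h⟩ := hx
      obtain ⟨p, q, hpq⟩ := mem_adjoin_simple_iff K (r : E) |>.mp r.2
      by_cases hq : Polynomial.aeval g q = 0
      · refine ⟨1, 0, by simp, ?_⟩
        rw [hq, div_zero] at hpq
        have hr : r = 0 := Subtype.ext hpq
        simp [hr]
      · refine ⟨q * s, c + p.natDegree, by simp [hs, hq], ?_⟩
        have := hmul p h
        convert this using 1
        have hrx : r • x = (r : E) * x := rfl
        rw [map_mul, hrx, hpq]
        field_simp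
  intro U hU _
  have hU' : ∃ (s : Polynomial K) (c : ℕ), Polynomial.aeval g s ≠ 0 ∧
      ∀ u ∈ U, Polynomial.aeval g s * u ∈ W * pencil K g ^ c := by
    induction U, hU using Submodule.fg_induction with
    | singleton u =>
      obtain ⟨s, c, hs, h⟩ := hden u
      refine ⟨s, c, hs, fun x hx => ?_⟩
      obtain ⟨a, rfl⟩ := Submodule.mem_span_singleton.mp hx
      rw [mul_smul_comm]
      exact Submodule.smul_mem _ _ h
    | sup U U' _ _ h h' =>
      obtain ⟨s, c, hs, h⟩ := h (fun _ _ => IntermediateField.mem_top)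
      obtain ⟨s', c', hs', h'⟩ := h' (fun _ _ => IntermediateField.mem_top)
      refine ⟨s * s', (c + s'.natDegree) + (c' + s.natDegree), by simp [hs, hs'], ?_⟩
      intro x hx
      obtain ⟨y, hy, y', hy', rfl⟩ := Submodule.mem_sup.mp hx
      have h1 := hmono (Nat.le_add_right _ (c' + s.natDegree)) (hmul s' (h y hy))
      have h2 := hmono (Nat.le_add_left _ (c + s'.natDegree)) (hmul s (h' y' hy'))
      have := Submodule.add_mem _ h1 h2
      convert this using 1
      rw [map_mul]
      ring
  obtain ⟨s, c, hs, h⟩ := hU'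
  refine ⟨Module.finrank K⟮g⟯ E * (c + 1), fun n => ?_⟩
  have hfg : (W * pencil K g ^ (c + n)).FG := hW.mul ((fg_pencil g).pow _)
  have : Module.Finite K (W * pencil K g ^ (c + n) : Submodule K E) :=
    Module.Finite.iff_fg.mpr hfg
  have h1 : ∀ x : (U * pencil K g ^ n : Submodule K E),
      (LinearMap.mulLeft K (Polynomial.aeval g s)).domRestrict _ x ∈
        W * pencil K g ^ (c + n) := by
    rintro ⟨x, hx⟩
    simp only [LinearMap.domRestrict_apply, LinearMap.mulLeft_apply]
    induction hx using Submodule.mul_induction_on' with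
    | mem_mul_mem u hu p hp =>
      rw [← mul_assoc, pow_add, ← mul_assoc]
      exact Submodule.mul_mem_mul (h u hu) hp
    | add x _ y _ hx hy => rw [mul_add]; exact Submodule.add_mem _ hx hy
  have hinj : Function.Injective (LinearMap.codRestrict _ _ h1) := by
    rw [LinearMap.injective_codRestrict_iff]
    intro x y hxy
    exact Subtype.ext (mul_left_cancel₀ hs hxy)
  refine (LinearMap.finrank_le_finrank_of_injective hinj).trans ?_
  refine (finrank_mul_le hW ((fg_pencil g).pow _)).trans ?_
  refine (Nat.mul_le_mul hWr (finrank_pencil_pow_le g _)).trans (le_of_eq ?_)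
  ring

end Slope

section Bivariate

open Polynomial Polynomial.Bivariate

variable {K E : Type*} [Field K] [Field E] [Algebra K E]

theorem aevalAeval_eq_eval₂ (x y : E) (p : K[X][X]) :
    aevalAeval x y p = p.eval₂ (aeval x : K[X] →ₐ[K] E).toRingHom y := by
  induction p using Polynomial.induction_on' with
  | add p q hp hq => simp only [map_add, eval₂_add, hp, hq]
  | monomial n a =>
    rw [← C_mul_X_pow_eq_monomial, map_mul, map_pow]
    simp

theorem natDegree_minpoly_mul_finrank {x y : E} [FiniteDimensional K⟮x⟯ E] :
    (minpoly K⟮x⟯ y).natDegree * Module.finrank K⟮x, y⟯ E = Module.finrank K⟮x⟯ E := by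
  have h1 := Module.finrank_mul_finrank K⟮x⟯ K⟮x⟯⟮y⟯ E
  rw [adjoin.finrank (Algebra.IsIntegral.isIntegral y)] at h1
  rw [← h1, ← adjoin_simple_adjoin_simple]
  rfl

theorem isAlgebraic_polynomial_and_irreducible {x y : E} (hx : Transcendental K x)
    [FiniteDimensional K⟮x⟯ E] :
    (∃ Ψ : K[X][X], Ψ ≠ 0 ∧ aevalAeval x y Ψ = 0) ∧
    ∀ Φ : K[X][X], Irreducible Φ → aevalAeval x y Φ = 0 →
      Φ.natDegree * Module.finrank K⟮x, y⟯ E = Module.finrank K⟮x⟯ E := by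
  let a : K[X] →ₐ[K] K⟮x⟯ := aeval (AdjoinSimple.gen K x)
  let _ : Algebra K[X] K⟮x⟯ := a.toRingHom.toAlgebra
  let _ : Algebra K[X] E := (aeval x : K[X] →ₐ[K] E).toRingHom.toAlgebra
  have ha : ∀ p, (a p : E) = aeval x p := fun p => by
    have := (Polynomial.aeval_algHom_apply K⟮x⟯.val (AdjoinSimple.gen K x) p)
    exact this.symm
  have : IsScalarTower K[X] K⟮x⟯ E := IsScalarTower.of_algebraMap_eq fun p => (ha p).symm
  have hinj : Function.Injective (algebraMap K[X] K⟮x⟯) := by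
    intro p q h
    have h2 : aeval x p = aeval x q := by rw [← ha, ← ha]; exact congrArg Subtype.val h
    exact (transcendental_iff_injective.mp hx) h2
  have : FaithfulSMul K[X] K⟮x⟯ := (faithfulSMul_iff_algebraMap_injective _ _).mpr hinj
  have : IsFractionRing K[X] K⟮x⟯ := by
    refine IsFractionRing.of_field _ _ fun z => ?_
    obtain ⟨p, q, h⟩ := (mem_adjoin_simple_iff K (z : E)).mp z.2
    refine ⟨p, q, Subtype.ext ?_⟩
    rw [h, ← ha, ← ha]
    rfl
  constructor
  · have h1 : IsAlgebraic K⟮x⟯ y := Algebra.IsAlgebraic.isAlgebraic y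
    rw [← IsFractionRing.isAlgebraic_iff K[X] K⟮x⟯ E] at h1
    obtain ⟨Ψ, h0, h⟩ := h1
    refine ⟨Ψ, h0, ?_⟩
    rw [aevalAeval_eq_eval₂]
    exact h
  · intro Φ hΦ h
    rw [← natDegree_minpoly_mul_finrank (y := y)]
    congr 1
    have hdeg : Φ.natDegree ≠ 0 := by
      intro h0
      rw [natDegree_eq_zero] at h0
      obtain ⟨p, rfl⟩ := h0
      rw [aevalAeval_C] at h
      exact hΦ.ne_zero (by rw [transcendental_iff.mp hx p h, C_0])
    have := Nonempty.some (inferInstance : Nonempty (NormalizedGCDMonoid K[X]))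
    have hprim : Φ.IsPrimitive := hΦ.isPrimitive hdeg
    have hirr := (hprim.irreducible_iff_irreducible_map_fraction_map (K := K⟮x⟯)).mp hΦ
    have hroot : aeval y (Φ.map (algebraMap K[X] K⟮x⟯)) = 0 := by
      rw [aeval_map_algebraMap, ← h, aevalAeval_eq_eval₂]
      rfl
    rw [← minpoly.eq_of_irreducible hirr hroot, natDegree_mul_C, natDegree_map_eq_of_injective hinj]
    simpa using hirr.ne_zero

theorem exists_bivariate_relation {x y : E} (hx : Transcendental K x) (hy : Transcendental K y)
    [FiniteDimensional K⟮x⟯ E] [FiniteDimensional K⟮y⟯ E] :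
    ∃ Φ : K[X][X], Φ ≠ 0 ∧ aevalAeval x y Φ = 0 ∧
      Φ.natDegree * Module.finrank K⟮x, y⟯ E = Module.finrank K⟮x⟯ E ∧
      (swap Φ).natDegree * Module.finrank K⟮x, y⟯ E = Module.finrank K⟮y⟯ E := by
  obtain ⟨⟨Ψ, hΨ0, hΨ⟩, h1⟩ := isAlgebraic_polynomial_and_irreducible (y := y) hx
  obtain ⟨-, h2⟩ := isAlgebraic_polynomial_and_irreducible (y := x) hy
  let I := RingHom.ker (aevalAeval x y : K[X][X] →ₐ[K] E)
  have hI : I.IsPrime := RingHom.ker_isPrime _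
  have hI0 : I ≠ ⊥ := fun h => hΨ0 (by
    have : Ψ ∈ I := hΨ
    rwa [h, Ideal.mem_bot] at this)
  obtain ⟨Φ, hΦI, hΦ⟩ := hI.exists_mem_prime_of_ne_bot hI0
  have hΦ0 : aevalAeval x y Φ = 0 := hΦI
  refine ⟨Φ, hΦ.ne_zero, hΦ0, h1 Φ hΦ.irreducible hΦ0, ?_⟩
  rw [Set.pair_comm]
  refine h2 (swap Φ) ?_ ?_
  · exact (MulEquiv.irreducible_iff (swap (R := K))).mpr hΦ.irreducible
  · rwa [aevalAeval_swap]

end Bivariate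

section Pair

open Polynomial Polynomial.Bivariate

variable {K E : Type*} [Field K] [Field E] [Algebra K E]

theorem coeff_coeff_swap (p : K[X][X]) (i j : ℕ) :
    ((swap p).coeff i).coeff j = (p.coeff j).coeff i := by
  induction p using Polynomial.induction_on' with
  | add p q hp hq => simp only [map_add, coeff_add, hp, hq]
  | monomial n a =>
    induction a using Polynomial.induction_on' with
    | add p q hp hq => simp only [map_add, coeff_add, hp, hq]
    | monomial m r =>
      rw [swap_monomial_monomial]
      simp only [coeff_monomial]
      split_ifs <;> simp_all [coeff_monomial]

theorem exists_shift [Infinite K] {x y : E} {a b : ℕ} {c : ℕ → ℕ → K}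
    (h : ∑ i ∈ Finset.range (a + 1), ∑ j ∈ Finset.range (b + 1),
      algebraMap K E (c i j) * x ^ i * y ^ j = 0) (hc : ∃ i ≤ a, c i b ≠ 0) :
    ∃ (α : K) (c' : ℕ → ℕ → K), c' 0 b ≠ 0 ∧ (∀ j, c' a j = c a j) ∧
      ∑ i ∈ Finset.range (a + 1), ∑ j ∈ Finset.range (b + 1),
        algebraMap K E (c' i j) * (x - algebraMap K E α) ^ i * y ^ j = 0 := by
  let A : ℕ → K[X] := fun j => ∑ i ∈ Finset.range (a + 1), monomial i (c i j)
  have hA : ∀ i j, (A j).coeff i = if i ≤ a then c i j else 0 := by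
    intro i j
    simp [A, coeff_monomial]
  have hdeg : ∀ j, (A j).natDegree ≤ a := fun j =>
    natDegree_le_iff_coeff_eq_zero.mpr fun i hi => by rw [hA, if_neg (by omega)]
  obtain ⟨i₀, hi₀, hi₀c⟩ := hc
  have hAb : A b ≠ 0 := fun h0 => hi₀c (by
    have := hA i₀ b
    rw [h0, if_pos hi₀] at this
    simpa using this.symm)
  obtain ⟨α, hα⟩ : ∃ α, (A b).eval α ≠ 0 := by
    by_contra! hcon
    exact hAb (Polynomial.funext fun r => by simpa using hcon r)
  have hsum : ∀ (B : ℕ → K[X]) (z : E), (∀ j, (B j).natDegree ≤ a) →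
      ∑ i ∈ Finset.range (a + 1), ∑ j ∈ Finset.range (b + 1),
        algebraMap K E ((B j).coeff i) * z ^ i * y ^ j =
      ∑ j ∈ Finset.range (b + 1), aeval z (B j) * y ^ j := by
    intro B z hB
    rw [Finset.sum_comm]
    refine Finset.sum_congr rfl fun j _ => ?_
    rw [aeval_eq_sum_range' (Nat.lt_succ_of_le (hB j)), Finset.sum_mul]
    simp [Algebra.smul_def]
  refine ⟨α, fun i j => (taylor α (A j)).coeff i, ?_, ?_, ?_⟩
  · simpa [taylor_coeff_zero] using hα
  · intro j
    have h1 : (taylor α (A j)).coeff a = (A j).coeff a := by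
      rw [taylor_coeff, hasseDeriv_apply, sum_over_range' _ (by simp) (a + 1)
        (Nat.lt_succ_of_le (hdeg j)), Finset.sum_range_succ, Finset.sum_eq_zero]
      · simp
      · intro i hi
        rw [Nat.choose_eq_zero_of_lt (Finset.mem_range.mp hi)]
        simp
    show (taylor α (A j)).coeff a = c a j
    rw [h1, hA, if_pos le_rfl]
  · rw [hsum (fun j => taylor α (A j)) _ (fun j => by rw [natDegree_taylor]; exact hdeg j)]
    rw [← h]
    have h2 := hsum A x hdeg
    have h3 : ∑ i ∈ Finset.range (a + 1), ∑ j ∈ Finset.range (b + 1),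
        algebraMap K E (c i j) * x ^ i * y ^ j = ∑ i ∈ Finset.range (a + 1),
        ∑ j ∈ Finset.range (b + 1), algebraMap K E ((A j).coeff i) * x ^ i * y ^ j := by
      refine Finset.sum_congr rfl fun i hi => Finset.sum_congr rfl fun j _ => ?_
      rw [hA, if_pos (Nat.lt_succ_iff.mp (Finset.mem_range.mp hi))]
    rw [h3, h2]
    refine Finset.sum_congr rfl fun j _ => ?_
    congr 1
    rw [taylor_apply, aeval_comp]
    simp

/-- The span of the monomials `x ^ e * t ^ m` with `e < N` and `e + m ≤ N`. -/
def lowerSpan (K : Type*) {E : Type*} [Field K] [Field E] [Algebra K E] (x t : E) (N : ℕ) :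
    Submodule K E :=
  Submodule.span K {u | ∃ e m, e < N ∧ e + m ≤ N ∧ u = x ^ e * t ^ m}

theorem pow_mem_lowerSpan {x y : E} {a b : ℕ} {c : ℕ → ℕ → K}
    (h : ∑ i ∈ Finset.range (a + 1), ∑ j ∈ Finset.range (b + 1),
      algebraMap K E (c i j) * x ^ i * y ^ j = 0) (hc : c a 0 ≠ 0) :
    x ^ (a + b) ∈ lowerSpan K x (x * y) (a + b) := by
  classical
  have hterm : ∀ i j, i ≤ a → j ≤ b → (i, j) ≠ (a, 0) →
      x ^ b * (algebraMap K E (c i j) * x ^ i * y ^ j) ∈ lowerSpan K x (x * y) (a + b) := by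
    intro i j hi hj hij
    have hij' : i ≠ a ∨ j ≠ 0 := by
      by_contra! hcon
      exact hij (by rw [hcon.1, hcon.2])
    have : x ^ b * (algebraMap K E (c i j) * x ^ i * y ^ j) =
        c i j • (x ^ (i + (b - j)) * (x * y) ^ j) := by
      rw [Algebra.smul_def, mul_pow]
      have : x ^ b = x ^ (b - j) * x ^ j := by rw [← pow_add]; congr 1; omega
      rw [this, pow_add]
      ring
    rw [this]
    exact Submodule.smul_mem _ _ (Submodule.subset_span ⟨_, _, by omega, by omega, rfl⟩)
  have h' : ∑ p ∈ Finset.range (a + 1) ×ˢ Finset.range (b + 1),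
      x ^ b * (algebraMap K E (c p.1 p.2) * x ^ p.1 * y ^ p.2) = 0 := by
    rw [← Finset.mul_sum, Finset.sum_product, h, mul_zero]
  rw [← Finset.add_sum_erase _ _ (a := (a, 0)) (by simp)] at h'
  have h1 : x ^ b * (algebraMap K E (c a 0) * x ^ a * y ^ 0) ∈ lowerSpan K x (x * y) (a + b) := by
    rw [eq_neg_of_add_eq_zero_left h']
    refine Submodule.neg_mem _ (Submodule.sum_mem _ ?_)
    rintro ⟨i, j⟩ hp
    simp only [Finset.mem_erase, Finset.mem_product, Finset.mem_range] at hp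
    exact hterm i j (by omega) (by omega) hp.1
  have h2 : x ^ (a + b) = (c a 0)⁻¹ • (x ^ b * (algebraMap K E (c a 0) * x ^ a * y ^ 0)) := by
    rw [Algebra.smul_def, map_inv₀, pow_add]
    have : algebraMap K E (c a 0) ≠ 0 := by simpa using hc
    field_simp
  rw [h2]
  exact Submodule.smul_mem _ _ h1

theorem pow_mem_of_mem_lowerSpan {x t : E} {N : ℕ} (h : x ^ N ∈ lowerSpan K x t N) (n : ℕ) :
    x ^ n ∈ pencil K x ^ N * pencil K t ^ n := by
  induction n using Nat.strong_induction_on with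
  | _ n ih =>
    rcases Nat.lt_or_ge n N with hn | hn
    · rw [← mul_one (x ^ n)]
      refine Submodule.mul_mem_mul (pow_mem_pencil_pow x hn.le) ?_
      simpa using pow_mem_pencil_pow (K := K) t (Nat.zero_le n)
    · have hle : lowerSpan K x t N ≤
          Submodule.comap (LinearMap.mulLeft K (x ^ (n - N)))
            (pencil K x ^ N * pencil K t ^ n) := by
        rw [lowerSpan, Submodule.span_le]
        rintro _ ⟨e, m, he, hem, rfl⟩
        show x ^ (n - N) * (x ^ e * t ^ m) ∈ pencil K x ^ N * pencil K t ^ n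
        rw [← mul_assoc, ← pow_add]
        have h1 := Submodule.mul_mem_mul (ih (n - N + e) (by omega))
          (pow_mem_pencil_pow (K := K) t (le_refl m))
        rw [mul_assoc, ← pow_add] at h1
        have h2 : pencil K x ^ N * pencil K t ^ (n - N + e + m) ≤ pencil K x ^ N * pencil K t ^ n :=
          mul_le_mul' le_rfl (pow_le_pow_of_one_le (one_le_pencil t) (by omega))
        exact h2 h1
      have := hle h
      rw [Submodule.mem_comap, LinearMap.mulLeft_apply, ← pow_add] at this
      rwa [Nat.sub_add_cancel hn] at this

theorem powDominated_pair {x y : E} {N : ℕ} (hx : x ^ N ∈ lowerSpan K x (x * y) N)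
    (hy : y ^ N ∈ lowerSpan K y (x * y) N) :
    PowDominated (pencil K x * pencil K y) (pencil K (x * y)) := by
  refine ⟨pencil K x ^ N * pencil K y ^ N, ((fg_pencil x).pow N).mul ((fg_pencil y).pow N),
    fun n => ?_⟩
  have h1x : (1 : Submodule K E) ≤ pencil K x ^ N := one_le_pow_of_one_le' (one_le_pencil x) N
  have h1y : (1 : Submodule K E) ≤ pencil K y ^ N := one_le_pow_of_one_le' (one_le_pencil y) N
  rw [mul_pow, pencil_pow x n, pencil_pow y n, Submodule.span_mul_span, Submodule.span_le]
  rintro _ ⟨_, ⟨i, hi, rfl⟩, _, ⟨j, hj, rfl⟩, rfl⟩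
  simp only [Set.mem_Iic] at hi hj
  have key : ∀ {z : E} {k l : ℕ}, z ^ N ∈ lowerSpan K z (x * y) N → k ≤ n → l ≤ k →
      (x * y) ^ l * z ^ (k - l) ∈ pencil K z ^ N * pencil K (x * y) ^ n := by
    intro z k l hz hk hl
    have h1 := Submodule.mul_mem_mul (pow_mem_of_mem_lowerSpan hz (k - l))
      (pow_mem_pencil_pow (K := K) (x * y) (le_refl l))
    rw [mul_assoc, ← pow_add] at h1
    rw [mul_comm ((x * y) ^ l)]
    have h2 : pencil K z ^ N * pencil K (x * y) ^ (k - l + l) ≤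
        pencil K z ^ N * pencil K (x * y) ^ n :=
      mul_le_mul' le_rfl (pow_le_pow_of_one_le (one_le_pencil _) (by omega))
    exact h2 h1
  rcases Nat.le_total j i with hji | hij
  · have h2 := key hx hi hji
    have h3 : x ^ i * y ^ j = (x * y) ^ j * x ^ (i - j) := by
      have : x ^ i = x ^ (i - j) * x ^ j := by rw [← pow_add]; congr 1; omega
      rw [this, mul_pow]
      ring
    show x ^ i * y ^ j ∈ _
    rw [h3]
    have h4 : pencil K x ^ N * pencil K (x * y) ^ n ≤
        pencil K x ^ N * pencil K y ^ N * pencil K (x * y) ^ n :=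
      mul_le_mul' (le_mul_of_one_le h1y) le_rfl
    exact h4 h2
  · have h2 := key hy hj hij
    have h3 : x ^ i * y ^ j = (x * y) ^ i * y ^ (j - i) := by
      have : y ^ j = y ^ (j - i) * y ^ i := by rw [← pow_add]; congr 1; omega
      rw [this, mul_pow]
      ring
    show x ^ i * y ^ j ∈ _
    rw [h3, mul_comm (pencil K x ^ N)]
    have h4 : pencil K y ^ N * pencil K (x * y) ^ n ≤
        pencil K y ^ N * pencil K x ^ N * pencil K (x * y) ^ n :=
      mul_le_mul' (le_mul_of_one_le h1x) le_rfl
    exact h4 h2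

theorem pencil_sub_algebraMap (x : E) (α : K) :
    pencil K (x - algebraMap K E α) = pencil K x := by
  have h : ∀ α : K, algebraMap K E α ∈ pencil K x := fun α => by
    rw [Algebra.algebraMap_eq_smul_one]
    exact Submodule.smul_mem _ _ (one_mem_pencil x)
  refine le_antisymm (pencil_le (one_mem_pencil x)
    (Submodule.sub_mem _ (self_mem_pencil x) (h α))) ?_
  refine pencil_le (one_mem_pencil _) ?_
  have := Submodule.add_mem (pencil K (x - algebraMap K E α)) (self_mem_pencil _)
    (Submodule.smul_mem _ α (one_mem_pencil _))
  rwa [← Algebra.algebraMap_eq_smul_one, sub_add_cancel] at this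

theorem isIntegral_of_mem_lowerSpan {x t : E} {N : ℕ} (h : x ^ N ∈ lowerSpan K x t N) :
    IsIntegral K⟮t⟯ x ∧ (minpoly K⟮t⟯ x).natDegree ≤ N := by
  have hle : lowerSpan K x t N ≤ Submodule.restrictScalars K
      ((degreeLT K⟮t⟯ N).map (aeval x : K⟮t⟯[X] →ₐ[K⟮t⟯] E).toLinearMap) := by
    rw [lowerSpan, Submodule.span_le]
    rintro _ ⟨e, m, he, hem, rfl⟩
    refine ⟨C ((⟨t, mem_adjoin_simple_self K t⟩ : K⟮t⟯) ^ m) * X ^ e, ?_, ?_⟩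
    · rw [SetLike.mem_coe, mem_degreeLT]
      exact (degree_C_mul_X_pow_le _ _).trans_lt (by exact_mod_cast he)
    · show aeval x (C ((⟨t, mem_adjoin_simple_self K t⟩ : K⟮t⟯) ^ m) * X ^ e) = _
      rw [map_mul, aeval_C, aeval_X_pow, map_pow, mul_comm]
      rfl
  obtain ⟨p, hp, hpx⟩ := hle h
  rw [SetLike.mem_coe, mem_degreeLT] at hp
  have hm : (X ^ N - p).Monic := monic_X_pow_sub hp
  have h0 : aeval x (X ^ N - p) = 0 := by
    rw [map_sub, aeval_X_pow]
    exact sub_eq_zero.mpr hpx.symm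
  refine ⟨⟨_, hm, h0⟩, ?_⟩
  have h1 := natDegree_le_natDegree (minpoly.min K⟮t⟯ x hm h0)
  refine h1.trans ((natDegree_sub_le _ _).trans ?_)
  rw [natDegree_X_pow, max_le_iff]
  exact ⟨le_rfl, natDegree_le_of_degree_le hp.le⟩

theorem exists_powDominated_pencil [Infinite K] {x y : E} (hx : Transcendental K x)
    (hy : Transcendental K y) (hfx : FiniteDimensional K⟮x⟯ E) (hfy : FiniteDimensional K⟮y⟯ E) :
    ∃ g : E, Transcendental K g ∧ FiniteDimensional K⟮g⟯ E ∧
      Module.finrank K⟮g⟯ E ≤ Module.finrank K⟮x⟯ E + Module.finrank K⟮y⟯ E ∧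
      PowDominated (pencil K x * pencil K y) (pencil K g) := by
  obtain ⟨Φ, hΦ0, hΦ, hb, ha⟩ := exists_bivariate_relation hx hy
  set b := Φ.natDegree with hbdef
  set a := (swap Φ).natDegree with hadef
  have hc0 : ∑ i ∈ Finset.range (a + 1), ∑ j ∈ Finset.range (b + 1),
      algebraMap K E ((Φ.coeff j).coeff i) * x ^ i * y ^ j = 0 := by
    have hdeg : ∀ j, (Φ.coeff j).natDegree ≤ a := fun j =>
      natDegree_le_iff_coeff_eq_zero.mpr fun i hi => by
        rw [← coeff_coeff_swap, coeff_eq_zero_of_natDegree_lt hi, coeff_zero]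
    rw [Finset.sum_comm, ← hΦ, aevalAeval_eq_eval₂, eval₂_eq_sum_range]
    refine Finset.sum_congr rfl fun j _ => ?_
    show _ = aeval x (Φ.coeff j) * y ^ j
    rw [aeval_eq_sum_range' (Nat.lt_succ_of_le (hdeg j)), Finset.sum_mul]
    simp [Algebra.smul_def]
  have hswap0 : swap Φ ≠ 0 := by simpa using hΦ0
  obtain ⟨α, c₁, hc₁b, hc₁a, h₁⟩ := exists_shift hc0 (by
    by_contra! hcon
    have h1 : Φ.coeff b ≠ 0 := by simpa [hbdef] using hΦ0
    apply h1
    ext i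
    rcases le_or_gt i a with hi | hi
    · simpa using hcon i hi
    · rw [← coeff_coeff_swap, coeff_eq_zero_of_natDegree_lt hi, coeff_zero, coeff_zero])
  rw [Finset.sum_comm] at h₁
  have h₁' : ∑ j ∈ Finset.range (b + 1), ∑ i ∈ Finset.range (a + 1),
      algebraMap K E ((fun j i => c₁ i j) j i) * y ^ j * (x - algebraMap K E α) ^ i = 0 := by
    rw [← h₁]
    exact Finset.sum_congr rfl fun j _ => Finset.sum_congr rfl fun i _ => by ring
  obtain ⟨β, c₂, hc₂a, hc₂b, h₂⟩ := exists_shift h₁' (by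
    by_contra! hcon
    have h1 : (swap Φ).coeff a ≠ 0 := by simpa [hadef] using hswap0
    apply h1
    ext j
    rw [coeff_coeff_swap]
    rcases le_or_gt j b with hj | hj
    · simpa [hc₁a] using hcon j hj
    · rw [coeff_eq_zero_of_natDegree_lt hj, coeff_zero, coeff_zero])
  have hc₂b' : c₂ b 0 ≠ 0 := by rw [hc₂b]; exact hc₁b
  set x' := x - algebraMap K E α with hx'
  set y' := y - algebraMap K E β with hy'
  have hY : y' ^ (a + b) ∈ lowerSpan K y' (x' * y') (a + b) := by
    rw [add_comm a b, mul_comm x' y']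
    exact pow_mem_lowerSpan h₂ hc₂b'
  have hX : x' ^ (a + b) ∈ lowerSpan K x' (x' * y') (a + b) := by
    refine pow_mem_lowerSpan (c := fun i j => c₂ j i) ?_ hc₂a
    rw [Finset.sum_comm, ← h₂]
    exact Finset.sum_congr rfl fun j _ => Finset.sum_congr rfl fun i _ => by ring
  obtain ⟨h_integral, hdeg⟩ := isIntegral_of_mem_lowerSpan hX
  have hx'0 : x' ≠ 0 := fun h => hx (by
    rw [sub_eq_zero.mp h]
    exact isAlgebraic_algebraMap α)
  set t := x' * y' with ht
  have hadj : (K⟮t⟯⟮x'⟯).restrictScalars K = K⟮x, y⟯ := by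
    rw [adjoin_simple_adjoin_simple]
    apply le_antisymm
    · have hxm : x ∈ K⟮x, y⟯ := subset_adjoin _ _ (by simp)
      have hym : y ∈ K⟮x, y⟯ := subset_adjoin _ _ (by simp)
      have hx'm : x' ∈ K⟮x, y⟯ := sub_mem hxm (IntermediateField.algebraMap_mem _ α)
      have hy'm : y' ∈ K⟮x, y⟯ := sub_mem hym (IntermediateField.algebraMap_mem _ β)
      rw [adjoin_le_iff]
      rintro z (rfl | rfl)
      · exact mul_mem hx'm hy'm
      · exact hx'm
    · have htm : t ∈ K⟮t, x'⟯ := subset_adjoin _ _ (by simp)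
      have hxm : x' ∈ K⟮t, x'⟯ := subset_adjoin _ _ (by simp)
      have hym : y' ∈ K⟮t, x'⟯ := by
        have : y' = x'⁻¹ * t := by rw [ht]; field_simp
        rw [this]
        exact mul_mem (inv_mem hxm) htm
      rw [adjoin_le_iff]
      rintro z (rfl | rfl)
      · have := add_mem hxm (IntermediateField.algebraMap_mem K⟮t, x'⟯ α)
        rwa [hx', sub_add_cancel] at this
      · have := add_mem hym (IntermediateField.algebraMap_mem K⟮t, x'⟯ β)
        rwa [hy', sub_add_cancel] at this
  have hfxy : FiniteDimensional K⟮x, y⟯ E := by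
    rw [← adjoin_simple_adjoin_simple]
    exact inferInstanceAs (FiniteDimensional (K⟮x⟯⟮y⟯) E)
  have e1 : Module.finrank (K⟮t⟯⟮x'⟯) E = Module.finrank K⟮x, y⟯ E := by
    rw [← hadj]; rfl
  have hf1 : FiniteDimensional (K⟮t⟯⟮x'⟯) E := by
    rw [← hadj] at hfxy; exact hfxy
  have hf2 : FiniteDimensional K⟮t⟯ (K⟮t⟯⟮x'⟯) := adjoin.finiteDimensional h_integral
  have hft : FiniteDimensional K⟮t⟯ E := Module.Finite.trans (K⟮t⟯⟮x'⟯) E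
  refine ⟨t, ?_, hft, ?_, ?_⟩
  · intro hta
    apply hx
    have : Algebra.IsAlgebraic K K⟮t⟯ := isAlgebraic_adjoin_simple hta.isIntegral
    exact (Algebra.IsAlgebraic.trans K K⟮t⟯ E).isAlgebraic x
  · have h1 := Module.finrank_mul_finrank K⟮t⟯ (K⟮t⟯⟮x'⟯) E
    rw [e1, adjoin.finrank h_integral] at h1
    rw [← h1, ← ha, ← hb, ← add_mul, add_comm b a]
    exact Nat.mul_le_mul_right _ hdeg
  · have := powDominated_pair hX hY
    rwa [hx', hy', pencil_sub_algebraMap, pencil_sub_algebraMap, ← hx', ← hy'] at this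

end Pair

section Rank

open Polynomial

variable {K E : Type*} [Field K] [Field E] [Algebra K E]

theorem HasSlope.mono {E₀ : IntermediateField K E} {V : Submodule K E} {A B : ℕ}
    (h : HasSlope E₀ V A) (hAB : A ≤ B) : HasSlope E₀ V B := by
  intro U hU hUE
  obtain ⟨C, hC⟩ := h U hU hUE
  exact ⟨C, fun n => (hC n).trans (by gcongr)⟩

theorem exists_prod_powDominated [Infinite K] {d : ℕ} {s : Finset E} (hs : s.Nonempty)
    (ht : ∀ f ∈ s, Transcendental K f) (hfd : ∀ f ∈ s, FiniteDimensional K⟮f⟯ E)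
    (hd : ∀ f ∈ s, Module.finrank K⟮f⟯ E = d) :
    ∃ g : E, Transcendental K g ∧ FiniteDimensional K⟮g⟯ E ∧
      Module.finrank K⟮g⟯ E ≤ s.card * d ∧ PowDominated (∏ f ∈ s, pencil K f) (pencil K g) := by
  classical
  induction hs using Finset.Nonempty.cons_induction with
  | singleton f =>
    exact ⟨f, ht f (by simp), hfd f (by simp), by simp [hd f (by simp)],
      by simpa using PowDominated.refl _⟩
  | cons f s hf hs ih =>
    obtain ⟨g, hg, hgfd, hgd, hgp⟩ := ih (fun f hf => ht f (by simp [hf]))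
      (fun f hf => hfd f (by simp [hf])) (fun f hf => hd f (by simp [hf]))
    obtain ⟨t, h1, h2, h3, h4⟩ := exists_powDominated_pencil (ht f (by simp)) hg
      (hfd f (by simp)) hgfd
    refine ⟨t, h1, h2, ?_, ?_⟩
    · rw [hd f (by simp)] at h3
      rw [Finset.card_cons, add_mul]
      omega
    · rw [Finset.prod_cons]
      exact ((PowDominated.refl _).mul hgp).trans h4

theorem fg_prod_pencil (s : Finset E) (n : E → ℕ) : (∏ f ∈ s, pencil K f ^ n f).FG := by
  classical
  induction s using Finset.induction_on with
  | empty =>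
    simpa [Submodule.one_eq_span] using
      Submodule.fg_span (R := K) (Set.finite_singleton (1 : E))
  | insert f s hf ih =>
    rw [Finset.prod_insert hf]
    exact ((fg_pencil f).pow _).mul ih

theorem one_le_prod_pencil (s : Finset E) (n : E → ℕ) :
    (1 : Submodule K E) ≤ ∏ f ∈ s, pencil K f ^ n f := by
  classical
  induction s using Finset.induction_on with
  | empty => simp
  | insert f s hf ih =>
    rw [Finset.prod_insert hf]
    exact (one_le_pow_of_one_le' (one_le_pencil f) _).trans (le_mul_of_one_le ih)

theorem one_mem_of_one_le {W : Submodule K E} (h : (1 : Submodule K E) ≤ W) : (1 : E) ∈ W :=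
  Submodule.one_le.mp h

theorem mem_adjoin_of_mem_prod_pencil (s : Finset E) (n : E → ℕ) :
    ∀ x ∈ ∏ f ∈ s, pencil K f ^ n f, x ∈ adjoin K (s : Set E) := by
  have h : ∀ f ∈ s, pencil K f ≤ (adjoin K (s : Set E)).toSubmodule := fun f hf =>
    pencil_le (one_mem (adjoin K (s : Set E))) (subset_adjoin K _ hf)
  have hid : IsIdempotentElem (adjoin K (s : Set E)).toSubmodule :=
    Subalgebra.isIdempotentElem_toSubmodule _
  suffices ∀ t ⊆ s, ∏ f ∈ t, pencil K f ^ n f ≤ (adjoin K (s : Set E)).toSubmodule from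
    fun x hx => this s subset_rfl hx
  have hpow : ∀ f ∈ s, ∀ m, pencil K f ^ m ≤ (adjoin K (s : Set E)).toSubmodule := by
    intro f hf m
    induction m with
    | zero => simp
    | succ m ih => rw [pow_succ, ← hid.eq]; exact mul_le_mul' ih (h f hf)
  classical
  intro t
  induction t using Finset.induction_on with
  | empty => intro _; simp
  | insert f t hf ih =>
    intro hts
    rw [Finset.prod_insert hf, ← hid.eq]
    exact mul_le_mul' (hpow f (hts (by simp)) _) (ih fun x hx => hts (by simp [hx]))

/-- The dimension over `K(z)` of the span of `W`. -/
noncomputable def rankOver (z : E) (W : Submodule K E) : ℕ :=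
  Module.finrank K⟮z⟯ (Submodule.span K⟮z⟯ (W : Set E))

theorem finrank_add_rankOver_le {z : E} (hz : Transcendental K z) [FiniteDimensional K⟮z⟯ E]
    {W : Submodule K E} (hW : W.FG) :
    Module.finrank K W + rankOver z W ≤ Module.finrank K (W * pencil K z : Submodule K E) := by
  let b := Module.finBasis K⟮z⟯ (Submodule.span K⟮z⟯ (W : Set E))
  have := finrank_add_card_le_mul_pencil hz hW (b := fun i => (b i : E))
    (b.linearIndependent.map' (Submodule.subtype _) (Submodule.ker_subtype _)) (fun i => (b i).2)
  simpa [rankOver] using this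

theorem rankOver_mono {z : E} [FiniteDimensional K⟮z⟯ E] {W W' : Submodule K E} (h : W ≤ W') :
    rankOver z W ≤ rankOver z W' :=
  Submodule.finrank_mono (Submodule.span_mono h)

theorem rankOver_pos {z : E} [FiniteDimensional K⟮z⟯ E] {W : Submodule K E}
    (h : (1 : Submodule K E) ≤ W) : 1 ≤ rankOver z W := by
  rw [rankOver, Nat.one_le_iff_ne_zero, Ne, Submodule.finrank_eq_zero, Submodule.eq_bot_iff]
  intro hcon
  exact one_ne_zero (hcon 1 (Submodule.subset_span (one_mem_of_one_le h)))

theorem le_rankOver_of_subset {z : E} [FiniteDimensional K⟮z⟯ E] {W : Submodule K E}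
    {M : IntermediateField K E} (hzM : z ∈ M) (hM : ∀ x ∈ M, x ∈ Submodule.span K⟮z⟯ (W : Set E))
    {D : ℕ} (hD : D * Module.finrank M E = Module.finrank K⟮z⟯ E) : D ≤ rankOver z W := by
  have hle : K⟮z⟯ ≤ M := adjoin_simple_le_iff.mpr hzM
  have h1 := Module.finrank_mul_finrank K⟮z⟯ (extendScalars hle) E
  have h2 : Module.finrank (extendScalars hle) E = Module.finrank M E := rfl
  have h3 : 0 < Module.finrank K⟮z⟯ E := Module.finrank_pos
  rw [h2, ← hD] at h1
  have h4 : 0 < Module.finrank M E := by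
    rw [← hD] at h3
    exact Nat.pos_of_mul_pos_left h3
  rw [← Nat.eq_of_mul_eq_mul_right h4 h1]
  exact Submodule.finrank_mono (s := (extendScalars hle).toSubmodule) fun x hx => hM x hx

theorem mem_of_mul_mem {z : E} [FiniteDimensional K⟮z⟯ E] {N : Submodule K⟮z⟯ E} (h1 : (1 : E) ∈ N)
    {S : Set E} (hS : ∀ w ∈ S, ∀ x ∈ N, w * x ∈ N) : ∀ x ∈ adjoin K S, x ∈ N := by
  have hle : adjoin K S ≤ (adjoin K⟮z⟯ S).restrictScalars K :=
    adjoin_le_iff.mpr (subset_adjoin K⟮z⟯ S)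
  intro x hx
  have hx' : x ∈ (adjoin K⟮z⟯ S).toSubalgebra := hle hx
  rw [adjoin_toSubalgebra] at hx'
  clear hx
  suffices ∀ y ∈ N, x * y ∈ N by simpa using this 1 h1
  induction hx' using Algebra.adjoin_induction with
  | mem w hw => exact hS w hw
  | algebraMap r => intro y hy; rw [← Algebra.smul_def]; exact N.smul_mem r hy
  | add a b _ _ ha hb => intro y hy; rw [add_mul]; exact N.add_mem (ha y hy) (hb y hy)
  | mul a b _ _ ha hb => intro y hy; rw [mul_assoc]; exact ha _ (hb y hy)

theorem mul_mem_span_mul_pencil {z w : E} {W : Submodule K E} {x : E}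
    (hx : x ∈ Submodule.span K⟮z⟯ (W : Set E)) :
    w * x ∈ Submodule.span K⟮z⟯ ((W * pencil K w : Submodule K E) : Set E) := by
  have : Submodule.span K⟮z⟯ (W : Set E) ≤
      (Submodule.span K⟮z⟯ ((W * pencil K w : Submodule K E) : Set E)).comap
        (LinearMap.mulLeft K⟮z⟯ w) := by
    rw [Submodule.span_le]
    intro y hy
    show w * y ∈ Submodule.span K⟮z⟯ ((W * pencil K w : Submodule K E) : Set E)
    rw [mul_comm w y]
    exact Submodule.subset_span (Submodule.mul_mem_mul hy (self_mem_pencil w))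
  exact this hx

theorem min_le_rankOver_mul_pencil {z w : E} [FiniteDimensional K⟮z⟯ E] {W : Submodule K E}
    (h1 : (1 : Submodule K E) ≤ W) {D : ℕ}
    (hD : D * Module.finrank K⟮z, w⟯ E = Module.finrank K⟮z⟯ E) :
    min (rankOver z W + 1) D ≤ rankOver z (W * pencil K w) := by
  have hle : W ≤ W * pencil K w := le_mul_of_one_le (one_le_pencil w)
  by_cases hst : ∀ x ∈ Submodule.span K⟮z⟯ (W : Set E), w * x ∈ Submodule.span K⟮z⟯ (W : Set E)
  · refine (min_le_right _ _).trans (le_trans ?_ (rankOver_mono hle))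
    have hone : (1 : E) ∈ Submodule.span K⟮z⟯ (W : Set E) :=
      Submodule.subset_span (one_mem_of_one_le h1)
    refine le_rankOver_of_subset (M := K⟮z, w⟯) (subset_adjoin _ _ (by simp)) ?_ hD
    refine mem_of_mul_mem hone ?_
    rintro y (rfl | rfl) x hx
    · exact Submodule.smul_mem _ (⟨y, mem_adjoin_simple_self K y⟩ : K⟮y⟯) hx
    · exact hst x hx
  · push Not at hst
    obtain ⟨x, hx, hwx⟩ := hst
    refine (min_le_left _ _).trans ?_
    refine Submodule.finrank_lt_finrank_of_lt (lt_of_le_of_ne (Submodule.span_mono hle) ?_)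
    intro heq
    exact hwx (heq ▸ mul_mem_span_mul_pencil hx)

theorem mul_mem_span_of_le {z w : E} [FiniteDimensional K⟮z⟯ E] {n : ℕ}
    (hn : Module.finrank K⟮z⟯ E ≤ n + 1) {R : Submodule K E} {x : E}
    (hx : x ∈ Submodule.span K⟮z⟯ ((pencil K w ^ n * R : Submodule K E) : Set E)) :
    w * x ∈ Submodule.span K⟮z⟯ ((pencil K w ^ n * R : Submodule K E) : Set E) := by
  set N := Submodule.span K⟮z⟯ ((pencil K w ^ n * R : Submodule K E) : Set E) with hN
  have hmem : ∀ i ≤ n, ∀ r ∈ R, w ^ i * r ∈ N := fun i hi r hr =>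
    Submodule.subset_span (Submodule.mul_mem_mul (pow_mem_pencil_pow w hi) hr)
  have htop : ∀ r ∈ R, w ^ (n + 1) * r ∈ N := by
    intro r hr
    have h_integral : IsIntegral K⟮z⟯ w := Algebra.IsIntegral.isIntegral w
    have h1 : aeval w ((X : K⟮z⟯[X]) ^ (n + 1) %ₘ minpoly K⟮z⟯ w) = w ^ (n + 1) := by
      rw [aeval_modByMonic_eq_self_of_root (minpoly.aeval _ _), aeval_X_pow]
    rw [← h1, aeval_eq_sum_range' (n := n + 1), Finset.sum_mul]
    · refine Submodule.sum_mem _ fun i hi => ?_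
      rw [smul_mul_assoc]
      exact N.smul_mem _ (hmem i (Nat.lt_succ_iff.mp (Finset.mem_range.mp hi)) r hr)
    · refine (natDegree_modByMonic_lt _ (minpoly.monic h_integral) (minpoly.ne_one _ _)).trans_le ?_
      exact (minpoly.natDegree_le w).trans hn
  have hle : N ≤ N.comap (LinearMap.mulLeft K⟮z⟯ w) := by
    conv_lhs => rw [hN]
    rw [Submodule.span_le]
    suffices pencil K w ^ n * R ≤
      ((N.comap (LinearMap.mulLeft K⟮z⟯ w)).restrictScalars K) from this
    rw [Submodule.mul_le]
    intro p hp r hr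
    rw [pencil_pow] at hp
    induction hp using Submodule.span_induction with
    | mem p hp =>
      obtain ⟨i, hi, rfl⟩ := hp
      show w * (w ^ i * r) ∈ N
      rw [← mul_assoc, ← pow_succ']
      rcases Nat.lt_or_ge i n with hin | hin
      · exact hmem _ hin r hr
      · rw [le_antisymm hi hin]; exact htop r hr
    | zero => rw [zero_mul]; exact Submodule.zero_mem _
    | add a b _ _ ha hb => rw [add_mul]; exact Submodule.add_mem _ ha hb
    | smul c a _ ha => rw [smul_mul_assoc]; exact Submodule.smul_mem _ c ha
  exact hle hx

theorem mem_span_prod_pencil {z : E} [FiniteDimensional K⟮z⟯ E] {s : Finset E} {n : E → ℕ}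
    (hn : ∀ w ∈ s, Module.finrank K⟮z⟯ E ≤ n w) :
    ∀ x ∈ adjoin K (insert z (s : Set E)),
      x ∈ Submodule.span K⟮z⟯ ((∏ f ∈ s, pencil K f ^ n f : Submodule K E) : Set E) := by
  classical
  refine mem_of_mul_mem (Submodule.subset_span (one_mem_of_one_le (one_le_prod_pencil s n))) ?_
  rintro w (rfl | hw) x hx
  · exact Submodule.smul_mem _ (⟨w, mem_adjoin_simple_self K w⟩ : K⟮w⟯) hx
  · rw [← Finset.mul_prod_erase s _ hw] at hx ⊢
    exact mul_mem_span_of_le ((hn w hw).trans (Nat.le_succ _)) hx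

end Rank

section Bound

variable {K E : Type*} [Field K] [Field E] [Algebra K E]

theorem finrank_one : Module.finrank K (1 : Submodule K E) = 1 := by
  rw [Submodule.one_eq_span]
  exact finrank_span_singleton one_ne_zero

theorem exists_mul_finrank_eq {M M' : IntermediateField K E} (h : M ≤ M') [FiniteDimensional M E] :
    ∃ D, D * Module.finrank M' E = Module.finrank M E ∧ 0 < D ∧ 0 < Module.finrank M' E := by
  have h1 := Module.finrank_mul_finrank M (extendScalars h) E
  have h3 : 0 < Module.finrank M E := Module.finrank_pos
  rw [← h1] at h3
  exact ⟨_, h1, Nat.pos_of_mul_pos_right h3, Nat.pos_of_mul_pos_left h3⟩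

theorem hasSlope_prod_pow [Infinite K] {d : ℕ} {s : Finset E} (hs : s.Nonempty)
    (ht : ∀ f ∈ s, Transcendental K f) (hfd : ∀ f ∈ s, FiniteDimensional K⟮f⟯ E)
    (hd : ∀ f ∈ s, Module.finrank K⟮f⟯ E = d) {D : ℕ}
    (hD : D * Module.finrank (adjoin K (s : Set E)) E = d)
    (he : 0 < Module.finrank (adjoin K (s : Set E)) E) (N : ℕ) :
    HasSlope (adjoin K (s : Set E)) ((∏ f ∈ s, pencil K f) ^ N) (N * (s.card * D)) := by
  obtain ⟨g, _, hgfd, hgd, hgp⟩ := exists_prod_powDominated hs ht hfd hd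
  refine HasSlope.pow (HasSlope.restrict (e := Module.finrank (adjoin K (s : Set E)) E) ?_ rfl he
    (by simpa using fg_prod_pencil (K := K) s (fun _ => 1)) ?_) N
  · refine ((hasSlope_pencil g).of_dominated (fg_pencil g) hgp).mono (hgd.trans (le_of_eq ?_))
    rw [← hD]
    ring
  · simpa using mem_adjoin_of_mem_prod_pencil (K := K) s (fun _ => 1)

theorem two_mul_sum_min (D n : ℕ) :
    (n ≤ D → 2 * ∑ j ∈ Finset.range n, min (j + 1) D = n * (n + 1)) ∧
      (D ≤ n → 2 * ∑ j ∈ Finset.range n, min (j + 1) D + D * D = D + 2 * n * D) := by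
  induction n with
  | zero => exact ⟨fun _ => by simp, fun h => by simp [Nat.le_zero.mp h]⟩
  | succ n ih =>
    obtain ⟨h1, h2⟩ := ih
    rw [Finset.sum_range_succ]
    refine ⟨fun h => ?_, fun h => ?_⟩
    · rw [min_eq_left h, mul_add, h1 (by omega)]
      ring
    · rw [min_eq_right h]
      rcases Nat.lt_or_ge n D with hn | hn
      · have : D = n + 1 := by omega
        subst this
        have := h1 (by omega)
        nlinarith
      · have := h2 hn
        nlinarith

theorem two_mul_mul_le (D n : ℕ) :
    2 * (n * D) ≤ 2 * ∑ j ∈ Finset.range n, min (j + 1) D + D * (D - 1) := by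
  obtain ⟨h1, h2⟩ := two_mul_sum_min D n
  rcases Nat.eq_zero_or_pos D with rfl | hD
  · simp
  obtain ⟨D, rfl⟩ := Nat.exists_eq_succ_of_ne_zero hD.ne'
  rw [Nat.succ_eq_add_one, Nat.add_sub_cancel] at *
  rcases le_total n (D + 1) with h | h
  · rw [h1 h]
    obtain ⟨m, hm⟩ := Nat.exists_eq_add_of_le h
    rcases Nat.eq_zero_or_pos m with rfl | hm0
    · nlinarith
    · nlinarith [Nat.mul_le_mul hm0 (le_refl m)]
  · have := h2 h
    nlinarith

theorem sum_min_lt_finrank_prod {d D : ℕ} {s : Finset E}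
    (ht : ∀ f ∈ s, Transcendental K f) (hfd : ∀ f ∈ s, FiniteDimensional K⟮f⟯ E)
    (hd : ∀ f ∈ s, Module.finrank K⟮f⟯ E = d)
    (hpair : ∀ z ∈ s, ∀ w ∈ s, z ≠ w → D * Module.finrank K⟮z, w⟯ E = d) :
    1 + ∑ j ∈ Finset.range s.card, min (j + 1) D ≤
      Module.finrank K (∏ f ∈ s, pencil K f : Submodule K E) := by
  classical
  have hone : ∀ t : Finset E, (1 : Submodule K E) ≤ ∏ f ∈ t, pencil K f := fun t => by
    simpa using one_le_prod_pencil (K := K) t (fun _ => 1)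
  have hrank : ∀ z ∈ s, ∀ t ⊆ s, z ∉ t → min (t.card + 1) D ≤
      rankOver z (∏ f ∈ t, pencil K f) := by
    intro z hz t
    have := hfd z hz
    induction t using Finset.induction_on with
    | empty =>
      intro _ _
      exact (min_le_left _ _).trans (by simpa using rankOver_pos (hone ∅))
    | insert w t hw ih =>
      intro hts hzt
      have h1 := ih (fun x hx => hts (by simp [hx])) (fun h => hzt (by simp [h]))
      have h2 := min_le_rankOver_mul_pencil (z := z) (w := w) (hone t) (D := D) (by
        rw [hpair z hz w (hts (by simp)) (fun h => hzt (by simp [h])), hd z hz])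
      rw [Finset.prod_insert hw, mul_comm (pencil K w), Finset.card_insert_of_notMem hw]
      omega
  suffices ∀ t ⊆ s, 1 + ∑ j ∈ Finset.range t.card, min (j + 1) D ≤
      Module.finrank K (∏ f ∈ t, pencil K f : Submodule K E) from this s subset_rfl
  intro t
  induction t using Finset.induction_on with
  | empty => intro _; rw [Finset.prod_empty, finrank_one]; simp
  | insert z t hz ih =>
    intro hts
    have hzs : z ∈ s := hts (by simp)
    have hts' : t ⊆ s := fun x hx => hts (by simp [hx])
    have := hfd z hzs
    have h1 := finrank_add_rankOver_le (ht z hzs) (W := ∏ f ∈ t, pencil K f)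
      (by simpa using fg_prod_pencil (K := K) t (fun _ => 1))
    have h2 := hrank z hzs t hts' hz
    have h3 := ih hts'
    rw [Finset.prod_insert hz, mul_comm (pencil K z), Finset.card_insert_of_notMem hz,
      Finset.sum_range_succ]
    omega

theorem mul_add_finrank_le {z : E} (hz : Transcendental K z) [FiniteDimensional K⟮z⟯ E]
    {R : Submodule K E} (hR : R.FG) {M : IntermediateField K E} (hzM : z ∈ M)
    (hM : ∀ x ∈ M, x ∈ Submodule.span K⟮z⟯ (R : Set E)) {D : ℕ}
    (hD : D * Module.finrank M E = Module.finrank K⟮z⟯ E) (j : ℕ) :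
    D * j + Module.finrank K R ≤ Module.finrank K (R * pencil K z ^ j : Submodule K E) := by
  induction j with
  | zero => rw [pow_zero, mul_one, mul_zero, zero_add]
  | succ j ih =>
    have h1 := finrank_add_rankOver_le hz (hR.mul ((fg_pencil z).pow j))
    have h2 : D ≤ rankOver z (R * pencil K z ^ j) :=
      (le_rankOver_of_subset hzM hM hD).trans (rankOver_mono (le_mul_of_one_le
        (one_le_pow_of_one_le' (one_le_pencil z) j)))
    rw [pow_succ, ← mul_assoc, mul_add]
    omega

/-- The products of large powers of the pencils of elements of `S` have dimension at least
`D * ∑ n + 1 - q`. -/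
def HasDefect (K : Type*) {E : Type*} [Field K] [Field E] [Algebra K E] (S : Finset E)
    (D q : ℕ) : Prop :=
  ∀ n₀ : ℕ, ∃ n : E → ℕ, (∀ f ∈ S, n₀ ≤ n f) ∧
    D * ∑ f ∈ S, n f + 1 ≤ Module.finrank K (∏ f ∈ S, pencil K f ^ n f : Submodule K E) + q

theorem hasDefect_singleton {x : E} (hx : Transcendental K x) [FiniteDimensional K⟮x⟯ E] :
    HasDefect K {x} 1 0 := by
  intro n₀
  refine ⟨fun _ => n₀, by simp, ?_⟩
  have h := mul_add_finrank_le hx (R := 1) (Submodule.one_eq_span (R := K) (A := E) ▸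
    Submodule.fg_span (Set.finite_singleton _)) (mem_adjoin_simple_self K x) (fun y hy => by
      have := Submodule.smul_mem _ (⟨y, hy⟩ : K⟮x⟯) (Submodule.subset_span (R := K⟮x⟯)
        (s := ((1 : Submodule K E) : Set E)) (one_mem_of_one_le le_rfl))
      rwa [Algebra.smul_def, mul_one] at this) (one_mul _) n₀
  rw [finrank_one, one_mul (pencil K x ^ n₀)] at h
  rw [Finset.sum_singleton, Finset.prod_singleton]
  exact h

theorem defect_arith {e D q t m r r' : ℕ} (he : 0 < e) (heD : 0 < e * D) (h : e * r ≤ r')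
    (hr : D * t + 1 ≤ r + q) :
    e * D * (e - 1 + m + t) + 1 ≤ e * D * m + r' + (e * q + (e * D - 1) * (e - 1)) := by
  have h7 := Nat.mul_le_mul_left e hr
  have h8 : e * (D * t + 1) = e * D * t + e := by ring
  rw [h8] at h7
  generalize e * D = a at *
  obtain ⟨e, rfl⟩ := Nat.exists_eq_succ_of_ne_zero he.ne'
  obtain ⟨a, rfl⟩ := Nat.exists_eq_succ_of_ne_zero heD.ne'
  simp only [Nat.succ_eq_add_one, Nat.add_sub_cancel] at *
  nlinarith

theorem HasDefect.finset_insert [DecidableEq E] {S : Finset E} {D q d e : ℕ} (h : HasDefect K S D q)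
    {z : E} (hzS : z ∉ S) (hz : Transcendental K z) [FiniteDimensional K⟮z⟯ E]
    (hzd : Module.finrank K⟮z⟯ E = d) (hD : D * Module.finrank (adjoin K (S : Set E)) E = d)
    (he : e * Module.finrank (adjoin K (insert z (S : Set E))) E =
      Module.finrank (adjoin K (S : Set E)) E) (hd : 0 < d) :
    HasDefect K (insert z S) (e * D) (e * q + (e * D - 1) * (e - 1)) := by
  intro n₀
  obtain ⟨n, hn, hdim⟩ := h (max n₀ d)
  have hdD : e * D * Module.finrank (adjoin K (insert z (S : Set E))) E = d := by
    rw [← hD, ← he]; ring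
  have heD0 : 0 < e * D := by
    rw [← hdD] at hd
    exact Nat.pos_of_mul_pos_right hd
  have he0 : 0 < e := Nat.pos_of_mul_pos_right heD0
  have hS0 : 0 < Module.finrank (adjoin K (S : Set E)) E := by
    rw [← hD] at hd
    exact Nat.pos_of_mul_pos_left hd
  have hSfin : FiniteDimensional (adjoin K (S : Set E)) E := Module.finite_of_finrank_pos hS0
  set R := ∏ f ∈ S, pencil K f ^ n f with hR
  have hRfg : R.FG := fg_prod_pencil S n
  have hdeg : (minpoly (adjoin K (S : Set E)) z).natDegree = e := by
    have h_integral : IsIntegral (adjoin K (S : Set E)) z := Algebra.IsIntegral.isIntegral z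
    have h1 := Module.finrank_mul_finrank (adjoin K (S : Set E)) (adjoin K (S : Set E))⟮z⟯ E
    rw [adjoin.finrank h_integral, ← he] at h1
    have h2 : Module.finrank (adjoin K (S : Set E))⟮z⟯ E =
        Module.finrank (adjoin K (insert z (S : Set E))) E := by
      have h3 : ((adjoin K (S : Set E))⟮z⟯).restrictScalars K =
          adjoin K (insert z (S : Set E)) := by
        rw [adjoin_adjoin_left, Set.union_singleton]
      rw [← h3]; rfl
    rw [h2] at h1
    refine Nat.eq_of_mul_eq_mul_right ?_ h1
    rw [← he] at hS0
    exact Nat.pos_of_mul_pos_left hS0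
  have h1 : e * Module.finrank K R ≤
      Module.finrank K (pencil K z ^ (e - 1) * R : Submodule K E) := by
    have := card_mul_finrank_le (adjoin K (S : Set E)) (linearIndependent_pow z) hRfg
      ((fg_pencil z).pow (e - 1)) (fun i => pow_mem_pencil_pow z (by omega))
      (mem_adjoin_of_mem_prod_pencil S n)
    rwa [Fintype.card_fin, hdeg] at this
  have hspan : ∀ x ∈ adjoin K (insert z (S : Set E)),
      x ∈ Submodule.span K⟮z⟯ ((pencil K z ^ (e - 1) * R : Submodule K E) : Set E) := by
    intro x hx
    have h2 := mem_span_prod_pencil (z := z) (n := n)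
      (fun w hw => hzd.trans_le ((le_max_right n₀ d).trans (hn w hw))) x hx
    refine Submodule.span_mono ?_ h2
    have h3 : R ≤ R * pencil K z ^ (e - 1) :=
      le_mul_of_one_le (one_le_pow_of_one_le' (one_le_pencil z) _)
    rw [mul_comm (pencil K z ^ (e - 1))]
    exact h3
  have h4 := mul_add_finrank_le hz (((fg_pencil z).pow (e - 1)).mul hRfg)
    (subset_adjoin K _ (Set.mem_insert _ _)) hspan (hdD.trans hzd.symm) n₀
  refine ⟨Function.update n z (e - 1 + n₀), ?_, ?_⟩
  · intro f hf
    rcases eq_or_ne f z with rfl | hfz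
    · simp
    · rw [Function.update_of_ne hfz]
      exact (le_max_left _ _).trans (hn f ((Finset.mem_insert.mp hf).resolve_left hfz))
  · have hne : ∀ f ∈ S, f ≠ z := fun f hf h => hzS (h ▸ hf)
    rw [Finset.sum_insert hzS, Finset.prod_insert hzS, Function.update_self,
      Finset.sum_congr rfl (g := n) (fun f hf => by rw [Function.update_of_ne (hne f hf)]),
      Finset.prod_congr rfl (g := fun f => pencil K f ^ n f)
        (fun f hf => by rw [Function.update_of_ne (hne f hf)]), ← hR]
    have h5 : pencil K z ^ (e - 1 + n₀) * R = pencil K z ^ (e - 1) * R * pencil K z ^ n₀ := by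
      rw [pow_add]; exact mul_right_comm _ _ _
    rw [h5]
    refine le_trans ?_ (Nat.add_le_add_right h4 _)
    exact defect_arith he0 heD0 h1 hdim

end Bound

section Core

variable {K E : Type*} [Field K] [Field E] [Algebra K E]

theorem finrank_prod_add_le {d D : ℕ} {s : Finset E}
    (ht : ∀ f ∈ s, Transcendental K f) (hfd : ∀ f ∈ s, FiniteDimensional K⟮f⟯ E)
    (hd : ∀ f ∈ s, Module.finrank K⟮f⟯ E = d)
    (hD : D * Module.finrank (adjoin K (s : Set E)) E = d) {n m : E → ℕ}
    (hn : ∀ f ∈ s, d ≤ n f) (hnm : ∀ f ∈ s, n f ≤ m f) :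
    D * ∑ f ∈ s, m f + Module.finrank K (∏ f ∈ s, pencil K f ^ n f : Submodule K E) ≤
      D * ∑ f ∈ s, n f + Module.finrank K (∏ f ∈ s, pencil K f ^ m f : Submodule K E) := by
  classical
  suffices ∀ t ⊆ s, D * ∑ f ∈ t, m f + Module.finrank K (∏ f ∈ s, pencil K f ^ n f :
      Submodule K E) ≤ D * ∑ f ∈ t, n f + Module.finrank K
        (∏ f ∈ s, pencil K f ^ (if f ∈ t then m f else n f) : Submodule K E) by
    have h := this s subset_rfl
    have hm : ∏ f ∈ s, pencil K f ^ (if f ∈ s then m f else n f) = ∏ f ∈ s, pencil K f ^ m f :=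
      Finset.prod_congr rfl fun f hf => by rw [if_pos hf]
    rwa [hm] at h
  intro t
  induction t using Finset.induction_on with
  | empty => intro _; simp only [Finset.sum_empty]; exact le_rfl
  | insert z t hz ih =>
    intro hts
    have hzs : z ∈ s := hts (by simp)
    have := hfd z hzs
    have h1 := ih fun x hx => hts (by simp [hx])
    have h2 := mul_add_finrank_le (ht z hzs)
      (fg_prod_pencil (K := K) s fun f => if f ∈ t then m f else n f)
      (M := adjoin K (s : Set E)) (subset_adjoin K _ hzs) (fun x hx =>
        mem_span_prod_pencil (fun w hw => by
          rw [hd z hzs]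
          have := hn w hw
          have := hnm w hw
          split_ifs <;> omega) x (adjoin.mono K _ _ (Set.subset_insert _ _) hx))
      (hD.trans (hd z hzs).symm) (m z - n z)
    have h3 : (∏ f ∈ s, pencil K f ^ (if f ∈ t then m f else n f)) * pencil K z ^ (m z - n z) =
        ∏ f ∈ s, pencil K f ^ (if f ∈ insert z t then m f else n f) := by
      rw [← Finset.mul_prod_erase s _ hzs, ← Finset.mul_prod_erase s (fun f => pencil K f ^
        (if f ∈ insert z t then m f else n f)) hzs, mul_right_comm]
      congr 1
      · rw [if_neg hz, if_pos (by simp), ← pow_add, Nat.add_sub_cancel' (hnm z hzs)]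
      · refine Finset.prod_congr rfl fun f hf => ?_
        simp [Finset.ne_of_mem_erase hf]
    rw [h3] at h2
    rw [Finset.sum_insert hz, Finset.sum_insert hz, mul_add, mul_add]
    have h4 : D * (m z - n z) + D * n z = D * m z := by
      rw [← mul_add, Nat.sub_add_cancel (hnm z hzs)]
    omega

theorem sq_arith {e D q : ℕ} (he : 2 ≤ e) (hD : 2 ≤ D) (hq : q ≤ (D - 1) ^ 2) :
    e * q + (e * D - 1) * (e - 1) + 1 ≤ (e * D - 1) ^ 2 := by
  obtain ⟨e, rfl⟩ := Nat.exists_eq_add_of_le he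
  obtain ⟨D, rfl⟩ := Nat.exists_eq_add_of_le hD
  have h1 : (2 + e) * (2 + D) - 1 = 2 * e + 2 * D + e * D + 3 := by
    have : (2 + e) * (2 + D) = 2 * e + 2 * D + e * D + 3 + 1 := by ring
    omega
  have h2 : 2 + e - 1 = 1 + e := by omega
  have h3 : 2 + D - 1 = 1 + D := by omega
  rw [h1, h2]
  rw [h3] at hq
  have h4 := Nat.mul_le_mul_left (2 + e) hq
  nlinarith [Nat.zero_le (e * D), Nat.zero_le (e * e * D), Nat.zero_le (e * D * D),
    Nat.zero_le (e * e * D * D), Nat.zero_le (e * e), Nat.zero_le (D * D)]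

theorem mul_sq_le {e D : ℕ} (he : 0 < e) : e * (D - 1) ^ 2 ≤ (D * e - 1) ^ 2 := by
  rcases D with _ | D
  · simp
  obtain ⟨e, rfl⟩ := Nat.exists_eq_succ_of_ne_zero he.ne'
  have h1 : (D + 1) * (e + 1) - 1 = D * (e + 1) + e := by
    have : (D + 1) * (e + 1) = D * (e + 1) + e + 1 := by ring
    omega
  rw [Nat.succ_eq_add_one, h1, Nat.add_sub_cancel]
  nlinarith [Nat.zero_le (D * e), Nat.zero_le (D * D * e), Nat.zero_le (D * D * e * e)]

theorem mul_choose_le_of_three_le {e D q : ℕ} (he : 0 < e) (h3 : 3 ≤ D * e)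
    (hq : 2 * q = D * (D - 1)) : e * (q + 1) ≤ (D * e - 1) ^ 2 := by
  rcases D with _ | _ | _ | D
  · simp at h3
  · have : q = 0 := by simpa using hq
    subst this
    obtain ⟨e, rfl⟩ := Nat.exists_eq_add_of_le (show 3 ≤ e by simpa using h3)
    have : (0 + 1) * (3 + e) - 1 = 2 + e := by omega
    rw [this]
    nlinarith
  · have : q = 1 := by omega
    subst this
    obtain ⟨e, rfl⟩ := Nat.exists_eq_add_of_le (show 2 ≤ e by omega)
    have : (0 + 1 + 1) * (2 + e) - 1 = 3 + 2 * e := by omega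
    rw [this]
    nlinarith
  · refine le_trans ?_ (mul_sq_le he)
    refine Nat.mul_le_mul_left _ ?_
    simp only [Nat.add_sub_cancel] at hq ⊢
    nlinarith

theorem mul_choose_le {e D q d : ℕ} (he : 0 < e) (hD : 0 < D) (hd : D * e ≤ d) (h3 : 3 ≤ d)
    (hq : 2 * q = D * (D - 1)) : e * (q + 1) ≤ (d - 1) ^ 2 := by
  by_cases h : 3 ≤ D * e
  · exact (mul_choose_le_of_three_le he h hq).trans (Nat.pow_le_pow_left (by omega) 2)
  refine le_trans ?_ (Nat.pow_le_pow_left (show 2 ≤ d - 1 by omega) 2)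
  have hD2 : D ≤ 2 := (Nat.le_mul_of_pos_right D he).trans (by omega)
  have he2 : e ≤ 2 := (Nat.le_mul_of_pos_left e hD).trans (by omega)
  interval_cases D <;> interval_cases e <;> omega

theorem exists_slope_of_pairwise [Infinite K] {d d₀ : ℕ} (hd0 : 0 < d) (hdd : d ≤ d₀)
    (hd3 : 3 ≤ d₀) {s : Finset E}
    (hs : s.Nonempty) (ht : ∀ f ∈ s, Transcendental K f)
    (hfd : ∀ f ∈ s, FiniteDimensional K⟮f⟯ E) (hd : ∀ f ∈ s, Module.finrank K⟮f⟯ E = d)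
    (hpair : ∀ z ∈ s, ∀ w ∈ s, z ≠ w → K⟮z, w⟯ = adjoin K (s : Set E)) :
    ∃ N A q, 0 < N ∧ HasSlope (adjoin K (s : Set E)) ((∏ f ∈ s, pencil K f) ^ N) A ∧
      A + 1 ≤ Module.finrank K ((∏ f ∈ s, pencil K f) ^ N : Submodule K E) + q ∧
      Module.finrank (adjoin K (s : Set E)) E * (q + 1) ≤ (d₀ - 1) ^ 2 := by
  obtain ⟨f, hf⟩ := id hs
  have := hfd f hf
  obtain ⟨D, hD, -, he⟩ := exists_mul_finrank_eq
    (adjoin_simple_le_iff.mpr (subset_adjoin K (s : Set E) hf))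
  rw [hd f hf] at hD
  obtain ⟨q, hq⟩ : ∃ q, 2 * q = D * (D - 1) := by
    obtain ⟨q, hq⟩ := Nat.even_mul_pred_self D
    exact ⟨q, by omega⟩
  refine ⟨1, _, q, one_pos, hasSlope_prod_pow hs ht hfd hd hD he 1, ?_, ?_⟩
  · have h1 := sum_min_lt_finrank_prod ht hfd hd (D := D)
      (fun z hz w hw hzw => by rw [hpair z hz w hw hzw, hD])
    have h2 := two_mul_mul_le D s.card
    rw [pow_one]
    omega
  · exact mul_choose_le he (Nat.pos_of_mul_pos_right (hD ▸ hd0)) (hD.trans_le hdd) hd3 hq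

theorem exists_hasDefect {d : ℕ} (hd0 : 0 < d) {s : Finset E}
    (ht : ∀ f ∈ s, Transcendental K f) (hfd : ∀ f ∈ s, FiniteDimensional K⟮f⟯ E)
    (hd : ∀ f ∈ s, Module.finrank K⟮f⟯ E = d) {x y : E} (hx : x ∈ s) (hy : y ∈ s)
    (hxy : K⟮x⟯ ≠ K⟮y⟯) (hne : K⟮x, y⟯ ≠ adjoin K (s : Set E)) :
    ∃ D q, D * Module.finrank (adjoin K (s : Set E)) E = d ∧ HasDefect K s D q ∧
      q + 1 ≤ (D - 1) ^ 2 := by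
  classical
  have hxy' : x ≠ y := fun h => hxy (by rw [h])
  have := hfd x hx
  have := hfd y hy
  obtain ⟨e₁, he₁, he₁0, hxy0⟩ := exists_mul_finrank_eq
    (M := K⟮x⟯) (M' := K⟮x, y⟯) (adjoin.mono K _ _ (by simp))
  rw [hd x hx] at he₁
  have he₁2 : 2 ≤ e₁ := by
    by_contra! hlt
    have h1 : e₁ = 1 := by omega
    rw [h1, one_mul] at he₁
    have h2 : K⟮x⟯ = K⟮x, y⟯ := eq_of_le_of_finrank_eq' (adjoin.mono K _ _ (by simp))
      (by rw [he₁, hd x hx])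
    have h3 : K⟮y⟯ = K⟮x, y⟯ := eq_of_le_of_finrank_eq' (adjoin.mono K _ _ (by simp))
      (by rw [he₁, hd y hy])
    exact hxy (h2.trans h3.symm)
  have hpair : HasDefect K {y, x} e₁ ((e₁ - 1) * (e₁ - 1)) := by
    have h := (hasDefect_singleton (ht x hx)).finset_insert (z := y) (e := e₁)
      (by simpa using hxy'.symm) (ht y hy) (hd y hy)
      (by rw [Finset.coe_singleton, one_mul, hd x hx])
      (by
        rw [Finset.coe_singleton, hd x hx, ← he₁, Set.pair_comm]) hd0
    simpa using h
  suffices ∀ t ⊆ s, x ∈ t → y ∈ t → ∃ D q, D * Module.finrank (adjoin K (t : Set E)) E = d ∧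
      HasDefect K t D q ∧ 2 ≤ D ∧ q ≤ (D - 1) ^ 2 ∧ (D ≠ e₁ → q + 1 ≤ (D - 1) ^ 2) by
    obtain ⟨D, q, hD, hdef, -, -, hq⟩ := this s subset_rfl hx hy
    refine ⟨D, q, hD, hdef, hq ?_⟩
    rintro rfl
    have : FiniteDimensional K⟮x, y⟯ E := Module.finite_of_finrank_pos hxy0
    refine hne (eq_of_le_of_finrank_eq' (adjoin.mono K _ _ ?_) ?_)
    · rintro z (rfl | rfl) <;> assumption
    · exact Nat.eq_of_mul_eq_mul_left he₁0 (he₁.trans hD.symm)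
  suffices ∀ t ⊆ s, x ∉ t → y ∉ t → ∃ D q,
      D * Module.finrank (adjoin K ((t ∪ {y, x} : Finset E) : Set E)) E = d ∧
      HasDefect K (t ∪ {y, x}) D q ∧ 2 ≤ D ∧ q ≤ (D - 1) ^ 2 ∧ (D ≠ e₁ → q + 1 ≤ (D - 1) ^ 2) by
    intro t hts hxt hyt
    have h := this (t \ {y, x}) (Finset.sdiff_subset.trans hts) (by simp) (by simp)
    rwa [Finset.sdiff_union_of_subset (by
      intro z hz
      simp only [Finset.mem_insert, Finset.mem_singleton] at hz
      rcases hz with rfl | rfl <;> assumption)] at h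
  intro t
  induction t using Finset.induction_on with
  | empty =>
    intro _ _ _
    refine ⟨e₁, _, ?_, by simpa using hpair, he₁2, by rw [sq], fun h => absurd rfl h⟩
    rw [← he₁, Finset.empty_union, Finset.coe_pair, Set.pair_comm]
  | insert z t hzt ih =>
    intro hts hxt hyt
    obtain ⟨D, q, hD, hdef, hD2, hq, hq'⟩ := ih (fun w hw => hts (by simp [hw]))
      (fun h => hxt (by simp [h])) (fun h => hyt (by simp [h]))
    have hz : z ∈ s := hts (by simp)
    have := hfd z hz
    have hS0 : 0 < Module.finrank (adjoin K ((t ∪ {y, x} : Finset E) : Set E)) E := by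
      rw [← hD] at hd0
      exact Nat.pos_of_mul_pos_left hd0
    have : FiniteDimensional (adjoin K ((t ∪ {y, x} : Finset E) : Set E)) E :=
      Module.finite_of_finrank_pos hS0
    obtain ⟨e, he, he0, -⟩ := exists_mul_finrank_eq
      (adjoin.mono K _ _ (Set.subset_insert z ((t ∪ {y, x} : Finset E) : Set E)))
    have hins := hdef.finset_insert (z := z) (e := e) (by
      simp only [Finset.mem_union, Finset.mem_insert, Finset.mem_singleton, not_or]
      exact ⟨hzt, fun h => hyt (by simp [h]), fun h => hxt (by simp [h])⟩)
      (ht z hz) (hd z hz) hD he hd0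
    rw [← Finset.insert_union] at hins
    refine ⟨e * D, _, ?_, hins, ?_, ?_⟩
    · rw [← hD, ← he, Finset.insert_union, Finset.coe_insert]
      ring
    · nlinarith
    · rcases Nat.lt_or_ge e 2 with he2 | he2
      · have : e = 1 := by omega
        subst this
        simpa using ⟨hq, hq'⟩
      · have := sq_arith he2 hD2 hq
        exact ⟨by omega, fun _ => this⟩

theorem exists_slope_bound [Infinite K] {d d₀ : ℕ} (hd0 : 0 < d) (hdd : d ≤ d₀)
    (hd3 : 3 ≤ d₀) {s : Finset E}
    (hs : s.Nonempty) (ht : ∀ f ∈ s, Transcendental K f)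
    (hfd : ∀ f ∈ s, FiniteDimensional K⟮f⟯ E) (hd : ∀ f ∈ s, Module.finrank K⟮f⟯ E = d)
    (hne : ∀ f ∈ s, ∀ g ∈ s, f ≠ g → K⟮f⟯ ≠ K⟮g⟯) :
    ∃ N A q, 0 < N ∧ HasSlope (adjoin K (s : Set E)) ((∏ f ∈ s, pencil K f) ^ N) A ∧
      A + 1 ≤ Module.finrank K ((∏ f ∈ s, pencil K f) ^ N : Submodule K E) + q ∧
      Module.finrank (adjoin K (s : Set E)) E * (q + 1) ≤ (d₀ - 1) ^ 2 := by
  by_cases hpair : ∀ z ∈ s, ∀ w ∈ s, z ≠ w → K⟮z, w⟯ = adjoin K (s : Set E)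
  · exact exists_slope_of_pairwise hd0 hdd hd3 hs ht hfd hd hpair
  push Not at hpair
  obtain ⟨x, hx, y, hy, hxy, hE⟩ := hpair
  obtain ⟨D, q, hD, hdef, hq⟩ := exists_hasDefect hd0 ht hfd hd hx hy
    (hne x hx y hy hxy) hE
  have he : 0 < Module.finrank (adjoin K (s : Set E)) E := by
    rw [← hD] at hd0
    exact Nat.pos_of_mul_pos_left hd0
  obtain ⟨n, hn, hdim⟩ := hdef d
  have hnm : ∀ f ∈ s, n f ≤ ∑ f ∈ s, n f := fun f hf =>
    Finset.single_le_sum (f := n) (fun _ _ => Nat.zero_le _) hf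
  have h := finrank_prod_add_le ht hfd hd hD hn hnm
  refine ⟨∑ f ∈ s, n f, _, q, ?_, hasSlope_prod_pow hs ht hfd hd hD he _, ?_, ?_⟩
  · have h1 := hn x hx
    have h2 := hnm x hx
    omega
  · rw [← Finset.prod_pow]
    rw [Finset.sum_const, smul_eq_mul] at h
    have : (∑ f ∈ s, n f) * (s.card * D) = D * (s.card * ∑ f ∈ s, n f) := by ring
    rw [this]
    omega
  · refine (Nat.mul_le_mul_left _ hq).trans ((mul_sq_le he).trans ?_)
    rw [hD]
    exact Nat.pow_le_pow_left (Nat.sub_le_sub_right hdd 1) 2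

theorem two_le_finrank_prod_pow {s : Finset E} {f : E} (hf : f ∈ s) (ht : Transcendental K f)
    [FiniteDimensional K⟮f⟯ E] {N : ℕ} (hN : 0 < N) :
    2 ≤ Module.finrank K ((∏ f ∈ s, pencil K f) ^ N : Submodule K E) := by
  classical
  have h1 : 2 ≤ Module.finrank K (pencil K f) := by
    have h := finrank_add_rankOver_le ht (W := 1) (Submodule.one_eq_span (R := K) (A := E) ▸
      Submodule.fg_span (Set.finite_singleton _))
    have := rankOver_pos (K := K) (z := f) (W := 1) le_rfl
    rw [finrank_one, one_mul (pencil K f)] at h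
    omega
  have hone : ∀ t : Finset E, (1 : Submodule K E) ≤ ∏ f ∈ t, pencil K f := fun t => by
    simpa using one_le_prod_pencil (K := K) t (fun _ => 1)
  refine h1.trans (finrank_mono_of_fg ?_ ?_)
  · exact Submodule.FG.pow (by simpa using fg_prod_pencil (K := K) s (fun _ => 1)) N
  · rw [← Nat.succ_pred_eq_of_pos hN, pow_succ']
    refine le_trans ?_ (le_mul_of_one_le (one_le_pow_of_one_le' (hone s) _))
    rw [← Finset.mul_prod_erase s _ hf]
    exact le_mul_of_one_le (hone _)

end Core

section Drop

variable {K E Γ : Type*} [Field K] [Field E] [Algebra K E] [LinearOrderedCommGroupWithZero Γ]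

/-- The elements of valuation at most `γ`, for a valuation `v` trivial on `K`. -/
def valuationBall (v : Valuation E Γ) (hv : ∀ c : K, v (algebraMap K E c) ≤ 1) (γ : Γ) :
    Submodule K E where
  carrier := {x | v x ≤ γ}
  zero_mem' := by simp
  add_mem' := fun ha hb => (v.map_add _ _).trans (max_le ha hb)
  smul_mem' := fun c x hx => by
    show v (c • x) ≤ γ
    rw [Algebra.smul_def, map_mul]
    exact mul_le_of_le_one_of_le (hv c) hx

theorem mem_valuationBall {v : Valuation E Γ} {hv : ∀ c : K, v (algebraMap K E c) ≤ 1} {γ : Γ}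
    {x : E} : x ∈ valuationBall v hv γ ↔ v x ≤ γ := Iff.rfl

theorem exists_max_valuation (v : Valuation E Γ) (hv : ∀ c : K, v (algebraMap K E c) ≤ 1)
    {V : Submodule K E} (hV : V.FG) : ∃ x ∈ V, ∀ y ∈ V, v y ≤ v x := by
  classical
  obtain ⟨s, rfl⟩ := hV
  rcases s.eq_empty_or_nonempty with rfl | hs
  · exact ⟨0, Submodule.zero_mem _, fun y hy => by simp_all⟩
  obtain ⟨x, hx, hmax⟩ := s.exists_max_image v hs
  refine ⟨x, Submodule.subset_span hx, fun y hy => ?_⟩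
  have : Submodule.span K (s : Set E) ≤ valuationBall v hv (v x) := by
    rw [Submodule.span_le]
    exact fun z hz => hmax z hz
  exact this hy

theorem finrank_add_le_of_valuation (v : Valuation E Γ)
    (hv : ∀ c : K, v (algebraMap K E c) ≤ 1) {N B : Submodule K E} (hB : B.FG) (hNB : N ≤ B)
    {γ : ℕ → Γ} (hγ : StrictMono γ) (hN : ∀ x ∈ N, v x ≤ γ 0) {n : ℕ}
    (h : ∀ j ≤ n, ∃ x ∈ B, v x = γ j) :
    Module.finrank K N + n ≤ Module.finrank K B := by
  suffices ∀ j ≤ n, Module.finrank K N + j ≤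
      Module.finrank K (B ⊓ valuationBall v hv (γ j) : Submodule K E) from
    (this n le_rfl).trans (finrank_mono_of_fg hB inf_le_left)
  have hfg : ∀ j, (B ⊓ valuationBall v hv (γ j)).FG := fun j => fg_of_le hB inf_le_left
  intro j
  induction j with
  | zero =>
    intro _
    exact finrank_mono_of_fg (hfg 0) (le_inf hNB fun x hx => hN x hx)
  | succ j ih =>
    intro hj
    have h1 := ih (by omega)
    obtain ⟨x, hxB, hx⟩ := h (j + 1) hj
    have : Module.Finite K (B ⊓ valuationBall v hv (γ (j + 1)) : Submodule K E) :=
      Module.Finite.iff_fg.mpr (hfg _)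
    have h2 : B ⊓ valuationBall v hv (γ j) < B ⊓ valuationBall v hv (γ (j + 1)) := by
      refine lt_of_le_of_ne (inf_le_inf_left _ fun y hy => ?_) fun heq => ?_
      · exact le_trans hy (hγ.monotone (Nat.le_succ j))
      · have hmem : x ∈ B ⊓ valuationBall v hv (γ (j + 1)) := ⟨hxB, hx.le⟩
        rw [← heq] at hmem
        have := (hx ▸ hmem.2 : γ (j + 1) ≤ γ j)
        exact (hγ (Nat.lt_succ_self j)).not_ge this
    have := Submodule.finrank_lt_finrank_of_lt h2
    omega

theorem valuation_le_of_mem_mul (v : Valuation E Γ)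
    (hv : ∀ c : K, v (algebraMap K E c) ≤ 1) {A B : Submodule K E} {a b : Γ}
    (hA : ∀ x ∈ A, v x ≤ a) (hB : ∀ x ∈ B, v x ≤ b) : ∀ x ∈ A * B, v x ≤ a * b := by
  have : A * B ≤ valuationBall v hv (a * b) := by
    rw [Submodule.mul_le]
    intro x hx y hy
    rw [mem_valuationBall, map_mul]
    exact mul_le_mul' (hA x hx) (hB y hy)
  exact this

theorem valuation_le_of_mem_pow (v : Valuation E Γ)
    (hv : ∀ c : K, v (algebraMap K E c) ≤ 1) {A : Submodule K E} {a : Γ}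
    (hA : ∀ x ∈ A, v x ≤ a) (n : ℕ) : ∀ x ∈ A ^ n, v x ≤ a ^ n := by
  induction n with
  | zero =>
    intro x hx
    rw [pow_zero, Submodule.mem_one] at hx
    obtain ⟨c, rfl⟩ := hx
    simpa using hv c
  | succ n ih =>
    rw [pow_succ, pow_succ]
    exact valuation_le_of_mem_mul v hv ih hA

theorem exists_drop (v : Valuation E Γ) (hv : ∀ c : K, v (algebraMap K E c) ≤ 1)
    (hres : ∀ x : E, v x ≤ 1 → ∃ c : K, v (x - algebraMap K E c) < 1)
    {V : Submodule K E} (hV : V.FG) (h0 : 0 < Module.finrank K V) :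
    ∃ v₀ ∈ V, v₀ ≠ 0 ∧ ∃ V' ≤ V, Module.finrank K V' + 1 = Module.finrank K V ∧
      (∀ x ∈ V', v x < v v₀) ∧ V = V' ⊔ Submodule.span K {v₀} := by
  obtain ⟨v₀, hv₀, hmax⟩ := exists_max_valuation v hv hV
  have hne : v₀ ≠ 0 := by
    rintro rfl
    have hbot : V = ⊥ := (Submodule.eq_bot_iff _).mpr fun x hx => by
      simpa using hmax x hx
    rw [hbot, finrank_bot] at h0
    exact lt_irrefl _ h0
  have hpos : 0 < v v₀ := zero_lt_iff.mpr ((Valuation.ne_zero_iff v).mpr hne)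
  let V' : Submodule K E :=
    { carrier := {x | x ∈ V ∧ v x < v v₀}
      zero_mem' := ⟨Submodule.zero_mem _, by simpa using hpos⟩
      add_mem' := fun ha hb => ⟨Submodule.add_mem _ ha.1 hb.1, v.map_add_lt ha.2 hb.2⟩
      smul_mem' := fun c x hx => ⟨Submodule.smul_mem _ c hx.1, by
        rw [Algebra.smul_def, map_mul]
        exact (mul_le_of_le_one_left' (hv c)).trans_lt hx.2⟩ }
  have hle : V' ≤ V := fun x hx => hx.1
  have hsup : V = V' ⊔ Submodule.span K {v₀} := by
    refine le_antisymm (fun x hx => ?_) (sup_le hle (by simpa using hv₀))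
    obtain ⟨c, hc⟩ := hres (x / v₀) (by
      rw [map_div₀]
      exact div_le_one_of_le₀ (hmax x hx) zero_le)
    have h1 : v (x - c • v₀) < v v₀ := by
      have : x - c • v₀ = (x / v₀ - algebraMap K E c) * v₀ := by
        rw [Algebra.smul_def]; field_simp
      rw [this, map_mul]
      calc _ < 1 * v v₀ := by gcongr
        _ = _ := one_mul _
    rw [← sub_add_cancel x (c • v₀)]
    exact Submodule.add_mem_sup
      (show x - c • v₀ ∈ V' from ⟨Submodule.sub_mem _ hx (Submodule.smul_mem _ _ hv₀), h1⟩)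
      (Submodule.smul_mem _ _ (Submodule.mem_span_singleton_self v₀))
  refine ⟨v₀, hv₀, hne, V', hle, ?_, fun x hx => hx.2, hsup⟩
  have hfin : Module.Finite K V' := Module.Finite.iff_fg.mpr (fg_of_le hV hle)
  have hinf : V' ⊓ Submodule.span K {v₀} = ⊥ := by
    rw [Submodule.eq_bot_iff]
    rintro x ⟨hx1, hx2⟩
    obtain ⟨c, rfl⟩ := Submodule.mem_span_singleton.mp hx2
    by_contra hcon
    have hc : c ≠ 0 := fun h => hcon (by simp [h])
    have := (Submodule.smul_mem V' c⁻¹ hx1).2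
    rw [inv_smul_smul₀ hc] at this
    exact lt_irrefl _ this
  have := Submodule.finrank_sup_add_finrank_inf_eq V' (Submodule.span K {v₀})
  rw [hinf, finrank_bot, ← hsup, finrank_span_singleton hne] at this
  omega

theorem HasSlope.drop (v : Valuation E Γ) (hv : ∀ c : K, v (algebraMap K E c) ≤ 1)
    {M : IntermediateField K E} {V V' : Submodule K E} {A : ℕ} (h : HasSlope M V A) (hV : V.FG)
    (hVV : V' ≤ V) {v₀ : E} (hv₀ : v₀ ∈ V) (hlt : ∀ x ∈ V', v x < v v₀)
    (h0 : 0 < Module.finrank K V') : ∃ B, A = B + 1 ∧ HasSlope M V' B := by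
  obtain ⟨v₁, hv₁, hmax⟩ := exists_max_valuation v hv (fg_of_le hV hVV)
  have hne₁ : v₁ ≠ 0 := by
    rintro rfl
    have hbot : V' = ⊥ := (Submodule.eq_bot_iff _).mpr fun x hx => by
      simpa using hmax x hx
    rw [hbot, finrank_bot] at h0
    exact lt_irrefl _ h0
  have hlt₁ := hlt v₁ hv₁
  have hpos₁ : 0 < v v₁ := zero_lt_iff.mpr ((Valuation.ne_zero_iff v).mpr hne₁)
  have key : ∀ U : Submodule K E, U.FG → U ≠ ⊥ → ∀ n,
      Module.finrank K (U * V' ^ n : Submodule K E) + n ≤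
        Module.finrank K (U * V ^ n : Submodule K E) := by
    intro U hU hU0 n
    obtain ⟨u, hu, humax⟩ := exists_max_valuation v hv hU
    have hune : u ≠ 0 := by
      rintro rfl
      exact hU0 ((Submodule.eq_bot_iff _).mpr fun x hx => by simpa using humax x hx)
    have hupos : 0 < v u := zero_lt_iff.mpr ((Valuation.ne_zero_iff v).mpr hune)
    refine finrank_add_le_of_valuation v hv (hU.mul (hV.pow n))
      (mul_le_mul' le_rfl (pow_le_pow_left' hVV n))
      (γ := fun j => v u * v v₁ ^ n * (v v₀ / v v₁) ^ j) ?_ ?_ ?_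
    · refine strictMono_nat_of_lt_succ fun j => ?_
      have h1 : 1 < v v₀ / v v₁ := (one_lt_div₀ hpos₁).mpr hlt₁
      have h2 : 0 < v u * v v₁ ^ n * (v v₀ / v v₁) ^ j :=
        mul_pos (mul_pos hupos (pow_pos hpos₁ n)) (pow_pos (zero_lt_one.trans h1) j)
      rw [pow_succ, ← mul_assoc]
      exact lt_mul_of_one_lt_right h2 h1
    · rw [pow_zero, mul_one]
      exact valuation_le_of_mem_mul v hv humax (valuation_le_of_mem_pow v hv hmax n)
    · intro j hj
      refine ⟨u * (v₁ ^ (n - j) * v₀ ^ j), Submodule.mul_mem_mul hu ?_, ?_⟩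
      · have := Submodule.mul_mem_mul (Submodule.pow_mem_pow V (hVV hv₁) (n - j))
          (Submodule.pow_mem_pow V hv₀ j)
        rwa [← pow_add, Nat.sub_add_cancel hj] at this
      · have : v v₁ ^ n = v v₁ ^ (n - j) * v v₁ ^ j := by
          rw [← pow_add, Nat.sub_add_cancel hj]
        rw [map_mul, map_mul, map_pow, map_pow, this, div_pow]
        field_simp
  have hA : A ≠ 0 := by
    rintro rfl
    obtain ⟨C, hC⟩ := h 1 (Submodule.one_eq_span (R := K) (A := E) ▸
      Submodule.fg_span (Set.finite_singleton _)) (fun x hx => by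
        obtain ⟨c, rfl⟩ := Submodule.mem_one.mp hx
        exact M.algebraMap_mem c)
    have h1 := key 1 (Submodule.one_eq_span (R := K) (A := E) ▸
      Submodule.fg_span (Set.finite_singleton _)) one_ne_zero (C + 1)
    have h2 := hC (C + 1)
    omega
  obtain ⟨B, rfl⟩ := Nat.exists_eq_succ_of_ne_zero hA
  refine ⟨B, rfl, fun U hU hUM => ?_⟩
  obtain ⟨C, hC⟩ := h U hU hUM
  rcases eq_or_ne U ⊥ with rfl | hU0
  · refine ⟨C, fun n => ?_⟩
    rw [Submodule.bot_mul, finrank_bot]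
    exact Nat.zero_le _
  · refine ⟨C, fun n => ?_⟩
    have h1 := key U hU hU0 n
    have h2 := hC n
    rw [Nat.succ_eq_add_one, mul_add] at h2
    omega

theorem exists_two_dimensional (v : Valuation E Γ) (hv : ∀ c : K, v (algebraMap K E c) ≤ 1)
    (hres : ∀ x : E, v x ≤ 1 → ∃ c : K, v (x - algebraMap K E c) < 1)
    {M : IntermediateField K E} {q : ℕ} (m : ℕ) :
    ∀ {V : Submodule K E} {A : ℕ}, V.FG → (∀ x ∈ V, x ∈ M) → HasSlope M V A →
      Module.finrank K V = m + 2 → A + 1 ≤ m + 2 + q →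
      ∃ W : Submodule K E, W.FG ∧ (∀ x ∈ W, x ∈ M) ∧ Module.finrank K W = 2 ∧
        HasSlope M W (q + 1) := by
  induction m with
  | zero =>
    intro V A hV hVM h hm hA
    exact ⟨V, hV, hVM, hm, h.mono (by omega)⟩
  | succ m ih =>
    intro V A hV hVM h hm hA
    obtain ⟨v₀, hv₀, -, V', hle, hdim, hlt, -⟩ := exists_drop v hv hres hV (by omega)
    obtain ⟨B, rfl, hB⟩ := h.drop v hv hV hle hv₀ hlt (by omega)
    exact ih (fg_of_le hV hle) (fun x hx => hVM x (hle hx)) hB (by omega) (by omega)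

theorem succ_le_finrank_pencil_pow {h : E} (hh : Transcendental K h) (n : ℕ) :
    n + 1 ≤ Module.finrank K (pencil K h ^ n : Submodule K E) := by
  induction n with
  | zero => rw [pow_zero, finrank_one]
  | succ n ih =>
    have h1 := finrank_add_card_le_mul_pencil hh ((fg_pencil h).pow n) (ι := Unit)
      (b := fun _ => (1 : E)) (LinearIndependent.of_subsingleton () one_ne_zero)
      (fun _ => Submodule.subset_span
        (one_mem_of_one_le (one_le_pow_of_one_le' (one_le_pencil h) n)))
    rw [pow_succ]
    rw [Fintype.card_unit] at h1
    omega

theorem finrank_le_of_hasSlope_pencil {M : IntermediateField K E} {h : E} {A : ℕ} (hhM : h ∈ M)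
    (hh : Transcendental K h) (hs : HasSlope M (pencil K h) A) :
    Module.finrank K⟮h⟯ E ≤ A * Module.finrank M E := by
  have hle : K⟮h⟯ ≤ M := adjoin_simple_le_iff.mpr hhM
  rw [← Module.finrank_mul_finrank K⟮h⟯ (extendScalars hle) E]
  refine Nat.mul_le_mul_right _ ?_
  by_cases hfin : Module.Finite K⟮h⟯ (extendScalars hle)
  swap
  · rw [Module.finrank_of_not_finite hfin]; exact Nat.zero_le _
  have : Module.Free K⟮h⟯ (extendScalars hle) := Module.Free.of_divisionRing _ _
  let b := Module.finBasis K⟮h⟯ (extendScalars hle)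
  set r := Module.finrank K⟮h⟯ (extendScalars hle)
  let w : Fin r → E := fun i => (b i : E)
  have hw : LinearIndependent K⟮h⟯ w :=
    b.linearIndependent.map' ((extendScalars hle).val.toLinearMap)
      (LinearMap.ker_eq_bot.mpr Subtype.val_injective)
  have hwM : Submodule.span K (Set.range w) ≤ M.toSubmodule := by
    rw [Submodule.span_le]
    rintro _ ⟨i, rfl⟩
    exact (b i).2
  have hfg : (Submodule.span K (Set.range w)).FG := Submodule.fg_span (Set.finite_range w)
  obtain ⟨C, hC⟩ := hs _ hfg fun x hx => hwM hx
  have h1 : ∀ n, r * (n + 1) ≤ n * A + C := fun n => by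
    refine le_trans ?_ (hC n)
    have h2 := card_mul_finrank_le K⟮h⟯ hw ((fg_pencil h).pow n) hfg
      (fun i => Submodule.subset_span ⟨i, rfl⟩) (fun x hx => by
        have := mem_adjoin_of_mem_prod_pencil (K := K) {h} (fun _ => n) x (by simpa using hx)
        rwa [Finset.coe_singleton] at this)
    rw [Fintype.card_fin] at h2
    exact (Nat.mul_le_mul_left _ (succ_le_finrank_pencil_pow hh n)).trans h2
  by_contra! hlt
  have h2 := h1 C
  have h3 : (A + 1) * (C + 1) ≤ r * (C + 1) := Nat.mul_le_mul_right _ hlt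
  nlinarith

theorem transcendental_of_valuation_lt_one (v : Valuation E Γ)
    (hv : ∀ c : K, v (algebraMap K E c) ≤ 1) {h : E} (h0 : h ≠ 0) (h1 : v h < 1) :
    Transcendental K h := by
  intro halg
  have hmem : h⁻¹ ∈ Algebra.adjoin K {h} :=
    halg.isIntegral.inv_mem (Algebra.self_mem_adjoin_singleton K h)
  have hle : ∀ x ∈ Algebra.adjoin K {h}, v x ≤ 1 := by
    intro x hx
    induction hx using Algebra.adjoin_induction with
    | mem x hx => rw [Set.mem_singleton_iff.mp hx]; exact h1.le
    | algebraMap r => exact hv r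
    | add x y _ _ hx hy => exact (v.map_add x y).trans (max_le hx hy)
    | mul x y _ _ hx hy => rw [map_mul]; exact mul_le_one' hx hy
  have hle := hle _ hmem
  rw [map_inv₀] at hle
  have hpos : 0 < v h := zero_lt_iff.mpr ((Valuation.ne_zero_iff v).mpr h0)
  exact ((one_lt_inv₀ hpos).mpr h1).not_ge hle

theorem exists_transcendental_finrank_le (v : Valuation E Γ)
    (hv : ∀ c : K, v (algebraMap K E c) ≤ 1)
    (hres : ∀ x : E, v x ≤ 1 → ∃ c : K, v (x - algebraMap K E c) < 1)
    {M : IntermediateField K E} {V : Submodule K E} {A q : ℕ} (hV : V.FG)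
    (hVM : ∀ x ∈ V, x ∈ M) (h2 : 2 ≤ Module.finrank K V) (hs : HasSlope M V A)
    (hA : A + 1 ≤ Module.finrank K V + q) :
    ∃ h : E, Transcendental K h ∧ Module.finrank K⟮h⟯ E ≤ (q + 1) * Module.finrank M E := by
  obtain ⟨m, hm⟩ := Nat.exists_eq_add_of_le' h2
  obtain ⟨W, hW, hWM, hW2, hWs⟩ := exists_two_dimensional (q := q) v hv hres m hV hVM hs hm
    (by omega)
  obtain ⟨v₀, hv₀, hne, V', hle, hdim, hlt, hsup⟩ := exists_drop v hv hres hW (by omega)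
  obtain ⟨v₁, hv₁, hspan⟩ : ∃ v₁ : V', v₁ ≠ 0 ∧ ∀ w : V', ∃ c : K, c • v₁ = w :=
    finrank_eq_one_iff'.mp (by omega)
  have hv₁0 : (v₁ : E) ≠ 0 := fun h => hv₁ (Subtype.ext h)
  set h := (v₁ : E) / v₀ with hh
  have hV' : V' ≤ Submodule.span K {(v₁ : E)} := fun x hx => by
    obtain ⟨c, hc⟩ := hspan ⟨x, hx⟩
    rw [Submodule.mem_span_singleton]
    exact ⟨c, congrArg Subtype.val hc⟩
  have hpos : 0 < v v₀ := zero_lt_iff.mpr ((Valuation.ne_zero_iff v).mpr hne)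
  have htr : Transcendental K h := transcendental_of_valuation_lt_one v hv
    (div_ne_zero hv₁0 hne) (by
      rw [map_div₀]
      exact (div_lt_one₀ hpos).mpr (hlt _ v₁.2))
  refine ⟨h, htr, finrank_le_of_hasSlope_pencil (div_mem (hWM _ (hle v₁.2)) (hWM _ hv₀)) htr ?_⟩
  have hpen : pencil K h ≤ Submodule.span K {v₀⁻¹} * W := by
    refine pencil_le ?_ ?_
    · rw [← inv_mul_cancel₀ hne]
      exact Submodule.mul_mem_mul (Submodule.mem_span_singleton_self _) hv₀
    · rw [hh, div_eq_inv_mul]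
      exact Submodule.mul_mem_mul (Submodule.mem_span_singleton_self _) (hle v₁.2)
  intro U hU hUM
  obtain ⟨C, hC⟩ := hWs U hU hUM
  refine ⟨C, fun n => le_trans ?_ (hC n)⟩
  have h3 : U * pencil K h ^ n ≤ Submodule.span K {v₀⁻¹ ^ n} * (U * W ^ n) := by
    refine (mul_le_mul' le_rfl (pow_le_pow_left' hpen n)).trans_eq ?_
    rw [mul_pow, Submodule.span_pow, Set.singleton_pow]
    exact mul_left_comm _ _ _
  have hfg1 : (Submodule.span K {v₀⁻¹ ^ n} : Submodule K E).FG :=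
    Submodule.fg_span (Set.finite_singleton _)
  have hfg2 : (U * W ^ n).FG := hU.mul (hW.pow n)
  refine (finrank_mono_of_fg (hfg1.mul hfg2) h3).trans ((finrank_mul_le hfg1 hfg2).trans ?_)
  rw [finrank_span_singleton (pow_ne_zero n (inv_ne_zero hne)), one_mul]

end Drop

section CommonPole

open Polynomial Polynomial.Bivariate

variable {K E Γ : Type*} [Field K] [Field E] [Algebra K E] [LinearOrderedCommGroupWithZero Γ]

theorem exists_moebius_relation {x y : E} (hx : Transcendental K x) (hy : Transcendental K y)
    (hfx : FiniteDimensional K⟮x⟯ E) (hxy : K⟮x⟯ = K⟮y⟯) :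
    ∃ α β γ δ : K, (α ≠ 0 ∨ β ≠ 0 ∨ γ ≠ 0 ∨ δ ≠ 0) ∧ algebraMap K E α * (x * y) +
      algebraMap K E β * x + algebraMap K E γ * y + algebraMap K E δ = 0 := by
  have hfy : FiniteDimensional K⟮y⟯ E := by rwa [← hxy]
  obtain ⟨Φ, hΦ0, hΦ, hb, ha⟩ := exists_bivariate_relation hx hy
  have h2 : K⟮x, y⟯ = K⟮x⟯ := by
    refine le_antisymm ?_ (adjoin.mono K _ _ (by simp))
    rw [adjoin_le_iff]
    rintro z (rfl | rfl)
    · exact mem_adjoin_simple_self K z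
    · rw [SetLike.mem_coe, hxy]; exact mem_adjoin_simple_self K z
  have hpos : 0 < Module.finrank K⟮x⟯ E := Module.finrank_pos
  rw [← hxy, h2] at ha
  rw [h2] at hb
  have hb1 : Φ.natDegree = 1 := Nat.eq_of_mul_eq_mul_right hpos (by rw [hb, one_mul])
  have ha1 : (swap Φ).natDegree = 1 := Nat.eq_of_mul_eq_mul_right hpos (by rw [ha, one_mul])
  have hdeg : ∀ j, (Φ.coeff j).natDegree ≤ 1 := fun j =>
    natDegree_le_iff_coeff_eq_zero.mpr fun i hi => by
      rw [← coeff_coeff_swap, coeff_eq_zero_of_natDegree_lt (ha1.trans_lt hi), coeff_zero]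
  have hsum : ∀ j, aeval x (Φ.coeff j) =
      algebraMap K E ((Φ.coeff j).coeff 0) + algebraMap K E ((Φ.coeff j).coeff 1) * x := by
    intro j
    rw [aeval_eq_sum_range' (Nat.lt_succ_of_le (hdeg j))]
    simp [Algebra.smul_def, Finset.sum_range_succ]
  have hsum' : aeval x (Φ.coeff 0) + aeval x (Φ.coeff 1) * y = 0 := by
    rw [← hΦ, aevalAeval_eq_eval₂, eval₂_eq_sum_range, hb1]
    simp [Finset.sum_range_succ]
  refine ⟨(Φ.coeff 1).coeff 1, (Φ.coeff 0).coeff 1, (Φ.coeff 1).coeff 0, (Φ.coeff 0).coeff 0,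
    ?_, ?_⟩
  · by_contra! hcon
    obtain ⟨h11, h01, h10, h00⟩ := hcon
    apply hΦ0
    ext j i
    simp only [coeff_zero]
    rcases lt_or_ge 1 j with hj | hj
    · rw [coeff_eq_zero_of_natDegree_lt (hb1.trans_lt hj), coeff_zero]
    rcases lt_or_ge 1 i with hi | hi
    · rw [coeff_eq_zero_of_natDegree_lt ((hdeg j).trans_lt hi)]
    interval_cases i <;> interval_cases j <;> simpa
  · rw [hsum, hsum] at hsum'
    rw [← hsum']
    ring

theorem valuation_add_algebraMap {v : Valuation E Γ} (hv : ∀ c : K, v (algebraMap K E c) ≤ 1)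
    {x : E} (hx : 1 < v x) (c : K) : v (x + algebraMap K E c) = v x :=
  v.map_add_eq_of_lt_left ((hv c).trans_lt hx)

theorem mem_pencil_of_adjoin_eq {v : Valuation E Γ} (hv : ∀ c : K, v (algebraMap K E c) ≤ 1)
    {x y : E} (hx : Transcendental K x) (hy : Transcendental K y)
    (hfx : FiniteDimensional K⟮x⟯ E) (hvx : 1 < v x) (hvy : 1 < v y) (hxy : K⟮x⟯ = K⟮y⟯) :
    y ∈ pencil K x := by
  obtain ⟨α, β, γ, δ, h0, h⟩ := exists_moebius_relation hx hy hfx hxy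
  have hα : α = 0 := by
    by_contra hα
    have hα' : algebraMap K E α ≠ 0 := (_root_.map_ne_zero _).mpr hα
    have h1 : (x + algebraMap K E (γ / α)) * (y + algebraMap K E (β / α)) =
        algebraMap K E (β * γ / α ^ 2 - δ / α) := by
      simp only [map_sub, map_mul, map_div₀, map_pow]
      field_simp
      linear_combination algebraMap K E α * h
    have h2 := congrArg v h1
    rw [map_mul, valuation_add_algebraMap hv hvx, valuation_add_algebraMap hv hvy] at h2
    exact (one_lt_mul'' hvx hvy).not_ge (h2 ▸ hv _)
  have hγ : γ ≠ 0 := by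
    rintro rfl
    subst hα
    simp only [map_zero, zero_mul, zero_add, add_zero] at h
    have hβ : β = 0 := by
      by_contra hβ
      have : x = algebraMap K E (-δ / β) := by
        have : algebraMap K E β ≠ 0 := (_root_.map_ne_zero _).mpr hβ
        rw [map_div₀, map_neg, eq_div_iff this]
        linear_combination h
      exact hx (this ▸ isAlgebraic_algebraMap _)
    subst hβ
    simp_all
  have hγ' : algebraMap K E γ ≠ 0 := (_root_.map_ne_zero _).mpr hγ
  refine mem_pencil.mpr ⟨-δ / γ, -β / γ, ?_⟩
  subst hα
  simp only [map_div₀, map_neg]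
  field_simp
  rw [map_zero] at h
  linear_combination h

theorem pencil_eq_of_adjoin_eq {v : Valuation E Γ} (hv : ∀ c : K, v (algebraMap K E c) ≤ 1)
    {x y : E} (hx : Transcendental K x) (hy : Transcendental K y)
    (hfx : FiniteDimensional K⟮x⟯ E) (hvx : 1 < v x) (hvy : 1 < v y) (hxy : K⟮x⟯ = K⟮y⟯) :
    pencil K x = pencil K y := by
  refine le_antisymm (pencil_le (one_mem_pencil y) ?_) (pencil_le (one_mem_pencil x) ?_)
  · exact mem_pencil_of_adjoin_eq hv hy hx (hxy ▸ hfx) hvy hvx hxy.symm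
  · exact mem_pencil_of_adjoin_eq hv hx hy hfx hvx hvy hxy

end CommonPole

section Descent

variable {k₀ F₀ K E : Type*} [Field k₀] [Field F₀] [Field K] [Field E] [Algebra k₀ F₀]
  [Algebra k₀ K] [Algebra k₀ E] [Algebra F₀ E] [Algebra K E] [IsScalarTower k₀ F₀ E]
  [IsScalarTower k₀ K E]

theorem linearIndependent_algebraMap_comp [Algebra.IsPushout k₀ K F₀ E] {ι : Type*} {y : ι → F₀}
    (hy : LinearIndependent k₀ y) : LinearIndependent K (fun i => algebraMap F₀ E (y i)) := by
  have h : IsBaseChange K (IsScalarTower.toAlgHom k₀ F₀ E).toLinearMap :=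
    Algebra.IsPushout.out
  let B := Module.Basis.extend hy.linearIndepOn_id
  have hy' : ∀ i, y i ∈ hy.linearIndepOn_id.extend (Set.subset_univ _) := fun i =>
    hy.linearIndepOn_id.subset_extend _ ⟨i, rfl⟩
  have h2 := (h.basis B).linearIndependent.comp (fun i => ⟨y i, hy' i⟩)
    (fun i j hij => hy.injective (congrArg Subtype.val hij))
  have h3 : (fun i => algebraMap F₀ E (y i)) = h.basis B ∘ fun i => ⟨y i, hy' i⟩ := by
    ext i
    simp [IsBaseChange.basis_apply, B]
  rw [h3]
  exact h2

theorem span_range_algebraMap [Algebra.IsPushout k₀ K F₀ E] :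
    Submodule.span K (Set.range (algebraMap F₀ E)) = ⊤ := by
  have h : IsBaseChange K (IsScalarTower.toAlgHom k₀ F₀ E).toLinearMap :=
    Algebra.IsPushout.out
  refine Submodule.eq_top_iff'.mpr fun x => ?_
  induction x using h.inductionOn with
  | zero => exact Submodule.zero_mem _
  | tmul m => exact Submodule.subset_span ⟨m, rfl⟩
  | smul s n hn => exact Submodule.smul_mem _ _ hn
  | add n₁ n₂ h₁ h₂ => exact Submodule.add_mem _ h₁ h₂

theorem exists_algEquiv_extending [Algebra.IsPushout k₀ K F₀ E] (σ : K ≃ₐ[k₀] K) :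
    ∃ φ : E ≃ₐ[F₀] E, ∀ c, φ (algebraMap K E c) = algebraMap K E (σ c) := by
  have : Algebra.IsPushout k₀ F₀ K E := Algebra.IsPushout.symm inferInstance
  let e := Algebra.IsPushout.equiv k₀ F₀ K E
  refine ⟨e.symm.trans ((Algebra.TensorProduct.congr AlgEquiv.refl σ).trans e), fun c => ?_⟩
  simp [e, Algebra.IsPushout.equiv_symm_algebraMap_right, Algebra.IsPushout.equiv_tmul]

theorem exists_algEquiv_algebraMap_eq [IsAlgClosed K] [Algebra.IsAlgebraic k₀ K]
    (φ : E ≃ₐ[F₀] E) (c : K) : ∃ c' : K, φ (algebraMap K E c) = algebraMap K E c' := by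
  have h : IsIntegral k₀ (φ (algebraMap K E c)) := by
    have h1 := (((Algebra.IsIntegral.isIntegral (R := k₀) c).map
      (IsScalarTower.toAlgHom k₀ K E)).map (φ.restrictScalars k₀))
    exact h1
  have h2 : IsIntegral K (φ (algebraMap K E c)) := h.tower_top
  have h3 := minpoly.mem_range_of_degree_eq_one K _
    (IsAlgClosed.degree_eq_one_of_irreducible K (minpoly.irreducible h2))
  obtain ⟨c', hc'⟩ := h3
  exact ⟨c', hc'.symm⟩

theorem mem_of_linearCombination {V : Submodule K E} [Algebra.IsPushout k₀ K F₀ E]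
    [IsGalois k₀ K] (hV : ∀ φ : E ≃ₐ[F₀] E, ∀ x ∈ V, φ x ∈ V) {ι : Type*} {b : ι → F₀}
    (hb : LinearIndependent k₀ b)
    (hbV : ∀ y ∈ Submodule.span k₀ (Set.range b), algebraMap F₀ E y ∈ V → y = 0)
    (l : ι →₀ K) (hl : Finsupp.linearCombination K (fun i => algebraMap F₀ E (b i)) l ∈ V) :
    l = 0 := by
  classical
  induction hn : l.support.card using Nat.strong_induction_on generalizing l with
  | _ n ih =>
    by_contra hne
    obtain ⟨i₀, hi₀⟩ := Finsupp.ne_iff.mp hne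
    set l' : ι →₀ K := (l i₀)⁻¹ • l with hl'
    have hl'V : Finsupp.linearCombination K (fun i => algebraMap F₀ E (b i)) l' ∈ V := by
      rw [hl', map_smul]
      exact Submodule.smul_mem _ _ hl
    have h1 : l' i₀ = 1 := by
      simp only [hl', Finsupp.smul_apply, smul_eq_mul]
      exact inv_mul_cancel₀ hi₀
    have hfix : ∀ σ : K ≃ₐ[k₀] K, ∀ i, σ (l' i) = l' i := by
      intro σ
      obtain ⟨φ, hφ⟩ := exists_algEquiv_extending (F₀ := F₀) (E := E) σ
      let m : ι →₀ K := l'.mapRange σ (map_zero σ) - l'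
      have hm : Finsupp.linearCombination K (fun i => algebraMap F₀ E (b i)) m ∈ V := by
        have h2 : Finsupp.linearCombination K (fun i => algebraMap F₀ E (b i)) m =
            φ (Finsupp.linearCombination K (fun i => algebraMap F₀ E (b i)) l') -
            Finsupp.linearCombination K (fun i => algebraMap F₀ E (b i)) l' := by
          rw [map_sub]
          congr 1
          simp only [Finsupp.linearCombination_apply]
          rw [Finsupp.sum_mapRange_index (by simp), map_finsuppSum]
          refine Finsupp.sum_congr fun i _ => ?_
          simp [Algebra.smul_def, hφ]
        rw [h2]
        exact Submodule.sub_mem _ (hV φ _ hl'V) hl'V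
      have hsub : m.support ⊆ l.support.erase i₀ := by
        intro i hi
        rw [Finsupp.mem_support_iff] at hi
        rw [Finset.mem_erase, Finsupp.mem_support_iff]
        refine ⟨?_, ?_⟩
        · rintro rfl
          exact hi (by simp [m, h1])
        · intro h
          exact hi (by simp [m, hl', h])
      have hcard : m.support.card < n := by
        rw [← hn]
        exact (Finset.card_le_card hsub).trans_lt
          (Finset.card_erase_lt_of_mem (Finsupp.mem_support_iff.mpr hi₀))
      have hm0 := ih _ hcard m hm rfl
      intro i
      have := DFunLike.congr_fun hm0 i
      simpa [m, sub_eq_zero] using this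
    have hrange : ∀ i, ∃ c : k₀, algebraMap k₀ K c = l' i := fun i =>
      (InfiniteGalois.mem_range_algebraMap_iff_fixed (l' i)).mpr (fun σ => hfix σ i)
    choose c hc using hrange
    have hx : Finsupp.linearCombination K (fun i => algebraMap F₀ E (b i)) l' =
        algebraMap F₀ E (∑ i ∈ l'.support, c i • b i) := by
      rw [Finsupp.linearCombination_apply, Finsupp.sum, map_sum]
      refine Finset.sum_congr rfl fun i _ => ?_
      rw [← hc i, algebraMap_smul, Algebra.smul_def, Algebra.smul_def, map_mul,
        ← IsScalarTower.algebraMap_apply]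
    have h0 := hbV (∑ i ∈ l'.support, c i • b i)
      (Submodule.sum_mem _ fun i _ => Submodule.smul_mem _ _ (Submodule.subset_span ⟨i, rfl⟩))
      (hx ▸ hl'V)
    have h2 := linearIndependent_iff'.mp hb _ _ h0 i₀ (by
      rw [Finsupp.mem_support_iff, h1]; exact one_ne_zero)
    have h3 := hc i₀
    rw [h1, h2, map_zero] at h3
    exact zero_ne_one h3

theorem algebraMap_mem_span {S : Set F₀} {y : F₀} (hy : y ∈ Submodule.span k₀ S) :
    algebraMap F₀ E y ∈ Submodule.span K (algebraMap F₀ E '' S) := by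
  induction hy using Submodule.span_induction with
  | mem z hz => exact Submodule.subset_span ⟨z, hz, rfl⟩
  | zero => rw [map_zero]; exact Submodule.zero_mem _
  | add z₁ z₂ _ _ h₁ h₂ => rw [map_add]; exact Submodule.add_mem _ h₁ h₂
  | smul c z _ h =>
    have : algebraMap F₀ E (c • z) = algebraMap k₀ K c • algebraMap F₀ E z := by
      rw [Algebra.smul_def, Algebra.smul_def, map_mul, ← IsScalarTower.algebraMap_apply,
        ← IsScalarTower.algebraMap_apply]
    rw [this]
    exact Submodule.smul_mem _ _ h

/-- The `k₀`-subspace of `F₀` of elements whose image lies in `V`. -/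
def rational (V : Submodule K E) : Submodule k₀ F₀ :=
  (V.restrictScalars k₀).comap (IsScalarTower.toAlgHom k₀ F₀ E).toLinearMap

variable (k₀ F₀) in
theorem le_span_rational [Algebra.IsPushout k₀ K F₀ E] [IsGalois k₀ K] {V : Submodule K E}
    (hV : ∀ φ : E ≃ₐ[F₀] E, ∀ x ∈ V, φ x ∈ V) :
    V ≤ Submodule.span K (algebraMap F₀ E '' (rational (k₀ := k₀) V : Submodule k₀ F₀)) := by
  obtain ⟨C, hC⟩ := Submodule.exists_isCompl (rational (k₀ := k₀) (F₀ := F₀) V)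
  intro x hx
  let b := Module.Basis.ofVectorSpace k₀ C
  have hbC : Submodule.span k₀ (Set.range fun i => (b i : F₀)) = C := by
    have := congrArg (Submodule.map C.subtype) b.span_eq
    rwa [Submodule.map_span, Submodule.map_top, Submodule.range_subtype, ← Set.range_comp] at this
  have hsum : x ∈ Submodule.span K (algebraMap F₀ E '' (rational (k₀ := k₀) V : Submodule k₀ F₀)) ⊔
      Submodule.span K (Set.range fun i => algebraMap F₀ E (b i : F₀)) := by
    have htop := span_range_algebraMap (k₀ := k₀) (F₀ := F₀) (K := K) (E := E)
    have hx' : x ∈ Submodule.span K (Set.range (algebraMap F₀ E)) := htop ▸ Submodule.mem_top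
    refine Submodule.span_le.mpr ?_ hx'
    rintro _ ⟨y, rfl⟩
    obtain ⟨u, hu, w, hw, rfl⟩ := Submodule.mem_sup.mp
      (show y ∈ rational (k₀ := k₀) V ⊔ C from hC.sup_eq_top ▸ Submodule.mem_top)
    rw [map_add]
    refine Submodule.add_mem_sup (Submodule.subset_span ⟨u, hu, rfl⟩) ?_
    rw [← hbC] at hw
    rw [Set.range_comp' (algebraMap F₀ E)]
    exact algebraMap_mem_span hw
  obtain ⟨u, hu, w, hw, rfl⟩ := Submodule.mem_sup.mp hsum
  have huV : u ∈ V := by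
    refine Submodule.span_le.mpr ?_ hu
    rintro _ ⟨y, hy, rfl⟩
    exact hy
  have hwV : w ∈ V := by simpa using Submodule.sub_mem _ hx huV
  obtain ⟨l, rfl⟩ := (Finsupp.mem_span_range_iff_exists_finsupp.mp hw)
  have hbi : LinearIndependent k₀ fun i => (b i : F₀) :=
    b.linearIndependent.map' C.subtype (Submodule.ker_subtype C)
  have hl := mem_of_linearCombination (b := fun i => (b i : F₀)) hV hbi (fun y hy hyV => by
    rw [hbC] at hy
    have : y ∈ rational (k₀ := k₀) V ⊓ C := ⟨hyV, hy⟩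
    rw [hC.inf_eq_bot] at this
    exact (Submodule.mem_bot _).mp this) l hwV
  simpa [hl] using hu

end Descent

section DescentRank

variable {k₀ F₀ K E : Type*} [Field k₀] [Field F₀] [Field K] [Field E] [Algebra k₀ F₀]
  [Algebra k₀ K] [Algebra k₀ E] [Algebra F₀ E] [Algebra K E] [IsScalarTower k₀ F₀ E]
  [IsScalarTower k₀ K E]

theorem fg_rational [Algebra.IsPushout k₀ K F₀ E] {V : Submodule K E} (hV : V.FG) :
    (rational V : Submodule k₀ F₀).FG := by
  let W : Submodule k₀ F₀ := rational V
  let b := Module.Basis.ofVectorSpace k₀ W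
  have hb : LinearIndependent k₀ fun i => (b i : F₀) :=
    b.linearIndependent.map' W.subtype (Submodule.ker_subtype W)
  have hbE := linearIndependent_algebraMap_comp (K := K) (E := E) hb
  have hbV : LinearIndependent K (fun i => (⟨algebraMap F₀ E (b i), (b i).2⟩ : V)) :=
    LinearIndependent.of_comp V.subtype hbE
  have : Module.Finite K V := Module.Finite.iff_fg.mpr hV
  have := hbV.finite
  exact Module.Finite.iff_fg.mp (Module.Finite.of_basis b)

variable (k₀ F₀) in
theorem finrank_le_finrank_rational [Algebra.IsPushout k₀ K F₀ E] [IsGalois k₀ K]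
    {V : Submodule K E} (hV : V.FG) (hst : ∀ φ : E ≃ₐ[F₀] E, ∀ x ∈ V, φ x ∈ V) :
    Module.finrank K V ≤ Module.finrank k₀ (rational V : Submodule k₀ F₀) := by
  let W : Submodule k₀ F₀ := rational V
  have : Module.Finite k₀ W := Module.Finite.iff_fg.mpr (fg_rational hV)
  let b := Module.finBasis k₀ W
  have hbW : Submodule.span k₀ (Set.range fun i => (b i : F₀)) = W := by
    have := congrArg (Submodule.map W.subtype) b.span_eq
    rwa [Submodule.map_span, Submodule.map_top, Submodule.range_subtype, ← Set.range_comp] at this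
  have hle : V ≤ Submodule.span K (Set.range fun i => algebraMap F₀ E (b i)) := by
    refine (le_span_rational k₀ F₀ hst).trans ?_
    rw [Submodule.span_le]
    rintro _ ⟨y, hy, rfl⟩
    have hy' : y ∈ W := hy
    rw [← hbW] at hy'
    rw [Set.range_comp' (algebraMap F₀ E)]
    exact algebraMap_mem_span hy'
  refine (finrank_mono_of_fg (Submodule.fg_span (Set.finite_range _)) hle).trans
    ((finrank_range_le_card _).trans ?_)
  rw [Fintype.card_fin]

theorem finrank_le_finrank_of_map_le [Algebra.IsPushout k₀ K F₀ E] {W : Submodule k₀ F₀}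
    (hW : W.FG) {V : Submodule K E} (hV : V.FG) (h : ∀ x ∈ W, algebraMap F₀ E x ∈ V) :
    Module.finrank k₀ W ≤ Module.finrank K V := by
  have : Module.Finite k₀ W := Module.Finite.iff_fg.mpr hW
  let b := Module.finBasis k₀ W
  have hb : LinearIndependent k₀ fun i => (b i : F₀) :=
    b.linearIndependent.map' W.subtype (Submodule.ker_subtype W)
  have := card_le_finrank_of_mem hV (linearIndependent_algebraMap_comp (K := K) (E := E) hb)
    fun i => h _ (b i).2
  rwa [Fintype.card_fin] at this

variable (k₀ F₀) in
/-- The subfield of `F₀` of elements whose image lies in `M`. -/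
def rationalField (M : IntermediateField K E) : IntermediateField k₀ F₀ :=
  (M.restrictScalars k₀).comap (IsScalarTower.toAlgHom k₀ F₀ E)

theorem HasSlope.rational [Algebra.IsPushout k₀ K F₀ E] {M : IntermediateField K E}
    {V : Submodule K E} {A : ℕ} (hV : V.FG) (h : HasSlope M V A) :
    HasSlope (rationalField k₀ F₀ M) (rational V) A := by
  intro U hU hUM
  let U' : Submodule K E := Submodule.span K (algebraMap F₀ E '' U)
  have hU' : U'.FG := by
    obtain ⟨s, rfl⟩ := id hU
    refine fg_of_le (Submodule.fg_span ((s : Set F₀).toFinite.image (algebraMap F₀ E))) ?_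
    refine Submodule.span_le.mpr ?_
    rintro _ ⟨y, hy, rfl⟩
    exact algebraMap_mem_span hy
  obtain ⟨C, hC⟩ := h U' hU' (by
    have : U' ≤ M.toSubmodule := by
      refine Submodule.span_le.mpr ?_
      rintro _ ⟨y, hy, rfl⟩
      exact hUM y hy
    exact fun x hx => this hx)
  refine ⟨C, fun n => le_trans ?_ (hC n)⟩
  refine finrank_le_finrank_of_map_le (hU.mul ((fg_rational hV).pow n)) (hU'.mul (hV.pow n)) ?_
  have hpow : ∀ n, ∀ x ∈ (GonalityAux.rational V : Submodule k₀ F₀) ^ n,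
      algebraMap F₀ E x ∈ V ^ n := by
    intro n
    induction n with
    | zero =>
      intro x hx
      rw [pow_zero, Submodule.mem_one] at hx ⊢
      obtain ⟨c, rfl⟩ := hx
      exact ⟨algebraMap k₀ K c, by
        rw [← IsScalarTower.algebraMap_apply, ← IsScalarTower.algebraMap_apply]⟩
    | succ n ih =>
      intro x hx
      rw [pow_succ] at hx ⊢
      induction hx using Submodule.mul_induction_on' with
      | mem_mul_mem a ha b hb =>
        rw [map_mul]; exact Submodule.mul_mem_mul (ih a ha) hb
      | add a _ b _ ha hb => rw [map_add]; exact Submodule.add_mem _ ha hb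
  intro x hx
  induction hx using Submodule.mul_induction_on' with
  | mem_mul_mem a ha b hb =>
    rw [map_mul]
    exact Submodule.mul_mem_mul (Submodule.subset_span ⟨a, ha, rfl⟩) (hpow n b hb)
  | add a _ b _ ha hb => rw [map_add]; exact Submodule.add_mem _ ha hb

theorem finrank_rationalField_le [Algebra.IsPushout k₀ K F₀ E] [IsGalois k₀ K]
    {M : IntermediateField K E} [FiniteDimensional M E]
    (hst : ∀ φ : E ≃ₐ[F₀] E, ∀ x ∈ M, φ x ∈ M) :
    Module.finrank (rationalField k₀ F₀ M) F₀ ≤ Module.finrank M E := by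
  classical
  set N := rationalField k₀ F₀ M with hN
  by_cases hfin : Module.Finite N F₀
  swap
  · rw [Module.finrank_of_not_finite hfin]; exact Nat.zero_le _
  have hsymm : Algebra.IsPushout k₀ F₀ K E := Algebra.IsPushout.symm inferInstance
  have hbc : IsBaseChange F₀ (IsScalarTower.toAlgHom k₀ K E).toLinearMap := hsymm.out
  let κ := Module.Basis.ofVectorSpace k₀ K
  let B := hbc.basis κ
  have hcoord : ∀ g ∈ M, ∀ j, B.repr g j ∈ N := by
    intro g hg j
    have h1 := le_span_rational k₀ F₀ (V := M.toSubmodule) hst hg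
    obtain ⟨n, c, y, rfl⟩ := Submodule.mem_span_set'.mp h1
    rw [map_sum, Finsupp.finsetSum_apply]
    refine sum_mem fun i _ => ?_
    obtain ⟨_, m, hm, hmy⟩ := y i
    have h2 : c i • algebraMap F₀ E m =
        m • (IsScalarTower.toAlgHom k₀ K E).toLinearMap (c i) := by
      rw [Algebra.smul_def, Algebra.smul_def, mul_comm]
      rfl
    show (B.repr (c i • (_ : E))) j ∈ N
    subst hmy
    rw [h2, map_smul, Finsupp.smul_apply, IsBaseChange.basis_repr_comp_apply]
    exact mul_mem hm (N.algebraMap_mem _)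
  let b := Module.finBasis N F₀
  have hb : LinearIndependent M fun i => algebraMap F₀ E (b i) := by
    rw [Fintype.linearIndependent_iff]
    intro g hg i
    have h1 : ∀ j, ∑ i, (⟨B.repr (g i) j, hcoord _ (g i).2 j⟩ : N) • b i = 0 := by
      intro j
      have h2 := congrArg (fun x => B.repr x j) hg
      simp only [map_sum, Finsupp.finsetSum_apply, map_zero, Finsupp.zero_apply] at h2
      rw [← h2]
      refine Finset.sum_congr rfl fun i _ => ?_
      have h3 : g i • algebraMap F₀ E (b i) = b i • (g i : E) := by
        rw [Algebra.smul_def, Algebra.smul_def, mul_comm]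
        rfl
      rw [h3, map_smul, Finsupp.smul_apply, smul_eq_mul, mul_comm]
      rfl
    have h4 : B.repr (g i) = 0 := by
      ext j
      exact congrArg Subtype.val (Fintype.linearIndependent_iff.mp b.linearIndependent _ (h1 j) i)
    have h5 : (g i : E) = 0 := by simpa using h4
    exact Subtype.ext h5
  have := hb.fintype_card_le_finrank
  rwa [Fintype.card_fin] at this

end DescentRank

section Extension

variable {k₀ F₀ K E Γ₀ Γ : Type*} [Field k₀] [Field F₀] [Field K] [Field E] [Algebra k₀ F₀]
  [Algebra k₀ K] [Algebra k₀ E] [Algebra F₀ E] [Algebra K E] [IsScalarTower k₀ F₀ E]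
  [IsScalarTower k₀ K E] [LinearOrderedCommGroupWithZero Γ₀] [LinearOrderedCommGroupWithZero Γ]

theorem exists_valuationSubring_dominating (O : ValuationSubring F₀) :
    ∃ A : ValuationSubring E, (∀ x, O.valuation x ≤ 1 → A.valuation (algebraMap F₀ E x) ≤ 1) ∧
      ∀ x, O.valuation x < 1 → A.valuation (algebraMap F₀ E x) < 1 := by
  obtain ⟨A, hA, hloc⟩ := IsLocalRing.exists_factor_valuationRing
    ((algebraMap F₀ E).comp O.subtype)
  have h1 : ∀ x, O.valuation x ≤ 1 → A.valuation (algebraMap F₀ E x) ≤ 1 := fun x hx =>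
    (A.valuation_le_one_iff _).mpr (hA ⟨x, (O.valuation_le_one_iff x).mp hx⟩)
  refine ⟨A, h1, fun x hx => lt_of_le_of_ne (h1 x hx.le) fun heq => ?_⟩
  let x' : O := ⟨x, (O.valuation_le_one_iff x).mp hx.le⟩
  have hu : IsUnit (((algebraMap F₀ E).comp O.subtype).codRestrict A.toSubring hA x') :=
    (A.valuation_eq_one_iff ⟨algebraMap F₀ E x, hA x'⟩).mpr heq
  have h2 := hloc.map_nonunit _ hu
  exact hx.ne ((O.valuation_eq_one_iff x').mp h2)

theorem valuation_algebraMap_le_one [Algebra.IsAlgebraic k₀ K] {v : Valuation E Γ}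
    (hv : ∀ c : k₀, v (algebraMap k₀ E c) ≤ 1) (c : K) : v (algebraMap K E c) ≤ 1 := by
  by_contra! h
  have h0 : algebraMap K E c ≠ 0 := by
    intro h0
    rw [h0, map_zero] at h
    exact not_lt_zero h
  have h1 : v (algebraMap K E c)⁻¹ < 1 := by
    rw [map_inv₀]
    exact inv_lt_one_of_one_lt₀ h
  refine transcendental_of_valuation_lt_one v hv (inv_ne_zero h0) h1 ?_
  have := (Algebra.IsAlgebraic.isAlgebraic (R := k₀) c).algebraMap (A := E)
  exact this.inv

theorem valuation_algebraMap_eq_one {v : Valuation E Γ}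
    (hv : ∀ c : K, v (algebraMap K E c) ≤ 1) {c : K} (hc : c ≠ 0) : v (algebraMap K E c) = 1 := by
  refine le_antisymm (hv c) ?_
  have h := hv c⁻¹
  have hpos : 0 < v (algebraMap K E c) := zero_lt_iff.mpr
    ((Valuation.ne_zero_iff v).mpr ((_root_.map_ne_zero _).mpr hc))
  rw [map_inv₀, map_inv₀] at h
  exact (inv_le_one₀ hpos).mp h

theorem valuation_algebraMap_lt {v₀ : Valuation F₀ Γ₀} {v : Valuation E Γ}
    (hlt : ∀ x, v₀ x < 1 → v (algebraMap F₀ E x) < 1) {x y : F₀} (h : v₀ x < v₀ y) :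
    v (algebraMap F₀ E x) < v (algebraMap F₀ E y) := by
  have hy : y ≠ 0 := by
    rintro rfl
    rw [map_zero] at h
    exact not_lt_zero h
  have hpos₀ : 0 < v₀ y := zero_lt_iff.mpr ((Valuation.ne_zero_iff v₀).mpr hy)
  have hpos : 0 < v (algebraMap F₀ E y) := zero_lt_iff.mpr
    ((Valuation.ne_zero_iff v).mpr ((_root_.map_ne_zero _).mpr hy))
  have h1 := hlt (x / y) (by rw [map_div₀]; exact (div_lt_one₀ hpos₀).mpr h)
  rw [map_div₀, map_div₀] at h1
  exact (div_lt_one₀ hpos).mp h1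

theorem valuation_lt_of_mem_span {v : Valuation E Γ}
    (hv : ∀ c : K, v (algebraMap K E c) ≤ 1) {S : Set E} {γ : Γ} (hγ : 0 < γ)
    (hS : ∀ x ∈ S, v x < γ) : ∀ x ∈ Submodule.span K S, v x < γ := by
  intro x hx
  induction hx using Submodule.span_induction with
  | mem z hz => exact hS z hz
  | zero => simpa using hγ
  | add a b _ _ ha hb => exact v.map_add_lt ha hb
  | smul c a _ ha =>
    rw [Algebra.smul_def, map_mul]
    exact (mul_le_of_le_one_left' (hv c)).trans_lt ha

theorem algEquiv_mem_span [IsAlgClosed K] [Algebra.IsAlgebraic k₀ K] (φ : E ≃ₐ[F₀] E)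
    {S : Set F₀} {x : E} (hx : x ∈ Submodule.span K (algebraMap F₀ E '' S)) :
    φ x ∈ Submodule.span K (algebraMap F₀ E '' S) := by
  induction hx using Submodule.span_induction with
  | mem z hz =>
    obtain ⟨y, hy, rfl⟩ := hz
    rw [φ.commutes]
    exact Submodule.subset_span ⟨y, hy, rfl⟩
  | zero => rw [map_zero]; exact Submodule.zero_mem _
  | add a b _ _ ha hb => rw [map_add]; exact Submodule.add_mem _ ha hb
  | smul c a _ ha =>
    obtain ⟨c', hc'⟩ := exists_algEquiv_algebraMap_eq (k₀ := k₀) φ c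
    rw [Algebra.smul_def, map_mul, hc', ← Algebra.smul_def]
    exact Submodule.smul_mem _ _ ha

theorem exists_leading_term [IsAlgClosed K] [Algebra.IsAlgebraic k₀ K]
    {v₀ : Valuation F₀ Γ₀} {v : Valuation E Γ}
    (hv₀ : ∀ c : k₀, v₀ (algebraMap k₀ F₀ c) ≤ 1)
    (hres : ∀ x : F₀, v₀ x ≤ 1 → ∃ c : k₀, v₀ (x - algebraMap k₀ F₀ c) < 1)
    (hv : ∀ c : K, v (algebraMap K E c) ≤ 1)
    (hlt : ∀ x, v₀ x < 1 → v (algebraMap F₀ E x) < 1) (n : ℕ) :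
    ∀ {Y : Submodule k₀ F₀}, Y.FG → Module.finrank k₀ Y = n → ∀ {x : E}, x ≠ 0 →
      x ∈ Submodule.span K (algebraMap F₀ E '' (Y : Set F₀)) →
      ∃ κ : K, κ ≠ 0 ∧ ∃ y : F₀, y ≠ 0 ∧ ∀ φ : E ≃ₐ[F₀] E,
        v (φ x - φ (algebraMap K E κ) * algebraMap F₀ E y) < v (algebraMap F₀ E y) := by
  induction n with
  | zero =>
    intro Y hY hn x hx0 hx
    have : Module.Finite k₀ Y := Module.Finite.iff_fg.mpr hY
    rw [Submodule.finrank_eq_zero] at hn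
    subst hn
    simp [hx0] at hx
  | succ n ih =>
    intro Y hY hn x hx0 hx
    obtain ⟨y, hyY, hy0, Y', hle, hdim, hltY, hsup⟩ := exists_drop v₀ hv₀ hres hY (by omega)
    obtain ⟨κ, x', hx', rfl⟩ : ∃ κ : K, ∃ x' ∈ Submodule.span K (algebraMap F₀ E '' (Y' : Set F₀)),
        x = κ • algebraMap F₀ E y + x' := by
      have h1 : (algebraMap F₀ E '' (Y : Set F₀)) ⊆
          (Submodule.span K {algebraMap F₀ E y} ⊔
            Submodule.span K (algebraMap F₀ E '' (Y' : Set F₀)) : Submodule K E) := by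
        rintro _ ⟨z, hz, rfl⟩
        rw [hsup] at hz
        have hz' : z ∈ Submodule.span k₀ ((Y' : Set F₀) ∪ {y}) := by
          rwa [Submodule.span_union, Submodule.span_eq]
        have := algebraMap_mem_span (K := K) (E := E) hz'
        rwa [Set.image_union, Submodule.span_union, Set.image_singleton, sup_comm] at this
      obtain ⟨a, ha, x', hx', rfl⟩ := Submodule.mem_sup.mp (Submodule.span_le.mpr h1 hx)
      obtain ⟨κ, rfl⟩ := Submodule.mem_span_singleton.mp ha
      exact ⟨κ, x', hx', rfl⟩
    by_cases hκ : κ = 0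
    · subst hκ
      rw [zero_smul, zero_add] at hx0 ⊢
      exact ih (fg_of_le hY hle) (by omega) hx0 hx'
    · refine ⟨κ, hκ, y, hy0, fun φ => ?_⟩
      rw [map_add, Algebra.smul_def, map_mul, φ.commutes, add_sub_cancel_left]
      refine valuation_lt_of_mem_span hv (zero_lt_iff.mpr ((Valuation.ne_zero_iff v).mpr
        ((_root_.map_ne_zero _).mpr hy0))) ?_ _ (algEquiv_mem_span (k₀ := k₀) φ hx')
      rintro _ ⟨z, hz, rfl⟩
      exact valuation_algebraMap_lt hlt (hltY z hz)

theorem exists_leading_term_of_isPushout [Algebra.IsPushout k₀ K F₀ E] [IsAlgClosed K]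
    [Algebra.IsAlgebraic k₀ K] {v₀ : Valuation F₀ Γ₀} {v : Valuation E Γ}
    (hv₀ : ∀ c : k₀, v₀ (algebraMap k₀ F₀ c) ≤ 1)
    (hres : ∀ x : F₀, v₀ x ≤ 1 → ∃ c : k₀, v₀ (x - algebraMap k₀ F₀ c) < 1)
    (hv : ∀ c : K, v (algebraMap K E c) ≤ 1)
    (hlt : ∀ x, v₀ x < 1 → v (algebraMap F₀ E x) < 1) {x : E} (hx : x ≠ 0) :
    ∃ κ : K, κ ≠ 0 ∧ ∃ y : F₀, y ≠ 0 ∧ ∀ φ : E ≃ₐ[F₀] E,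
      v (φ x - φ (algebraMap K E κ) * algebraMap F₀ E y) < v (algebraMap F₀ E y) := by
  have hx' : x ∈ Submodule.span K (Set.range (algebraMap F₀ E)) := by
    rw [span_range_algebraMap (k₀ := k₀)]
    exact Submodule.mem_top
  obtain ⟨n, c, y, rfl⟩ := Submodule.mem_span_set'.mp hx'
  choose z hz using fun i => (y i).2
  refine exists_leading_term hv₀ hres hv hlt _ (Y := Submodule.span k₀ (Set.range z))
    (Submodule.fg_span (Set.finite_range z)) rfl hx ?_
  refine Submodule.sum_mem _ fun i _ => Submodule.smul_mem _ _ (Submodule.subset_span ?_)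
  exact ⟨z i, Submodule.subset_span ⟨i, rfl⟩, hz i⟩

theorem valuation_algEquiv [Algebra.IsPushout k₀ K F₀ E] [IsAlgClosed K]
    [Algebra.IsAlgebraic k₀ K] {v₀ : Valuation F₀ Γ₀} {v : Valuation E Γ}
    (hv₀ : ∀ c : k₀, v₀ (algebraMap k₀ F₀ c) ≤ 1)
    (hres : ∀ x : F₀, v₀ x ≤ 1 → ∃ c : k₀, v₀ (x - algebraMap k₀ F₀ c) < 1)
    (hv : ∀ c : K, v (algebraMap K E c) ≤ 1)
    (hlt : ∀ x, v₀ x < 1 → v (algebraMap F₀ E x) < 1) (φ : E ≃ₐ[F₀] E) (x : E) :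
    v (φ x) = v x := by
  by_cases hx : x = 0
  · simp [hx]
  obtain ⟨κ, hκ, y, hy, h⟩ := exists_leading_term_of_isPushout hv₀ hres hv hlt hx
  have key : ∀ ψ : E ≃ₐ[F₀] E, v (ψ x) = v (algebraMap F₀ E y) := by
    intro ψ
    obtain ⟨c, hc⟩ := exists_algEquiv_algebraMap_eq (k₀ := k₀) ψ κ
    have hc0 : c ≠ 0 := by
      rintro rfl
      rw [map_zero] at hc
      exact hκ (by simpa using hc)
    have h1 := h ψ
    have h2 : v (ψ (algebraMap K E κ) * algebraMap F₀ E y) = v (algebraMap F₀ E y) := by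
      rw [hc, map_mul, valuation_algebraMap_eq_one hv hc0, one_mul]
    rw [← sub_add_cancel (ψ x) (ψ (algebraMap K E κ) * algebraMap F₀ E y),
      v.map_add_eq_of_lt_right (by rwa [h2]), h2]
  exact (key φ).trans (key AlgEquiv.refl).symm

theorem exists_valuation_sub_lt_one [Algebra.IsPushout k₀ K F₀ E] [IsAlgClosed K]
    [Algebra.IsAlgebraic k₀ K] {v₀ : Valuation F₀ Γ₀} {v : Valuation E Γ}
    (hv₀ : ∀ c : k₀, v₀ (algebraMap k₀ F₀ c) ≤ 1)
    (hres : ∀ x : F₀, v₀ x ≤ 1 → ∃ c : k₀, v₀ (x - algebraMap k₀ F₀ c) < 1)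
    (hv : ∀ c : K, v (algebraMap K E c) ≤ 1)
    (hlt : ∀ x, v₀ x < 1 → v (algebraMap F₀ E x) < 1) {x : E} (hx : v x ≤ 1) :
    ∃ c : K, v (x - algebraMap K E c) < 1 := by
  rcases hx.lt_or_eq with hx | hx
  · exact ⟨0, by simpa using hx⟩
  have hx0 : x ≠ 0 := by
    rintro rfl
    simp at hx
  obtain ⟨κ, hκ, y, hy, h⟩ := exists_leading_term_of_isPushout hv₀ hres hv hlt hx0
  have h1 := h AlgEquiv.refl
  simp only [AlgEquiv.coe_refl, id] at h1
  have h2 : v (algebraMap K E κ * algebraMap F₀ E y) = v (algebraMap F₀ E y) := by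
    rw [map_mul, valuation_algebraMap_eq_one hv hκ, one_mul]
  have hy1 : v (algebraMap F₀ E y) = 1 := by
    rw [← hx, ← sub_add_cancel x (algebraMap K E κ * algebraMap F₀ E y),
      v.map_add_eq_of_lt_right (by rwa [h2]), h2]
  have hy₀ : v₀ y ≤ 1 := by
    by_contra! hgt
    have h3 := valuation_algebraMap_lt hlt (x := 1) (y := y) (by rwa [map_one])
    rw [map_one, map_one, hy1] at h3
    exact lt_irrefl _ h3
  obtain ⟨c, hc⟩ := hres y hy₀
  have hc' := hlt _ hc
  refine ⟨κ * algebraMap k₀ K c, ?_⟩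
  have h4 : x - algebraMap K E (κ * algebraMap k₀ K c) =
      (x - algebraMap K E κ * algebraMap F₀ E y) +
        algebraMap K E κ * algebraMap F₀ E (y - algebraMap k₀ F₀ c) := by
    rw [map_mul, map_sub, ← IsScalarTower.algebraMap_apply k₀ K E,
      ← IsScalarTower.algebraMap_apply k₀ F₀ E]
    ring
  rw [h4]
  refine v.map_add_lt (hy1 ▸ h1) ?_
  rw [map_mul, valuation_algebraMap_eq_one hv hκ, one_mul]
  exact hc'

end Extension

section Semilinear

variable {K E : Type*} [Field K] [Field E] [Algebra K E]

theorem map_mem_adjoin {K' E' : Type*} [Field K'] [Field E'] [Algebra K' E'] {φ : E →+* E'}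
    (hφ : ∀ c : K, ∃ c' : K', φ (algebraMap K E c) = algebraMap K' E' c')
    {s : Set E} {t : Set E'} (hst : ∀ x ∈ s, φ x ∈ adjoin K' t) :
    ∀ x ∈ adjoin K s, φ x ∈ adjoin K' t := by
  intro x hx
  induction hx using adjoin_induction with
  | mem x hx => exact hst x hx
  | algebraMap c =>
    obtain ⟨c', hc⟩ := hφ c
    rw [hc]
    exact IntermediateField.algebraMap_mem _ _
  | add x y _ _ hx hy => rw [map_add]; exact add_mem hx hy
  | inv x _ hx => rw [map_inv₀]; exact inv_mem hx
  | mul x y _ _ hx hy => rw [map_mul]; exact mul_mem hx hy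

theorem map_mem_pencil {φ : E →+* E}
    (hφ : ∀ c : K, ∃ c' : K, φ (algebraMap K E c) = algebraMap K E c')
    {x z : E} (hx : x ∈ pencil K z) : φ x ∈ pencil K (φ z) := by
  obtain ⟨a, b, rfl⟩ := mem_pencil.mp hx
  obtain ⟨a', ha⟩ := hφ a
  obtain ⟨b', hb⟩ := hφ b
  exact mem_pencil.mpr ⟨a', b', by rw [map_add, map_mul, ha, hb]⟩

theorem map_mem_mul {φ : E →+* E} {P Q P' Q' : Submodule K E} (hP : ∀ x ∈ P, φ x ∈ P')
    (hQ : ∀ x ∈ Q, φ x ∈ Q') {x : E} (hx : x ∈ P * Q) : φ x ∈ P' * Q' := by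
  induction hx using Submodule.mul_induction_on' with
  | mem_mul_mem a ha b hb =>
    rw [map_mul]
    exact Submodule.mul_mem_mul (hP a ha) (hQ b hb)
  | add a _ b _ ha hb => rw [map_add]; exact Submodule.add_mem _ ha hb

theorem map_mem_one {φ : E →+* E}
    (hφ : ∀ c : K, ∃ c' : K, φ (algebraMap K E c) = algebraMap K E c')
    {x : E} (hx : x ∈ (1 : Submodule K E)) : φ x ∈ (1 : Submodule K E) := by
  obtain ⟨c, rfl⟩ := Submodule.mem_one.mp hx
  obtain ⟨c', hc⟩ := hφ c
  exact Submodule.mem_one.mpr ⟨c', hc.symm⟩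

theorem map_mem_pow {φ : E →+* E}
    (hφ : ∀ c : K, ∃ c' : K, φ (algebraMap K E c) = algebraMap K E c')
    {P P' : Submodule K E} (hP : ∀ x ∈ P, φ x ∈ P') (n : ℕ) : ∀ x ∈ P ^ n, φ x ∈ P' ^ n := by
  induction n with
  | zero =>
    intro x hx
    rw [pow_zero] at hx ⊢
    exact map_mem_one hφ hx
  | succ n ih =>
    intro x hx
    rw [pow_succ] at hx ⊢
    exact map_mem_mul ih hP hx

theorem map_mem_prod {φ : E →+* E}
    (hφ : ∀ c : K, ∃ c' : K, φ (algebraMap K E c) = algebraMap K E c')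
    {ι : Type*} (s : Finset ι) (P P' : ι → Submodule K E) (hP : ∀ i ∈ s, ∀ x ∈ P i, φ x ∈ P' i) :
    ∀ x ∈ ∏ i ∈ s, P i, φ x ∈ ∏ i ∈ s, P' i := by
  classical
  induction s using Finset.induction_on with
  | empty =>
    intro x hx
    rw [Finset.prod_empty] at hx ⊢
    exact map_mem_one hφ hx
  | insert a s ha ih =>
    intro x hx
    rw [Finset.prod_insert ha] at hx ⊢
    exact map_mem_mul (hP a (Finset.mem_insert_self a s))
      (ih fun i hi => hP i (Finset.mem_insert_of_mem hi)) hx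

theorem exists_ringEquiv_adjoin {φ : E ≃+* E}
    (hφ : ∀ c : K, ∃ c' : K, φ (algebraMap K E c) = algebraMap K E c')
    (hφ' : ∀ c : K, ∃ c' : K, φ.symm (algebraMap K E c) = algebraMap K E c') (f : E) :
    ∃ e : K⟮f⟯ ≃+* K⟮φ f⟯, ∀ x, (e x : E) = φ x := by
  have h1 : ∀ x ∈ K⟮f⟯, φ x ∈ K⟮φ f⟯ := map_mem_adjoin (φ := (φ : E →+* E)) hφ
    (by rintro _ rfl; exact mem_adjoin_simple_self K _)
  have h2 : ∀ x ∈ K⟮φ f⟯, φ.symm x ∈ K⟮f⟯ := map_mem_adjoin (φ := (φ.symm : E →+* E)) hφ'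
    (by
      rintro _ rfl
      have h := mem_adjoin_simple_self K f
      simpa using h)
  exact ⟨{ toFun x := ⟨φ x, h1 x x.2⟩
           invFun x := ⟨φ.symm x, h2 x x.2⟩
           left_inv x := Subtype.ext (φ.symm_apply_apply x)
           right_inv x := Subtype.ext (φ.apply_symm_apply x)
           map_mul' x y := Subtype.ext (map_mul φ _ _)
           map_add' x y := Subtype.ext (map_add φ _ _) }, fun _ => rfl⟩

theorem finrank_adjoin_map {φ : E ≃+* E}
    (hφ : ∀ c : K, ∃ c' : K, φ (algebraMap K E c) = algebraMap K E c')
    (hφ' : ∀ c : K, ∃ c' : K, φ.symm (algebraMap K E c) = algebraMap K E c') (f : E) :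
    Module.finrank K⟮φ f⟯ E = Module.finrank K⟮f⟯ E := by
  obtain ⟨e, he⟩ := exists_ringEquiv_adjoin hφ hφ' f
  exact (Algebra.finrank_eq_of_equiv_equiv e φ (by ext x; exact he x)).symm

theorem pencil_eq_of_pencil_map_eq {φ : E ≃+* E}
    (hφ' : ∀ c : K, ∃ c' : K, φ.symm (algebraMap K E c) = algebraMap K E c') {x y : E}
    (h : pencil K (φ x) = pencil K (φ y)) :
    pencil K x = pencil K y := by
  have key : ∀ x y : E, pencil K (φ x) = pencil K (φ y) → pencil K x ≤ pencil K y := by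
    intro x y h
    refine pencil_le (one_mem_pencil y) ?_
    have h1 : φ x ∈ pencil K (φ y) := h ▸ self_mem_pencil _
    have h2 := map_mem_pencil (φ := (φ.symm : E →+* E)) hφ' h1
    simpa using h2
  exact le_antisymm (key x y h) (key y x h.symm)

end Semilinear

section Normalize

variable {K E Γ : Type*} [Field K] [Field E] [Algebra K E] [LinearOrderedCommGroupWithZero Γ]

theorem exists_adjoin_eq_one_lt_valuation {v : Valuation E Γ}
    (hres : ∀ x, v x ≤ 1 → ∃ c : K, v (x - algebraMap K E c) < 1) {f : E}
    (hf : Transcendental K f) : ∃ g, K⟮g⟯ = K⟮f⟯ ∧ Transcendental K g ∧ 1 < v g := by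
  by_cases h : 1 < v f
  · exact ⟨f, rfl, hf, h⟩
  obtain ⟨c, hc⟩ := hres f (not_lt.mp h)
  have htr : Transcendental K (f - algebraMap K E c) := fun hal => hf <| by
    simpa using hal.add (isAlgebraic_algebraMap (A := E) c)
  have h0 : f - algebraMap K E c ≠ 0 := fun h0 => htr (h0 ▸ isAlgebraic_zero)
  refine ⟨(f - algebraMap K E c)⁻¹, le_antisymm ?_ ?_, fun hal => htr (by simpa using hal.inv), ?_⟩
  · rw [adjoin_simple_le_iff]
    exact inv_mem (sub_mem (mem_adjoin_simple_self K f) (IntermediateField.algebraMap_mem _ _))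
  · rw [adjoin_simple_le_iff]
    have := add_mem (inv_mem (mem_adjoin_simple_self K (f - algebraMap K E c)⁻¹))
      (IntermediateField.algebraMap_mem K⟮(f - algebraMap K E c)⁻¹⟯ c)
    simpa using this
  · rw [map_inv₀]
    exact (one_lt_inv₀ (zero_lt_iff.mpr ((Valuation.ne_zero_iff v).mpr h0))).mpr hc

end Normalize

section Orbit

variable {k₀ F₀ K E Γ₀ Γ : Type*} [Field k₀] [Field F₀] [Field K] [Field E] [Algebra k₀ F₀]
  [Algebra k₀ K] [Algebra k₀ E] [Algebra F₀ E] [Algebra K E] [IsScalarTower k₀ F₀ E]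
  [IsScalarTower k₀ K E] [LinearOrderedCommGroupWithZero Γ₀] [LinearOrderedCommGroupWithZero Γ]

variable (k₀ F₀ K) in
theorem isIntegral_of_isPushout [Algebra.IsPushout k₀ K F₀ E] [Algebra.IsAlgebraic k₀ K] (x : E) :
    IsIntegral F₀ x := by
  have hx : x ∈ Submodule.span K (Set.range (algebraMap F₀ E)) := by
    rw [span_range_algebraMap (k₀ := k₀)]
    exact Submodule.mem_top
  induction hx using Submodule.span_induction with
  | mem x hx =>
    obtain ⟨y, rfl⟩ := hx
    exact isIntegral_algebraMap
  | zero => exact isIntegral_zero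
  | add x y _ _ hx hy => exact hx.add hy
  | smul c x _ hx =>
    rw [Algebra.smul_def]
    refine IsIntegral.mul ?_ hx
    exact ((Algebra.IsIntegral.isIntegral (R := k₀) c).map
      (IsScalarTower.toAlgHom k₀ K E)).tower_top

theorem finite_orbit [Algebra.IsPushout k₀ K F₀ E] [Algebra.IsAlgebraic k₀ K] (f : E) :
    {x | ∃ φ : E ≃ₐ[F₀] E, φ f = x}.Finite := by
  have h_integral := isIntegral_of_isPushout k₀ F₀ K f
  refine ((minpoly F₀ f).rootSet_finite E).subset ?_
  rintro _ ⟨φ, rfl⟩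
  rw [Polynomial.mem_rootSet]
  exact ⟨minpoly.ne_zero h_integral, by rw [Polynomial.aeval_algHom_apply, minpoly.aeval, map_zero]⟩

theorem transcendental_algEquiv [Algebra.IsAlgebraic k₀ K] (φ : E ≃ₐ[F₀] E) {f : E}
    (hf : Transcendental K f) : Transcendental K (φ f) := by
  intro h
  have h1 : IsAlgebraic k₀ (φ f) := h.restrictScalars k₀
  have h2 := h1.algHom ((φ.symm.restrictScalars k₀ : E ≃ₐ[k₀] E) : E →ₐ[k₀] E)
  have h3 : IsAlgebraic k₀ f := by simpa using h2
  exact hf (h3.tower_top K)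

end Orbit

section Assembly

variable {k₀ F₀ K E : Type*} [Field k₀] [Field F₀] [Field K] [Field E] [Algebra k₀ F₀]
  [Algebra k₀ K] [Algebra k₀ E] [Algebra F₀ E] [Algebra K E] [IsScalarTower k₀ F₀ E]
  [IsScalarTower k₀ K E]

/-- A finite set of representatives, one for each pencil, of the Galois orbit of `f`. -/
theorem exists_orbit_representatives [Algebra.IsPushout k₀ K F₀ E] [Algebra.IsAlgebraic k₀ K]
    (f : E) : ∃ s : Finset E, s.Nonempty ∧ (∀ g ∈ s, ∃ φ : E ≃ₐ[F₀] E, φ f = g) ∧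
      (∀ g ∈ s, ∀ g' ∈ s, pencil K g = pencil K g' → g = g') ∧
      ∀ φ : E ≃ₐ[F₀] E, ∃ g ∈ s, pencil K g = pencil K (φ f) := by
  classical
  have hfin := finite_orbit (k₀ := k₀) (F₀ := F₀) (K := K) f
  set O := {x | ∃ φ : E ≃ₐ[F₀] E, φ f = x} with hO
  obtain ⟨s, hs, hinj, himg⟩ := Finset.exists_subset_injOn_image_eq_of_surjOn O
    (hfin.toFinset.image (pencil K)) (by
      intro P hP
      simpa using hP)
  have hcov : ∀ φ : E ≃ₐ[F₀] E, ∃ g ∈ s, pencil K g = pencil K (φ f) := by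
    intro φ
    have h1 : pencil K (φ f) ∈ hfin.toFinset.image (pencil K) :=
      Finset.mem_image_of_mem _ (hfin.mem_toFinset.mpr ⟨φ, rfl⟩)
    rw [← himg] at h1
    exact Finset.mem_image.mp h1
  obtain ⟨g, hg, -⟩ := hcov AlgEquiv.refl
  exact ⟨s, ⟨g, hg⟩, fun g hg => hs hg, fun g hg g' hg' h => hinj hg hg' h, hcov⟩

/-- The product of the pencils of a complete set of representatives is Galois stable. -/
theorem prod_pencil_stable {φ : E ≃+* E} {s : Finset E}
    (hφ : ∀ c : K, ∃ c' : K, φ (algebraMap K E c) = algebraMap K E c')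
    (hφ' : ∀ c : K, ∃ c' : K, φ.symm (algebraMap K E c) = algebraMap K E c')
    (hinj : ∀ g ∈ s, ∀ g' ∈ s, pencil K g = pencil K g' → g = g')
    (hcov : ∀ g ∈ s, ∃ g' ∈ s, pencil K g' = pencil K (φ g)) :
    ∀ x ∈ ∏ g ∈ s, pencil K g, φ x ∈ ∏ g ∈ s, pencil K g := by
  classical
  choose! π hπ hπφ using hcov
  have hπinj : Set.InjOn π s := fun x hx y hy hxy => hinj x hx y hy <|
    pencil_eq_of_pencil_map_eq hφ' (by rw [← hπφ x hx, ← hπφ y hy, hxy])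
  have hprod : ∏ g ∈ s, pencil K (φ g) = ∏ g ∈ s, pencil K g :=
    Finset.prod_nbij π hπ hπinj (Finset.surjOn_of_injOn_of_card_le π hπ hπinj le_rfl)
      fun g hg => (hπφ g hg).symm
  intro x hx
  exact hprod ▸ map_mem_prod (φ := (φ : E →+* E)) hφ s (pencil K) (fun g => pencil K (φ g))
    (fun g _ x hx => map_mem_pencil (φ := (φ : E →+* E)) hφ hx) x hx

theorem exists_transcendental_finrank_le_sq [Algebra.IsPushout k₀ K F₀ E] [IsAlgClosed K]
    [Algebra.IsAlgebraic k₀ K] [IsGalois k₀ K] (O : ValuationSubring F₀)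
    (hO : ∀ c : k₀, O.valuation (algebraMap k₀ F₀ c) ≤ 1)
    (hres : ∀ x : F₀, O.valuation x ≤ 1 → ∃ c : k₀, O.valuation (x - algebraMap k₀ F₀ c) < 1)
    {d : ℕ} (hd : 3 ≤ d) {f : E} (hf : Transcendental K f) [FiniteDimensional K⟮f⟯ E]
    (hfd : Module.finrank K⟮f⟯ E ≤ d) :
    ∃ h : F₀, Transcendental k₀ h ∧ Module.finrank k₀⟮h⟯ F₀ ≤ (d - 1) ^ 2 := by
  classical
  have hinf : Infinite K := IsAlgClosed.instInfinite
  obtain ⟨A, hA1, hAlt⟩ := exists_valuationSubring_dominating (E := E) O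
  have hAk : ∀ c : K, A.valuation (algebraMap K E c) ≤ 1 :=
    valuation_algebraMap_le_one (k₀ := k₀) fun c => by
      rw [IsScalarTower.algebraMap_apply k₀ F₀ E]
      exact hA1 _ (hO c)
  obtain ⟨f₁, hff₁, hf₁, hvf₁⟩ := exists_adjoin_eq_one_lt_valuation (K := K)
    (fun x hx => exists_valuation_sub_lt_one hO hres hAk hAlt hx) hf
  have hfin₁ : FiniteDimensional K⟮f₁⟯ E := by rwa [hff₁]
  rw [← hff₁] at hfd
  have hφ : ∀ (φ : E ≃ₐ[F₀] E) (c : K), ∃ c' : K, φ (algebraMap K E c) = algebraMap K E c' :=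
    fun φ c => exists_algEquiv_algebraMap_eq (k₀ := k₀) φ c
  obtain ⟨s, hne, hs, hinj, hcov⟩ := exists_orbit_representatives (k₀ := k₀) (F₀ := F₀) (K := K) f₁
  have htr : ∀ g ∈ s, Transcendental K g := by
    intro g hg
    obtain ⟨φ, rfl⟩ := hs g hg
    exact transcendental_algEquiv (k₀ := k₀) φ hf₁
  have hdeg : ∀ g ∈ s, Module.finrank K⟮g⟯ E = Module.finrank K⟮f₁⟯ E := by
    intro g hg
    obtain ⟨φ, rfl⟩ := hs g hg
    exact finrank_adjoin_map (φ := (φ : E ≃+* E)) (hφ φ) (hφ φ.symm) f₁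
  have hpos : 0 < Module.finrank K⟮f₁⟯ E := Module.finrank_pos
  have hfd' : ∀ g ∈ s, FiniteDimensional K⟮g⟯ E := fun g hg =>
    Module.finite_of_finrank_pos ((hdeg g hg).symm ▸ hpos)
  have hval : ∀ g ∈ s, 1 < A.valuation g := by
    intro g hg
    obtain ⟨φ, rfl⟩ := hs g hg
    rwa [valuation_algEquiv hO hres hAk hAlt]
  have hcov' : ∀ φ : E ≃ₐ[F₀] E, ∀ g ∈ s, ∃ g' ∈ s, pencil K g' = pencil K (φ g) := by
    intro φ g hg
    obtain ⟨ψ, rfl⟩ := hs g hg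
    exact hcov (ψ.trans φ)
  obtain ⟨N, a, q, hN, hslope, ha, hq⟩ := exists_slope_bound hpos hfd hd hne htr hfd' hdeg
    fun g hg g' hg' hgg' h => hgg' <| hinj g hg g' hg' <|
      pencil_eq_of_adjoin_eq hAk (htr g hg) (htr g' hg') (hfd' g hg) (hval g hg) (hval g' hg') h
  obtain ⟨g, hg⟩ := hne
  have hfing : FiniteDimensional K⟮g⟯ E := hfd' g hg
  have h2 := two_le_finrank_prod_pow hg (htr g hg) hN
  set V : Submodule K E := (∏ g ∈ s, pencil K g) ^ N with hV
  set M : IntermediateField K E := adjoin K (s : Set E) with hM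
  have hVpow : V = ∏ g ∈ s, pencil K g ^ N := by rw [hV, Finset.prod_pow]
  have hVfg : V.FG := hVpow ▸ fg_prod_pencil s fun _ => N
  have hVM : ∀ x ∈ V, x ∈ M := hVpow ▸ mem_adjoin_of_mem_prod_pencil s fun _ => N
  have hVst : ∀ φ : E ≃ₐ[F₀] E, ∀ x ∈ V, φ x ∈ V := fun φ =>
    map_mem_pow (φ := ((φ : E ≃+* E) : E →+* E)) (hφ φ)
      (prod_pencil_stable (φ := (φ : E ≃+* E)) (hφ φ) (hφ φ.symm) hinj (hcov' φ)) N
  have hMst : ∀ φ : E ≃ₐ[F₀] E, ∀ x ∈ M, φ x ∈ M := fun φ =>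
    map_mem_adjoin (φ := ((φ : E ≃+* E) : E →+* E)) (hφ φ) fun g hg => by
      obtain ⟨g', hg', h⟩ := hcov' φ g hg
      have h3 : φ g ∈ pencil K g' := h ▸ self_mem_pencil _
      obtain ⟨b, c, hbc⟩ := mem_pencil.mp h3
      change φ g ∈ M
      rw [hbc]
      exact add_mem (IntermediateField.algebraMap_mem _ _)
        (mul_mem (IntermediateField.algebraMap_mem _ _) (subset_adjoin K _ hg'))
  have hgM : K⟮g⟯ ≤ M := adjoin_simple_le_iff.mpr (subset_adjoin K _ hg)
  obtain ⟨-, -, -, hMpos⟩ := exists_mul_finrank_eq hgM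
  have hMfin : FiniteDimensional M E := Module.finite_of_finrank_pos hMpos
  have hrank := finrank_le_finrank_rational k₀ F₀ hVfg hVst
  obtain ⟨h, hh, hhd⟩ := exists_transcendental_finrank_le O.valuation hO hres
    (fg_rational (k₀ := k₀) (F₀ := F₀) hVfg)
    (M := rationalField k₀ F₀ M) (fun x hx => hVM _ hx) (h2.trans hrank)
    (HasSlope.rational hVfg hslope) (ha.trans (Nat.add_le_add_right hrank q))
  refine ⟨h, hh, hhd.trans (le_trans ?_ hq)⟩
  rw [mul_comm]
  exact Nat.mul_le_mul_right _ (finrank_rationalField_le hMst)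

end Assembly

section BaseChange

variable {k₀ F₀ L K E₁ E : Type*} [Field k₀] [Field F₀] [Field L] [Field K] [Field E₁] [Field E]
  [Algebra k₀ F₀] [Algebra k₀ L] [Algebra k₀ K]
  [Algebra k₀ E₁] [Algebra F₀ E₁] [Algebra L E₁] [IsScalarTower k₀ F₀ E₁] [IsScalarTower k₀ L E₁]
  [Algebra k₀ E] [Algebra F₀ E] [Algebra K E] [IsScalarTower k₀ F₀ E] [IsScalarTower k₀ K E]

theorem exists_transcendental_finrank_le_of_algHom [Algebra.IsPushout k₀ L F₀ E₁]
    [Algebra.IsPushout k₀ K F₀ E] [Algebra.IsAlgebraic k₀ K] (σ : L →ₐ[k₀] K) {f : E₁}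
    (hf : Transcendental L f) [FiniteDimensional L⟮f⟯ E₁] :
    ∃ g : E, Transcendental K g ∧ FiniteDimensional K⟮g⟯ E ∧
      Module.finrank K⟮g⟯ E ≤ Module.finrank L⟮f⟯ E₁ := by
  let j : E₁ →ₐ[k₀] E := Algebra.pushoutDesc E₁ ((IsScalarTower.toAlgHom k₀ K E).comp σ)
    (IsScalarTower.toAlgHom k₀ F₀ E) fun x y => mul_comm _ _
  have hjL : ∀ c : L, j (algebraMap L E₁ c) = algebraMap K E (σ c) := fun c =>
    Algebra.pushoutDesc_left E₁ _ _ _ c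
  have hjF : ∀ y : F₀, j (algebraMap F₀ E₁ y) = algebraMap F₀ E y := fun y =>
    Algebra.pushoutDesc_right E₁ _ _ _ y
  have hadj : ∀ x ∈ L⟮f⟯, j x ∈ K⟮j f⟯ := map_mem_adjoin (φ := (j : E₁ →+* E))
    (fun c => ⟨σ c, hjL c⟩) (by rintro _ rfl; exact mem_adjoin_simple_self K _)
  let b := Module.finBasis L⟮f⟯ E₁
  set S : Submodule K⟮j f⟯ E := Submodule.span K⟮j f⟯ (Set.range fun i => j (b i)) with hS
  have hjS : ∀ x, j x ∈ S := by
    intro x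
    rw [← b.sum_repr x, map_sum]
    refine Submodule.sum_mem _ fun i _ => ?_
    have h1 : j (b.repr x i • b i) =
        (⟨j (b.repr x i), hadj _ (b.repr x i).2⟩ : K⟮j f⟯) • j (b i) := by
      rw [Algebra.smul_def, map_mul]
      rfl
    rw [h1]
    exact Submodule.smul_mem _ _ (Submodule.subset_span ⟨i, rfl⟩)
  have htop : S = ⊤ := by
    refine eq_top_iff.mpr fun x _ => ?_
    have hx : x ∈ Submodule.span K (Set.range (algebraMap F₀ E)) := by
      rw [span_range_algebraMap (k₀ := k₀)]
      exact Submodule.mem_top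
    refine (Submodule.span_le (p := S.restrictScalars K)).mpr ?_ hx
    rintro _ ⟨y, rfl⟩
    exact hjF y ▸ hjS _
  refine ⟨j f, fun h => hf ?_, ?_, ?_⟩
  · have h1 : IsAlgebraic k₀ (j f) := h.restrictScalars k₀
    exact ((isAlgebraic_algHom_iff j (RingHom.injective (j : E₁ →+* E))).mp h1).tower_top L
  · have h1 : S.FG := Submodule.fg_span (Set.finite_range _)
    rw [htop] at h1
    exact ⟨h1⟩
  · have h1 := finrank_range_le_card (R := K⟮j f⟯) fun i => j (b i)
    rw [Set.finrank, ← hS, htop, finrank_top, Fintype.card_fin] at h1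
    exact h1

end BaseChange

section Place

open IsLocalRing

theorem exists_valuation_sub_algebraMap_lt_one {k₀ F₀ : Type*} [Field k₀] [Field F₀]
    [Algebra k₀ F₀] (P : FFPlace k₀ F₀) (hP : P.degree = 1) {x : F₀}
    (hx : P.asSubring.valuation x ≤ 1) :
    ∃ c : k₀, P.asSubring.valuation (x - algebraMap k₀ F₀ c) < 1 := by
  let ι : k₀ →+* P.asSubring :=
    (algebraMap k₀ F₀).codRestrict P.asSubring.toSubring P.algebraMap_mem
  let alg : Algebra k₀ (ResidueField P.asSubring) := ((residue P.asSubring).comp ι).toAlgebra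
  have h1 : Module.finrank k₀ (ResidueField P.asSubring) = 1 := hP
  let x' : P.asSubring := ⟨x, (P.asSubring.valuation_le_one_iff x).mp hx⟩
  obtain ⟨c, hc⟩ := (finrank_eq_one_iff_of_nonzero' (1 : ResidueField P.asSubring)
    one_ne_zero).mp h1 (residue P.asSubring x')
  refine ⟨c, ?_⟩
  have h2 : residue P.asSubring (x' - ι c) = 0 := by
    rw [map_sub, ← hc, Algebra.smul_def, mul_one]
    exact sub_self _
  have h3 := (residue_eq_zero_iff _).mp h2
  exact (P.asSubring.valuation_lt_one_iff _).mp h3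

end Place

section FractionRing

open TensorProduct

attribute [local instance] Algebra.TensorProduct.rightAlgebra

theorem bijective_algebraMap_fractionRing (k₀ L F₀ : Type*) [Field k₀] [Field F₀] [Field L]
    [Algebra k₀ F₀] [Algebra k₀ L] [Algebra.IsAlgebraic k₀ L] [IsDomain (L ⊗[k₀] F₀)] :
    Function.Bijective (algebraMap (L ⊗[k₀] F₀) (FractionRing (L ⊗[k₀] F₀))) := by
  have h_integral : Algebra.IsIntegral F₀ (L ⊗[k₀] F₀) := Algebra.IsPushout.isIntegral k₀ F₀ L _
  exact ⟨IsFractionRing.injective _ _, IsFractionRing.surjective_iff_isField.mpr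
    (isField_of_isIntegral_of_isField' (Field.toIsField F₀))⟩

theorem exists_isPushout {k₀ L F₀ E : Type*} [Field k₀] [Field F₀] [Field L] [Field E]
    [Algebra k₀ F₀] [Algebra k₀ L] [Algebra L E] [Algebra (L ⊗[k₀] F₀) E]
    [IsScalarTower L (L ⊗[k₀] F₀) E]
    (hbij : Function.Bijective (algebraMap (L ⊗[k₀] F₀) E)) :
    ∃ (_ : Algebra k₀ E) (_ : Algebra F₀ E) (_ : IsScalarTower k₀ F₀ E) (_ : IsScalarTower k₀ L E),
      Algebra.IsPushout k₀ L F₀ E := by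
  let _ : Algebra k₀ E := ((algebraMap L E).comp (algebraMap k₀ L)).toAlgebra
  let _ : Algebra F₀ E := ((algebraMap (L ⊗[k₀] F₀) E).comp (algebraMap F₀ (L ⊗[k₀] F₀))).toAlgebra
  have h1 : IsScalarTower k₀ L E := .of_algebraMap_eq fun _ => rfl
  have h2 : IsScalarTower k₀ F₀ E := .of_algebraMap_eq fun c => by
    rw [IsScalarTower.algebraMap_apply k₀ L E, IsScalarTower.algebraMap_apply L (L ⊗[k₀] F₀) E,
      ← IsScalarTower.algebraMap_apply k₀ L, IsScalarTower.algebraMap_apply k₀ F₀ (L ⊗[k₀] F₀)]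
    rfl
  exact ⟨_, _, h2, h1, Algebra.IsPushout.of_equiv
    (AlgEquiv.ofBijective (IsScalarTower.toAlgHom L (L ⊗[k₀] F₀) E) hbij) rfl⟩

end FractionRing

section Main

open TensorProduct

theorem exists_transcendental_finrank_le_sq_of_baseChange {k₀ F₀ L K E₁ E : Type*} [Field k₀]
    [PerfectField k₀] [Field F₀] [Field L] [Field K] [Field E₁] [Field E] [Algebra k₀ F₀]
    [Algebra k₀ L] [Algebra k₀ K] [Algebra L E₁] [Algebra K E]
    [Algebra (L ⊗[k₀] F₀) E₁] [Algebra (K ⊗[k₀] F₀) E] [IsScalarTower L (L ⊗[k₀] F₀) E₁]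
    [IsScalarTower K (K ⊗[k₀] F₀) E] [Algebra.IsAlgebraic k₀ L] [IsAlgClosure k₀ K]
    (hL : Function.Bijective (algebraMap (L ⊗[k₀] F₀) E₁))
    (hK : Function.Bijective (algebraMap (K ⊗[k₀] F₀) E))
    (P : FFPlace k₀ F₀) (hP : P.degree = 1) {f : E₁} (hf : Transcendental L f)
    (h2 : 2 < Module.finrank L⟮f⟯ E₁) :
    ∃ h : F₀, Transcendental k₀ h ∧
      Module.finrank k₀⟮h⟯ F₀ ≤ (Module.finrank L⟮f⟯ E₁ - 1) ^ 2 := by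
  obtain ⟨_, _, _, _, _⟩ := exists_isPushout hL
  obtain ⟨_, _, _, _, _⟩ := exists_isPushout hK
  have hclosed : IsAlgClosed K := IsAlgClosure.isAlgClosed k₀
  have halg : Algebra.IsAlgebraic k₀ K := IsAlgClosure.isAlgebraic
  have hgal : IsGalois k₀ K := { to_normal := normal_iff.mpr fun x =>
    ⟨Algebra.IsIntegral.isIntegral x, IsAlgClosed.splits _⟩ }
  have hfin : FiniteDimensional L⟮f⟯ E₁ := Module.finite_of_finrank_pos (by lia)
  obtain ⟨g, hg, hgfin, hgd⟩ := exists_transcendental_finrank_le_of_algHom (F₀ := F₀) (E := E)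
    (IsAlgClosed.lift (R := k₀) : L →ₐ[k₀] K) hf
  exact exists_transcendental_finrank_le_sq P.asSubring
    (fun c => (P.asSubring.valuation_le_one_iff _).mpr (P.algebraMap_mem c))
    (fun x hx => exists_valuation_sub_algebraMap_lt_one P hP hx) h2 hg hgd

end Main

end GonalityAux

/-- let `X` be a geometrically integral curve over a perfect field `k` with
function field `F = k(X)`, let `L ⊇ k` be an algebraic field extension, and let
`d = γ_L(X)` (the gonality of the function field `Frac(L ⊗_k F)` of `X_L` over `L`).
If `X` has a `k`-rational point (a place of degree 1) and `d > 2`, then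
`γ_k(X) ≤ (d - 1)²`. -/
theorem gonality_le_sq_of_baseChange_gt_two
    (k F L : Type*) [Field k] [Field F] [Algebra k F] [PerfectField k]
    (hF : IsFunctionField k F)
    [IsDomain (TensorProduct k (AlgebraicClosure k) F)]
    [Field L] [Algebra k L] [Algebra.IsAlgebraic k L]
    [IsDomain (TensorProduct k L F)]
    (hP : ∃ P : FFPlace k F, P.degree = 1) :
    letI : Algebra L (FractionRing (TensorProduct k L F)) :=
      ((algebraMap (TensorProduct k L F) (FractionRing (TensorProduct k L F))).comp
        (algebraMap L (TensorProduct k L F))).toAlgebra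
    2 < gonality L (FractionRing (TensorProduct k L F)) →
      gonality k F ≤ (gonality L (FractionRing (TensorProduct k L F)) - 1) ^ 2 := by
  intro h2
  let inst : Algebra L (FractionRing (TensorProduct k L F)) :=
    ((algebraMap (TensorProduct k L F) (FractionRing (TensorProduct k L F))).comp
      (algebraMap L (TensorProduct k L F))).toAlgebra
  have htower : @IsScalarTower L (TensorProduct k L F) (FractionRing (TensorProduct k L F))
      Algebra.toSMul Algebra.toSMul inst.toSMul := .of_algebraMap_eq fun _ => rfl
  obtain ⟨P, hP⟩ := hP
  obtain ⟨f, hf, hfd⟩ := Nat.sInf_mem (Nat.nonempty_of_pos_sInf (two_pos.trans h2))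
  obtain ⟨h, hh, hhd⟩ := GonalityAux.exists_transcendental_finrank_le_sq_of_baseChange
    (E := FractionRing (TensorProduct k (AlgebraicClosure k) F))
    (GonalityAux.bijective_algebraMap_fractionRing k L F)
    (GonalityAux.bijective_algebraMap_fractionRing k (AlgebraicClosure k) F)
    P hP hf (h2.trans_eq hfd.symm)
  have h3 : gonality k F ≤ Module.finrank k⟮h⟯ F := Nat.sInf_le ⟨h, hh, rfl⟩
  exact h3.trans (hhd.trans_eq (congrArg (fun d => (d - 1) ^ 2) hfd))
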